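/- arXiv:1207.4719 — 10 statements merged into one kernel-verified Lean document; each statement's English description precedes it below -/
import Mathlib

section
/- Let φ(x) = c_1 x^{s_1} + … + c_l x^{s_l} be a real-exponent polynomial with at least two terms (l ≥ 2, all c_i nonzero real, the exponents s_i pairwise distinct positive reals), and let λ be a positive integer. Then φ^λ has at least λ + 1 terms: there do not exist an integer m ≤ λ, real numbers d_1, …, d_m, and pairwise distinct nonnegative reals t_1, …, t_m such that φ(x)^λ = ∑_{j=1}^m d_j x^{t_j} for all x ∈ (0,1). -/
open AddMonoidAlgebra in
/-- The Euler derivation on the group algebra. -/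
noncomputable def eulerD : AddMonoidAlgebra ℝ ℝ →+ AddMonoidAlgebra ℝ ℝ :=
  (Finsupp.liftAddHom fun t : ℝ =>
    (AddMonoidAlgebra.singleAddHom t).comp (AddMonoidHom.mulLeft t)).comp
    (AddMonoidAlgebra.coeffAddEquiv (R := ℝ) (M := ℝ)).toAddMonoidHom

theorem eulerD_single (t a : ℝ) :
    eulerD (AddMonoidAlgebra.single t a) = AddMonoidAlgebra.single t (t * a) := by
  simp [eulerD]

theorem eulerD_coeff (P : AddMonoidAlgebra ℝ ℝ) (t : ℝ) :
    (eulerD P).coeff t = t * P.coeff t := by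
  classical
  induction P using AddMonoidAlgebra.induction_linear with
  | zero => simp
  | add f g hf hg => simp [hf, hg, mul_add]
  | single u a =>
    rw [eulerD_single]
    simp only [AddMonoidAlgebra.coeff_single, Finsupp.single_apply]
    split_ifs with h
    · rw [h]
    · simp

theorem eulerD_mul (P Q : AddMonoidAlgebra ℝ ℝ) :
    eulerD (P * Q) = eulerD P * Q + P * eulerD Q := by
  induction P using AddMonoidAlgebra.induction_linear with
  | zero => simp
  | add f g hf hg => rw [add_mul, map_add, hf, hg, map_add]; ring
  | single u a =>
    induction Q using AddMonoidAlgebra.induction_linear with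
    | zero => simp
    | add f g hf hg => rw [mul_add, map_add, hf, hg, map_add]; ring
    | single v b =>
      rw [AddMonoidAlgebra.single_mul_single, eulerD_single, eulerD_single, eulerD_single,
        AddMonoidAlgebra.single_mul_single, AddMonoidAlgebra.single_mul_single,
        ← AddMonoidAlgebra.single_add]
      congr 1
      ring

theorem pow_dvd_eulerD (φ : AddMonoidAlgebra ℝ ℝ) (k : ℕ) :
    ∀ P, φ ^ (k + 1) ∣ P → φ ^ k ∣ eulerD P := by
  induction k with
  | zero => intro P _; simp
  | succ k ih =>
    rintro P ⟨q, rfl⟩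
    have h : φ ^ (k + 1 + 1) * q = φ * (φ ^ (k + 1) * q) := by ring
    rw [h, eulerD_mul]
    refine dvd_add (Dvd.intro (eulerD φ * q) (by ring)) ?_
    have h2 : φ ^ (k + 1) = φ * φ ^ k := pow_succ' φ k
    have h3 := mul_dvd_mul_left φ (ih (φ ^ (k + 1) * q) (dvd_mul_right _ _))
    rwa [← h2] at h3

theorem dvd_monomial_of_pow_dvd (φ : AddMonoidAlgebra ℝ ℝ) (k : ℕ) :
    ∀ P : AddMonoidAlgebra ℝ ℝ, P ≠ 0 → φ ^ k ∣ P → P.coeff.support.card ≤ k →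
      ∃ Q : AddMonoidAlgebra ℝ ℝ, φ ∣ Q ∧ Q.coeff.support.card = 1 := by
  classical
  induction k with
  | zero =>
    intro P hP _ hc
    exfalso
    apply hP
    simpa using hc
  | succ k ih =>
    intro P hP hd hc
    by_cases h1 : P.coeff.support.card = 1
    · exact ⟨P, (dvd_pow_self φ (Nat.succ_ne_zero k)).trans hd, h1⟩
    have hne : P.coeff.support.Nonempty := by
      rw [Finsupp.support_nonempty_iff]
      simpa using hP
    obtain ⟨t, ht⟩ := hne
    have hsupp : (eulerD P - t • P).coeff.support = P.coeff.support.erase t := by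
      ext u
      have : (eulerD P - t • P).coeff u = (u - t) * P.coeff u := by
        simp [eulerD_coeff, sub_mul]
      rw [Finsupp.mem_support_iff, this, Finset.mem_erase, Finsupp.mem_support_iff,
        mul_ne_zero_iff, sub_ne_zero]
    have hcard := Finset.card_erase_of_mem ht
    have hpos := Finset.card_pos.mpr ⟨t, ht⟩
    refine ih (eulerD P - t • P) ?_ ?_ ?_
    · intro h0
      rw [h0] at hsupp
      rw [← hsupp] at hcard
      simp at hcard
      omega
    · exact dvd_sub (pow_dvd_eulerD φ k P hd)
        (((pow_dvd_pow φ (Nat.le_succ k)).trans hd).trans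
          ⟨algebraMap ℝ _ t, by rw [Algebra.smul_def, mul_comm]⟩)
    · rw [hsupp, hcard]; omega

theorem card_mul_ne_one (φ q : AddMonoidAlgebra ℝ ℝ) (hφ : 2 ≤ φ.coeff.support.card) :
    (φ * q).coeff.support.card ≠ 1 := by
  classical
  intro h
  have hq : q ≠ 0 := by rintro rfl; simp at h
  have hq1 : 1 ≤ q.coeff.support.card := by
    rw [Nat.one_le_iff_ne_zero]
    simpa using hq
  obtain ⟨p1, h1, p2, h2, hne, u1, u2⟩ :=
    TwoUniqueSums.uniqueAdd_of_one_lt_card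
      (A := φ.coeff.support) (B := q.coeff.support) (by nlinarith)
  rw [Finset.mem_product] at h1 h2
  have m : ∀ p : ℝ × ℝ, p.1 ∈ φ.coeff.support ∧ p.2 ∈ q.coeff.support →
      UniqueAdd φ.coeff.support q.coeff.support p.1 p.2 →
      p.1 + p.2 ∈ (φ * q).coeff.support := by
    intro p hp u
    rw [Finsupp.mem_support_iff, AddMonoidAlgebra.coeff_mul_add_of_uniqueAdd u]
    exact mul_ne_zero (Finsupp.mem_support_iff.mp hp.1) (Finsupp.mem_support_iff.mp hp.2)
  have e := Finset.card_le_one.mp h.le _ (m p1 h1 u1) _ (m p2 h2 u2)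
  have := u1 h2.1 h2.2 e.symm
  exact hne (Prod.ext this.1.symm this.2.symm)

/-- Evaluation at `exp u`. -/
noncomputable def evalExp (u : ℝ) : AddMonoidAlgebra ℝ ℝ →ₐ[ℝ] ℝ :=
  AddMonoidAlgebra.lift ℝ ℝ ℝ
    { toFun := fun t => Real.exp (u * t.toAdd)
      map_one' := by simp
      map_mul' := fun a b => by simp [mul_add, Real.exp_add] }

theorem evalExp_single (u t a : ℝ) :
    evalExp u (AddMonoidAlgebra.single t a) = a * Real.exp (u * t) := by
  simp [evalExp]

theorem eq_zero_of_evalExp (P : AddMonoidAlgebra ℝ ℝ) (h : ∀ u < 0, evalExp u P = 0) :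
    P = 0 := by
  classical
  have hli := linearIndependent_monoidHom (Multiplicative ℕ) ℝ
  let χ : ℝ → (Multiplicative ℕ →* ℝ) := fun t => powersHom ℝ (Real.exp (-t))
  have hχ : Function.Injective χ := by
    intro a b hab
    have := (powersHom ℝ).injective hab
    simpa using this
  have hli2 := hli.comp χ hχ
  rw [linearIndependent_iff'] at hli2
  have key := hli2 P.coeff.support (fun t => P.coeff t * Real.exp (-t)) (by
    ext n
    have hu := h (-(n.toAdd + 1 : ℝ)) (by
      have : (0 : ℝ) ≤ n.toAdd := Nat.cast_nonneg _
      linarith)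
    rw [← AddMonoidAlgebra.sum_coeff_single P, Finsupp.sum, map_sum] at hu
    simp only [evalExp_single] at hu
    simp only [Finset.sum_apply, Pi.smul_apply, smul_eq_mul, Function.comp, Pi.zero_apply]
    rw [← hu]
    refine Finset.sum_congr rfl fun t _ => ?_
    simp only [χ, powersHom_apply]
    rw [← Real.exp_nat_mul, mul_assoc, ← Real.exp_add]
    congr 2
    ring)
  ext t
  by_cases ht : t ∈ P.coeff.support
  · have := key t ht
    simpa using this
  · simpa using ht

/-- If `φ(x) = ∑ cᵢ x^{sᵢ}` is a real-exponent polynomial with at least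
two terms (all coefficients nonzero, exponents pairwise distinct positive reals) and
`lam ≥ 1` is an integer, then `φ^lam` has at least `lam + 1` terms: it cannot be written
on `(0,1)` as a real-exponent polynomial with at most `lam` terms. -/
theorem muntz_real_exponent_power_terms
    (l : ℕ) (hl : 2 ≤ l) (c : Fin l → ℝ) (s : Fin l → ℝ)
    (hc : ∀ i, c i ≠ 0) (hs : ∀ i, 0 < s i) (hsinj : Function.Injective s)
    (lam : ℕ) (hlam : 0 < lam) :
    ¬ ∃ (m : ℕ) (_ : m ≤ lam) (d : Fin m → ℝ) (t : Fin m → ℝ),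
        (∀ j, 0 ≤ t j) ∧ Function.Injective t ∧
        ∀ x ∈ Set.Ioo (0 : ℝ) 1,
          (∑ i, c i * x ^ (s i)) ^ lam = ∑ j, d j * x ^ (t j) := by
  classical
  rintro ⟨m, hm, d, t, -, -, h⟩
  let φ : AddMonoidAlgebra ℝ ℝ := ∑ i, AddMonoidAlgebra.single (s i) (c i)
  let f : AddMonoidAlgebra ℝ ℝ := ∑ j, AddMonoidAlgebra.single (t j) (d j)
  have hev : φ ^ lam = f := by
    rw [← sub_eq_zero]
    apply eq_zero_of_evalExp
    intro u hu
    have hx := h (Real.exp u) ⟨Real.exp_pos u, Real.exp_lt_one_iff.mpr hu⟩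
    simp only [← Real.exp_mul] at hx
    simp only [map_sub, map_pow, φ, f, map_sum, evalExp_single]
    rw [hx, sub_self]
  have hcoef : ∀ i, φ.coeff (s i) = c i := by
    intro i
    simp only [φ, AddMonoidAlgebra.coeff_sum, AddMonoidAlgebra.coeff_single,
      Finsupp.finsetSum_apply, Finsupp.single_apply, hsinj.eq_iff]
    simp
  have hφ : 2 ≤ φ.coeff.support.card := by
    have hsub : Finset.univ.image s ⊆ φ.coeff.support := by
      intro x hx
      obtain ⟨i, -, rfl⟩ := Finset.mem_image.mp hx
      rw [Finsupp.mem_support_iff, hcoef]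
      exact hc i
    have := Finset.card_le_card hsub
    rw [Finset.card_image_of_injective _ hsinj] at this
    simp at this
    omega
  have hφ0 : φ ≠ 0 := by
    intro h0
    rw [h0] at hφ
    simp at hφ
  have hf : f.coeff.support.card ≤ lam := by
    have hsub : f.coeff.support ⊆ Finset.univ.image t := by
      intro x hx
      by_contra hn
      rw [Finsupp.mem_support_iff] at hx
      apply hx
      simp only [f, AddMonoidAlgebra.coeff_sum, AddMonoidAlgebra.coeff_single,
        Finsupp.finsetSum_apply]
      refine Finset.sum_eq_zero fun j _ => ?_
      rw [Finsupp.single_apply, if_neg]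
      rintro rfl
      exact hn (Finset.mem_image_of_mem _ (Finset.mem_univ _))
    refine (Finset.card_le_card hsub).trans (Finset.card_image_le.trans ?_)
    simpa using hm
  obtain ⟨Q, ⟨q, rfl⟩, hQ⟩ := dvd_monomial_of_pow_dvd φ lam f
    (by rw [← hev]; exact pow_ne_zero _ hφ0) (by rw [hev]) hf
  exact card_mul_ne_one φ q hφ hQ
end

section
/- Let Λ = (λ_k)_{k≥1} be a strictly increasing sequence of positive real numbers with ∑_k 1/λ_k < ∞ and let 1 ≤ p < ∞. If a real-exponent polynomial f(x) = c_1 x^{s_1} + … + c_l x^{s_l} (all c_i nonzero, the s_i pairwise distinct positive reals) belongs to the Müntz space M^p_Λ, then every exponent s_1, …, s_l belongs to Λ. -/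
open MeasureTheory

/-- Lebesgue measure restricted to the unit interval `[0,1]`. -/
noncomputable def m01 : Measure ℝ := volume.restrict (Set.Icc (0 : ℝ) 1)

/-- `g` belongs to the linear span of the monomials `x ↦ x^{Λ k}`. -/
def inSpan (Λ : ℕ → ℝ) (g : ℝ → ℝ) : Prop :=
  ∃ (n : ℕ) (c : Fin n → ℝ) (k : Fin n → ℕ),
    ∀ x : ℝ, g x = ∑ i, c i * x ^ (Λ (k i))

/-- `f` belongs to the Müntz space `M^p_Λ`, i.e. to the closure in `L^p([0,1])` of the
linear span of the monomials `x ↦ x^{Λ k}`. -/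
def memMuntz (p : ℝ) (Λ : ℕ → ℝ) (f : ℝ → ℝ) : Prop :=
  ∀ ε : ℝ, 0 < ε → ∃ g : ℝ → ℝ, inSpan Λ g ∧
    eLpNorm (fun x => f x - g x) (ENNReal.ofReal p) m01 ≤ ENNReal.ofReal ε

/-- Quadratic form contraction. -/
lemma Q_step {ι : Type*} [Fintype ι] (b e : ι → ℝ) (hb : ∀ i, 0 < b i) (m : ℝ) (hm : 0 < m) :
    ∑ i, ∑ j, (e i * ((b i - m) / (b i + m))) * (e j * ((b j - m) / (b j + m))) / (b i + b j)
      ≤ ∑ i, ∑ j, e i * e j / (b i + b j) := by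
  have key : ∑ i, ∑ j, e i * e j / (b i + b j)
      - ∑ i, ∑ j, (e i * ((b i - m) / (b i + m))) * (e j * ((b j - m) / (b j + m))) / (b i + b j)
      = 2 * m * (∑ i, e i / (b i + m)) ^ 2 := by
    rw [sq, Finset.sum_mul_sum, Finset.mul_sum, ← Finset.sum_sub_distrib]
    refine Finset.sum_congr rfl fun i _ => ?_
    rw [Finset.mul_sum, ← Finset.sum_sub_distrib]
    refine Finset.sum_congr rfl fun j _ => ?_
    have h1 := hb i
    have h2 := hb j
    have h3 : b i + m ≠ 0 := by positivity
    have h4 : b j + m ≠ 0 := by positivity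
    have h5 : b i + b j ≠ 0 := by positivity
    field_simp
    ring
  have : 0 ≤ 2 * m * (∑ i, e i / (b i + m)) ^ 2 := by positivity
  linarith

lemma Q_prod {ι κ : Type*} [Fintype ι] (b : ι → ℝ) (hb : ∀ i, 0 < b i)
    (m : κ → ℝ) (hm : ∀ k, 0 < m k) (S : Finset κ) (e : ι → ℝ) :
    ∑ i, ∑ j, (e i * ∏ k ∈ S, ((b i - m k) / (b i + m k))) *
        (e j * ∏ k ∈ S, ((b j - m k) / (b j + m k))) / (b i + b j)
      ≤ ∑ i, ∑ j, e i * e j / (b i + b j) := by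
  classical
  induction S using Finset.induction_on with
  | empty => simp
  | insert a S ha ih =>
    refine le_trans (le_of_eq ?_) ((Q_step b _ hb (m a) (hm a)).trans ih)
    refine Finset.sum_congr rfl fun i _ => Finset.sum_congr rfl fun j _ => ?_
    rw [Finset.prod_insert ha, Finset.prod_insert ha]
    ring

lemma one_sub_sum_le_prod_aux {κ : Type*} (S : Finset κ) (x : κ → ℝ) (h0 : ∀ k ∈ S, 0 ≤ x k)
    (h1 : ∀ k ∈ S, x k ≤ 1) : 1 - ∑ k ∈ S, x k ≤ ∏ k ∈ S, (1 - x k) := by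
  classical
  induction S using Finset.induction_on with
  | empty => simp
  | insert a S ha ih =>
    rw [Finset.prod_insert ha, Finset.sum_insert ha]
    have ih' := ih (fun k hk => h0 k (Finset.mem_insert_of_mem hk))
      (fun k hk => h1 k (Finset.mem_insert_of_mem hk))
    have hP : ∏ k ∈ S, (1 - x k) ≤ 1 := Finset.prod_le_one
      (fun k hk => by linarith [h1 k (Finset.mem_insert_of_mem hk)])
      (fun k hk => by linarith [h0 k (Finset.mem_insert_of_mem hk)])
    nlinarith [h0 a (Finset.mem_insert_self a S)]

lemma prod_lower (Λ : ℕ → ℝ) (hpos : ∀ k, 0 < Λ k)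
    (hsum : Summable fun k => 1 / Λ k) (b : ℝ) (hb : 0 < b) (hne : ∀ k, b ≠ Λ k + 3 / 2) :
    ∃ δ > 0, ∃ N0 : ℕ, ∀ N ≥ N0,
      δ ≤ |∏ k ∈ Finset.range N, ((b - (Λ k + 3 / 2)) / (b + (Λ k + 3 / 2)))| := by
  have hx : Summable fun k => 2 * b / (b + (Λ k + 3 / 2)) := by
    refine Summable.of_nonneg_of_le (fun k => ?_) (fun k => ?_) (hsum.mul_left (2 * b))
    · have := hpos k; positivity
    · have := hpos k
      rw [mul_one_div]
      gcongr
      linarith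
  have ht := tendsto_sum_nat_add (fun k => 2 * b / (b + (Λ k + 3 / 2)))
  obtain ⟨N0, hN0⟩ := (ht.eventually (gt_mem_nhds (by norm_num : (0:ℝ) < 1 / 2))).exists
  have hxs := (summable_nat_add_iff N0).2 hx
  have hnn : ∀ k, 0 ≤ 2 * b / (b + (Λ k + 3 / 2)) := fun k => by
    have := hpos k; positivity
  refine ⟨(∏ k ∈ Finset.range N0, |(b - (Λ k + 3 / 2)) / (b + (Λ k + 3 / 2))|) * (1 / 2), ?_,
    N0, fun N hN => ?_⟩
  · refine mul_pos (Finset.prod_pos fun k _ => abs_pos.2 (div_ne_zero (sub_ne_zero.2 (hne k)) ?_))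
      (by norm_num)
    have := hpos k
    positivity
  · obtain ⟨M, rfl⟩ := Nat.exists_eq_add_of_le hN
    rw [Finset.abs_prod, Finset.prod_range_add]
    refine mul_le_mul_of_nonneg_left ?_ (Finset.prod_nonneg fun _ _ => abs_nonneg _)
    have hle : ∀ k, 2 * b / (b + (Λ (k + N0) + 3 / 2)) ≤ 1 / 2 := fun k =>
      (hxs.le_tsum k (fun j _ => hnn _)).trans hN0.le
    have h1 : 1 - ∑ k ∈ Finset.range M, 2 * b / (b + (Λ (k + N0) + 3 / 2)) ≤
        ∏ k ∈ Finset.range M, (1 - 2 * b / (b + (Λ (k + N0) + 3 / 2))) :=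
      one_sub_sum_le_prod_aux _ _ (fun k _ => hnn _) (fun k _ => by linarith [hle k])
    have h2 := (hxs.sum_le_tsum (Finset.range M) (fun j _ => hnn _)).trans hN0.le
    refine le_trans (by linarith) (h1.trans ?_)
    refine Finset.prod_le_prod (fun k _ => by linarith [hle k]) fun k _ => ?_
    rw [add_comm N0 k]
    refine le_trans (le_of_eq ?_) (neg_le_abs _)
    have := hpos (k + N0)
    have h3 : b + (Λ (k + N0) + 3 / 2) ≠ 0 := by positivity
    field_simp
    ring

lemma analytic {ι : Type*} [Fintype ι] (a e : ι → ℝ) (ha : ∀ i, 0 < a i) (p : ℝ) (hp : 1 ≤ p)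
    (ε : ℝ) (hε : 0 < ε)
    (h : eLpNorm (fun x => ∑ i, e i * x ^ (a i)) (ENNReal.ofReal p) m01 ≤ ENNReal.ofReal ε) :
    ∑ i, ∑ j, (e i / (a i + 1)) * (e j / (a j + 1)) / ((a i + 3 / 2) + (a j + 3 / 2)) ≤ ε ^ 2 := by
  set F : ℝ → ℝ := fun x => ∑ i, e i * x ^ (a i) with hF
  have hFc : Continuous F := by
    refine continuous_finsetSum _ fun i _ => continuous_const.mul ?_
    exact Real.continuous_rpow_const (ha i).le
  have hprob : IsProbabilityMeasure m01 := ⟨by simp [m01]⟩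
  have h1 : eLpNorm F 1 m01 ≤ ENNReal.ofReal ε := by
    refine (eLpNorm_le_eLpNorm_of_exponent_le ?_ hFc.aestronglyMeasurable).trans h
    rw [← ENNReal.ofReal_one]
    exact ENNReal.ofReal_le_ofReal hp
  have hint : ∀ u v : ℝ, IntervalIntegrable F volume u v := fun u v => hFc.intervalIntegrable u v
  have h2 : ∫ x in (0:ℝ)..1, |F x| ≤ ε := by
    rw [intervalIntegral.integral_of_le zero_le_one, ← integral_Icc_eq_integral_Ioc]
    have : ∫ x in Set.Icc (0:ℝ) 1, |F x| = (eLpNorm F 1 m01).toReal := by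
      rw [eLpNorm_one_eq_lintegral_enorm]
      exact integral_norm_eq_lintegral_enorm hFc.aestronglyMeasurable
    rw [this]
    exact ENNReal.toReal_le_of_le_ofReal hε.le h1
  set H : ℝ → ℝ := fun x => ∑ i, (e i / (a i + 1)) * x ^ (a i + 1) with hH
  have hHF : ∀ x, 0 ≤ x → ∫ t in (0:ℝ)..x, F t = H x := by
    intro x hx
    simp only [hF, hH]
    rw [intervalIntegral.integral_finsetSum]
    · refine Finset.sum_congr rfl fun i _ => ?_
      rw [intervalIntegral.integral_const_mul, integral_rpow (Or.inl (by linarith [ha i])),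
        Real.zero_rpow (by linarith [ha i])]
      ring
    · intro i _
      exact (continuous_const.mul (Real.continuous_rpow_const (ha i).le)).intervalIntegrable _ _
  have hHb : ∀ x ∈ Set.Icc (0:ℝ) 1, |H x| ≤ ε := by
    intro x hx
    rw [← hHF x hx.1]
    refine (intervalIntegral.abs_integral_le_integral_abs hx.1).trans (le_trans ?_ h2)
    exact intervalIntegral.integral_mono_interval le_rfl hx.1 hx.2
      (Filter.Eventually.of_forall fun t => abs_nonneg _) (hFc.abs.intervalIntegrable _ _)
  have hpc : ∀ i j, Continuous fun x : ℝ => x ^ (a i + 1 + (a j + 1)) := fun i j =>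
    Real.continuous_rpow_const (by linarith [ha i, ha j])
  have hG : ∫ x in (0:ℝ)..1, (∑ i, ∑ j, (e i / (a i + 1)) * (e j / (a j + 1)) *
      x ^ (a i + 1 + (a j + 1))) =
      ∑ i, ∑ j, (e i / (a i + 1)) * (e j / (a j + 1)) / ((a i + 3 / 2) + (a j + 3 / 2)) := by
    rw [intervalIntegral.integral_finsetSum]
    · refine Finset.sum_congr rfl fun i _ => ?_
      rw [intervalIntegral.integral_finsetSum]
      · refine Finset.sum_congr rfl fun j _ => ?_
        rw [intervalIntegral.integral_const_mul,
          integral_rpow (Or.inl (by linarith [ha i, ha j])),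
          Real.zero_rpow (by linarith [ha i, ha j]), Real.one_rpow]
        rw [show a i + 1 + (a j + 1) + 1 = (a i + 3 / 2) + (a j + 3 / 2) by ring]
        ring
      · intro j _
        exact (continuous_const.mul (hpc i j)).intervalIntegrable _ _
    · intro i _
      exact (continuous_finsetSum _ fun j _ =>
        continuous_const.mul (hpc i j)).intervalIntegrable _ _
  rw [← hG]
  have hle : ∀ x ∈ Set.Icc (0:ℝ) 1, (∑ i, ∑ j, (e i / (a i + 1)) * (e j / (a j + 1)) *
      x ^ (a i + 1 + (a j + 1))) ≤ ε ^ 2 := by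
    intro x hx
    have : (∑ i, ∑ j, (e i / (a i + 1)) * (e j / (a j + 1)) *
      x ^ (a i + 1 + (a j + 1))) = (H x) ^ 2 := by
      rw [sq, hH]
      simp only
      rw [Finset.sum_mul_sum]
      refine Finset.sum_congr rfl fun i _ => Finset.sum_congr rfl fun j _ => ?_
      rw [Real.rpow_add_of_nonneg hx.1 (by linarith [ha i]) (by linarith [ha j])]
      ring
    rw [this]
    exact sq_le_sq' (abs_le.1 (hHb x hx)).1 (abs_le.1 (hHb x hx)).2
  have := intervalIntegral.integral_mono_on (μ := volume) zero_le_one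
    ((continuous_finsetSum _ fun i _ => continuous_finsetSum _ fun j _ =>
        continuous_const.mul (hpc i j)).intervalIntegrable _ _)
    (continuous_const.intervalIntegrable _ _) hle
  simpa using this

/-- If a real-exponent polynomial `∑ cᵢ x^{sᵢ}` (nonzero coefficients,
pairwise distinct positive exponents) belongs to the Müntz space `M^p_Λ`, then every
exponent `sᵢ` belongs to `Λ`. -/
theorem muntz_polynomial_exponents_mem
    (p : ℝ) (hp : 1 ≤ p)
    (Λ : ℕ → ℝ) (hmono : StrictMono Λ) (hpos : ∀ k, 0 < Λ k)
    (hsum : Summable fun k => 1 / Λ k)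
    (l : ℕ) (c : Fin l → ℝ) (s : Fin l → ℝ)
    (hc : ∀ i, c i ≠ 0) (hs : ∀ i, 0 < s i) (hsinj : Function.Injective s)
    (hf : memMuntz p Λ fun x => ∑ i, c i * x ^ (s i)) :
    ∀ i, ∃ k, Λ k = s i := by
  intro i₀
  by_contra! hcon
  set B : ℝ := s i₀ + 3 / 2 with hB
  have hBpos : 0 < B := by have := hs i₀; positivity
  obtain ⟨δ, hδ, N0, hN0⟩ := prod_lower Λ hpos hsum B hBpos
    (fun k hk => hcon k (by linarith))
  set P : ℝ := ∏ j ∈ Finset.univ.erase i₀, ((B - (s j + 3 / 2)) / (B + (s j + 3 / 2))) with hP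
  have hP0 : P ≠ 0 := by
    refine Finset.prod_ne_zero_iff.2 fun j hj => div_ne_zero ?_ ?_
    · intro h
      exact (Finset.ne_of_mem_erase hj) (hsinj (by linarith))
    · have := hs j; positivity
  set C : ℝ := c i₀ / (s i₀ + 1) with hC
  have hC0 : C ≠ 0 := div_ne_zero (hc i₀) (by linarith [hs i₀])
  set η : ℝ := (C * (δ * P)) ^ 2 / (B + B) with hη
  have hη0 : 0 < η := by
    have : C * (δ * P) ≠ 0 := mul_ne_zero hC0 (mul_ne_zero hδ.ne' hP0)
    positivity
  obtain ⟨g, ⟨n, d, k, hg⟩, hle⟩ := hf (Real.sqrt (η / 2)) (Real.sqrt_pos.2 (by positivity))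
  let a : Fin l ⊕ Fin n → ℝ := Sum.elim s (fun i => Λ (k i))
  let e : Fin l ⊕ Fin n → ℝ := Sum.elim c (fun i => - d i)
  have ha : ∀ i, 0 < a i := by
    rintro (i | i)
    · exact hs i
    · exact hpos _
  have hfun : (fun x : ℝ => (∑ i, c i * x ^ (s i)) - g x) = fun x => ∑ i, e i * x ^ (a i) := by
    funext x
    simp [hg, a, e, sub_eq_add_neg]
  have h1 := analytic a e ha p hp _ (Real.sqrt_pos.2 (by positivity)) (hfun ▸ hle)
  rw [Real.sq_sqrt (by positivity)] at h1
  set N := N0 + ∑ i, (k i + 1) with hN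
  have hkN : ∀ i, k i < N := fun i => by
    have := Finset.single_le_sum (f := fun i => k i + 1) (fun _ _ => Nat.zero_le _)
      (Finset.mem_univ i)
    omega
  let m : ℕ ⊕ Fin l → ℝ := Sum.elim (fun k => Λ k + 3 / 2) (fun j => s j + 3 / 2)
  have hm : ∀ q, 0 < m q := by
    rintro (q | q)
    · have := hpos q; simp only [m, Sum.elim_inl]; positivity
    · have := hs q; simp only [m, Sum.elim_inr]; positivity
  let S : Finset (ℕ ⊕ Fin l) := (Finset.range N).disjSum (Finset.univ.erase i₀)
  have h2 := Q_prod (fun i => a i + 3 / 2) (fun i => by have := ha i; positivity) m hm S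
    (fun i => e i / (a i + 1))
  have hzero : ∀ i, i ≠ Sum.inl i₀ →
      ∏ q ∈ S, ((a i + 3 / 2 - m q) / (a i + 3 / 2 + m q)) = 0 := by
    rintro (i | i) hi
    · refine Finset.prod_eq_zero (i := Sum.inr i) ?_ ?_
      · simp only [S, Finset.inr_mem_disjSum, Finset.mem_erase, Finset.mem_univ, and_true]
        exact fun h => hi (by rw [h])
      · simp [a, m]
    · refine Finset.prod_eq_zero (i := Sum.inl (k i)) ?_ ?_
      · simp only [S, Finset.inl_mem_disjSum, Finset.mem_range]
        exact hkN i
      · simp [a, m]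
  rw [Finset.sum_eq_single (Sum.inl i₀) (fun i _ hi => by simp [hzero i hi]) (by simp),
    Finset.sum_eq_single (Sum.inl i₀) (fun i _ hi => by simp [hzero i hi]) (by simp)] at h2
  have h3 : η ≤ η / 2 := by
    refine le_trans ?_ (h2.trans h1)
    have hprod : ∏ q ∈ S, ((a (Sum.inl i₀) + 3 / 2 - m q) / (a (Sum.inl i₀) + 3 / 2 + m q)) =
        (∏ k ∈ Finset.range N, ((B - (Λ k + 3 / 2)) / (B + (Λ k + 3 / 2)))) * P := by
      simp only [S, Finset.prod_disjSum]
      rfl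
    simp only [hprod]
    change η ≤ (C * (_ * P)) * (C * (_ * P)) / (B + B)
    rw [hη, ← sq]
    refine div_le_div_of_nonneg_right ?_ (by positivity)
    rw [sq_le_sq, abs_mul, abs_mul, abs_mul, abs_mul, abs_of_pos hδ]
    have := hN0 N (Nat.le_add_right _ _)
    gcongr
  linarith
end

section
/- Suppose Λ = (λ_k)_{k≥1} is a strictly increasing sequence of positive integers with ∑_k 1/λ_k < ∞, 1 ≤ p < ∞, and φ is a real-exponent polynomial with at least two terms satisfying φ([0,1]) ⊆ [0,1]. Then the composition operator C_φ does not leave M^p_Λ invariant: there exists λ ∈ Λ such that the function x ↦ φ(x)^λ does not belong to M^p_Λ. -/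
open MeasureTheory

abbrev GP := AddMonoidAlgebra ℝ ℝ

noncomputable def gpD (f : GP) : GP :=
  AddMonoidAlgebra.ofCoeff (Finsupp.onFinset f.coeff.support (fun a => a * f.coeff a) (by
    intro a ha
    simp only [Finsupp.mem_support_iff]
    exact right_ne_zero_of_mul ha))

lemma gpD_coeff (f : GP) (a : ℝ) : (gpD f).coeff a = a * f.coeff a := rfl

lemma gpD_add (f g : GP) : gpD (f + g) = gpD f + gpD g := by
  ext a; simp [gpD_coeff, mul_add]

lemma gpD_single (a r : ℝ) : gpD (AddMonoidAlgebra.single a r) = AddMonoidAlgebra.single a (a * r) := by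
  ext b
  simp only [gpD_coeff, AddMonoidAlgebra.coeff_single, Finsupp.single_apply]
  split_ifs with h <;> simp [h]

lemma gpD_zero : gpD 0 = 0 := by
  ext a; simp [gpD_coeff]

lemma gpD_mul (f g : GP) : gpD (f * g) = gpD f * g + f * gpD g := by
  induction f using AddMonoidAlgebra.induction_linear with
  | zero => simp [gpD_zero]
  | add f f' hf hf' => simp only [add_mul, gpD_add, hf, hf']; ring
  | single a r =>
    induction g using AddMonoidAlgebra.induction_linear with
    | zero => simp [gpD_zero]
    | add f f' hf hf' => simp only [mul_add, gpD_add, hf, hf']; ring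
    | single b t =>
      simp only [AddMonoidAlgebra.single_mul_single, gpD_single, ← AddMonoidAlgebra.single_add]
      congr 1; ring

lemma gpD_pow_dvd (P : GP) (n : ℕ) : P ^ n ∣ gpD (P ^ (n + 1)) := by
  induction n with
  | zero => simp
  | succ n ih =>
    rw [pow_succ P (n+1), gpD_mul]
    refine dvd_add ?_ (Dvd.intro _ rfl)
    rw [pow_succ P n] at *
    exact mul_dvd_mul ih dvd_rfl

lemma gpL_dvd (P F : GP) (n : ℕ) (e : ℝ) (h : P ^ (n + 1) ∣ F) : P ^ n ∣ gpD F - e • F := by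
  obtain ⟨G, rfl⟩ := h
  rw [gpD_mul]
  have h1 : P ^ n ∣ P ^ (n+1) := pow_dvd_pow _ (Nat.le_succ n)
  refine dvd_sub (dvd_add ((gpD_pow_dvd P n).mul_right _) (h1.mul_right _)) ?_
  rw [← mul_smul_comm]
  exact h1.mul_right _

lemma gpL_many (P : GP) (A : Finset ℝ) : ∀ (n : ℕ) (F : GP), P ^ (n + A.card) ∣ F →
    ∃ G : GP, P ^ n ∣ G ∧ ∀ a, G.coeff a = (∏ e ∈ A, (a - e)) * F.coeff a := by
  classical
  induction A using Finset.induction_on with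
  | empty => intro n F h; exact ⟨F, by simpa using h, by simp⟩
  | insert e A he ih =>
    intro n F h
    rw [Finset.card_insert_of_notMem he] at h
    obtain ⟨G, hG, hG'⟩ := ih n (gpD F - e • F) (gpL_dvd P F _ e (by rwa [add_assoc]))
    refine ⟨G, hG, fun a => ?_⟩
    rw [hG', Finset.prod_insert he]
    simp [gpD_coeff]; ring

lemma gp_not_dvd_single (P : GP) (hP : 2 ≤ P.coeff.support.card) (e r : ℝ) (hr : r ≠ 0) :
    ¬ P ∣ AddMonoidAlgebra.single e r := by
  rintro ⟨G, hG⟩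
  have hG0 : G ≠ 0 := by
    rintro rfl
    rw [mul_zero] at hG
    have := congrArg (fun f : GP => f.coeff e) hG
    simp at this; exact hr this
  have hGc : 0 < G.coeff.support.card := by
    rw [Finset.card_pos, Finsupp.support_nonempty_iff]
    simpa using hG0
  obtain ⟨p1, h1, p2, h2, hne, u1, u2⟩ :=
    TwoUniqueSums.uniqueAdd_of_one_lt_card (A := P.coeff.support) (B := G.coeff.support) (by nlinarith)
  rw [Finset.mem_product] at h1 h2
  have key : ∀ p : ℝ × ℝ, p.1 ∈ P.coeff.support → p.2 ∈ G.coeff.support →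
      UniqueAdd P.coeff.support G.coeff.support p.1 p.2 → p.1 + p.2 = e := by
    intro p a b u
    by_contra hcon
    have h := AddMonoidAlgebra.coeff_mul_add_of_uniqueAdd u
    rw [← hG, AddMonoidAlgebra.coeff_single, Finsupp.single_apply, if_neg (fun h => hcon h.symm)] at h
    rw [Finsupp.mem_support_iff] at a b
    exact mul_ne_zero a b h.symm
  have e1 := key p1 h1.1 h1.2 u1
  have e2 := key p2 h2.1 h2.2 u2
  have := u1 h2.1 h2.2 (by rw [e1, e2])
  exact hne (Prod.ext this.1.symm this.2.symm)

lemma gp_card (P : GP) (hP : 2 ≤ P.coeff.support.card) (n : ℕ) :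
    n + 1 ≤ (P ^ n).coeff.support.card := by
  classical
  by_contra hcon
  push Not at hcon
  have hP0 : P ≠ 0 := by rintro rfl; simp at hP
  have hF0 : P ^ n ≠ 0 := pow_ne_zero _ hP0
  have hne : (P ^ n).coeff.support.Nonempty := by
    rw [Finsupp.support_nonempty_iff]; simpa using hF0
  obtain ⟨e, he⟩ := hne
  have hc := Finset.card_erase_add_one he
  obtain ⟨G, hG, hG'⟩ := gpL_many P ((P ^ n).coeff.support.erase e) 1 (P ^ n)
    (pow_dvd_pow _ (by omega))
  rw [pow_one] at hG
  have hs : G = AddMonoidAlgebra.single e (G.coeff e) := by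
    ext a
    rw [AddMonoidAlgebra.coeff_single, Finsupp.single_apply]
    split_ifs with h
    · rw [h]
    · rw [hG']
      by_cases ha : a ∈ (P ^ n).coeff.support
      · rw [Finset.prod_eq_zero (i := a), zero_mul]
        · exact Finset.mem_erase.2 ⟨fun h' => h h'.symm, ha⟩
        · ring
      · rw [Finsupp.notMem_support_iff.1 ha, mul_zero]
  rw [hs] at hG
  refine gp_not_dvd_single P hP _ _ ?_ hG
  rw [hG']
  refine mul_ne_zero (Finset.prod_ne_zero_iff.2 fun a ha => ?_) (Finsupp.mem_support_iff.1 he)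
  exact sub_ne_zero.2 fun h => (Finset.mem_erase.1 ha).1 h.symm

lemma gp_bound (P : GP) (M : ℝ) (hP : ∀ a ∈ P.coeff.support, 0 ≤ a ∧ a ≤ M) (n : ℕ) :
    ∀ a ∈ (P ^ n).coeff.support, 0 ≤ a ∧ a ≤ n * M := by
  classical
  induction n with
  | zero =>
    intro a ha
    rw [pow_zero] at ha
    have := AddMonoidAlgebra.support_coeff_one_subset ha
    simp at this; simp [this]
  | succ n ih =>
    intro a ha
    rw [pow_succ] at ha
    obtain ⟨b, hb, c, hc, rfl⟩ := Finset.mem_add.1 (AddMonoidAlgebra.support_coeff_mul_subset _ _ ha)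
    have := ih b hb
    have := hP c hc
    push_cast
    constructor <;> linarith

/-- evaluation at positive `x` -/
noncomputable def gpEv (x : ℝ) (hx : 0 < x) : GP →ₐ[ℝ] ℝ :=
  AddMonoidAlgebra.lift ℝ ℝ ℝ
    { toFun := fun a => x ^ (Multiplicative.toAdd a)
      map_one' := by simp
      map_mul' := fun a b => by simp [Real.rpow_add hx] }

lemma gpEv_eq (x : ℝ) (hx : 0 < x) (F : GP) :
    gpEv x hx F = ∑ a ∈ F.coeff.support, F.coeff a * x ^ a := by
  simp [gpEv, AddMonoidAlgebra.lift_apply, Finsupp.sum]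

lemma gpEv_single (x : ℝ) (hx : 0 < x) (a r : ℝ) :
    gpEv x hx (AddMonoidAlgebra.single a r) = r * x ^ a := by
  simp [gpEv]

noncomputable def cauchyQ (S : Finset ℝ) (u β : ℝ → ℝ) : ℝ :=
  ∑ r ∈ S, ∑ t ∈ S, β r * β t / (u r + u t)

lemma cauchyQ_step (S : Finset ℝ) (u β : ℝ → ℝ) (hu : ∀ r ∈ S, 0 < u r) (w : ℝ) (hw : 0 < w) :
    cauchyQ S u (fun r => (u r - w) / (u r + w) * β r) ≤ cauchyQ S u β := by
  have : cauchyQ S u β - cauchyQ S u (fun r => (u r - w) / (u r + w) * β r)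
      = 2 * w * (∑ r ∈ S, β r / (u r + w)) ^ 2 := by
    unfold cauchyQ
    rw [sq, Finset.sum_mul_sum, Finset.mul_sum, ← Finset.sum_sub_distrib]
    refine Finset.sum_congr rfl fun r hr => ?_
    rw [Finset.mul_sum, ← Finset.sum_sub_distrib]
    refine Finset.sum_congr rfl fun t ht => ?_
    have h1 := hu r hr
    have h2 := hu t ht
    have : u r + w ≠ 0 := by positivity
    have : u t + w ≠ 0 := by positivity
    have : u r + u t ≠ 0 := by positivity
    field_simp
    ring
  have : 0 ≤ 2 * w * (∑ r ∈ S, β r / (u r + w)) ^ 2 := by positivity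
  linarith

lemma cauchyQ_many (S A : Finset ℝ) (u : ℝ → ℝ) (hu : ∀ r ∈ S, 0 < u r) (hA : ∀ r ∈ A, 0 < u r) :
    ∀ β : ℝ → ℝ, cauchyQ S u (fun r => (∏ e ∈ A, (u r - u e) / (u r + u e)) * β r) ≤ cauchyQ S u β := by
  classical
  induction A using Finset.induction_on with
  | empty => intro β; simp
  | insert e A he ih =>
    intro β
    have h1 := ih (fun r hr => hA r (Finset.mem_insert_of_mem hr))
      (fun r => (u r - u e) / (u r + u e) * β r)
    refine le_trans (le_of_eq ?_) (h1.trans (cauchyQ_step S u β hu (u e) (hA e (Finset.mem_insert_self _ _))))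
    congr 1
    ext r
    rw [Finset.prod_insert he]; ring

lemma cauchyQ_lower (S : Finset ℝ) (u β : ℝ → ℝ) (hu : ∀ r ∈ S, 0 < u r) (q : ℝ) (hq : q ∈ S) :
    ((∏ e ∈ S.erase q, (u q - u e) / (u q + u e)) * β q) ^ 2 / (u q + u q) ≤ cauchyQ S u β := by
  classical
  refine le_trans (le_of_eq ?_) (cauchyQ_many S (S.erase q) u hu (fun r hr => hu r (Finset.mem_of_mem_erase hr)) β)
  have h0 : ∀ r ∈ S, r ≠ q → ∏ e ∈ S.erase q, (u r - u e) / (u r + u e) = 0 := by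
    intro r hr hrq
    exact Finset.prod_eq_zero (Finset.mem_erase.2 ⟨hrq, hr⟩) (by simp)
  unfold cauchyQ
  rw [Finset.sum_eq_single_of_mem q hq, Finset.sum_eq_single_of_mem q hq]
  · rw [sq]
  · intro t ht htq; simp [h0 t ht htq]
  · intro t ht htq; simp [h0 t ht htq]

lemma int_poly (S : Finset ℝ) (b : ℝ → ℝ) (hS : ∀ r ∈ S, 0 ≤ r) (y : ℝ) :
    ∫ x in (0:ℝ)..y, ∑ r ∈ S, b r * x ^ r = ∑ r ∈ S, b r / (r + 1) * y ^ (r + 1) := by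
  rw [intervalIntegral.integral_finsetSum]
  · refine Finset.sum_congr rfl fun r hr => ?_
    have := hS r hr
    rw [intervalIntegral.integral_const_mul, integral_rpow (Or.inl (by linarith)),
      Real.zero_rpow (by linarith)]
    ring
  · intro r hr
    exact (intervalIntegral.intervalIntegrable_rpow (Or.inl (hS r hr))).const_mul _

lemma poly_cont (S : Finset ℝ) (b : ℝ → ℝ) (hS : ∀ r ∈ S, 0 ≤ r) :
    Continuous fun x : ℝ => ∑ r ∈ S, b r * x ^ r := by
  refine continuous_finsetSum _ fun r hr => ?_
  exact continuous_const.mul (Real.continuous_rpow_const (hS r hr))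

lemma cauchyQ_upper (S : Finset ℝ) (b : ℝ → ℝ) (hS : ∀ r ∈ S, 0 ≤ r) (ε : ℝ)
    (h : ∫ x in (0:ℝ)..1, |∑ r ∈ S, b r * x ^ r| ≤ ε) :
    cauchyQ S (fun r => r + 3 / 2) (fun r => b r / (r + 1)) ≤ ε ^ 2 := by
  have hc := poly_cont S b hS
  have hε : ∀ y ∈ Set.Icc (0:ℝ) 1, |∑ r ∈ S, b r / (r + 1) * y ^ (r + 1)| ≤ ε := by
    intro y hy
    rw [← int_poly S b hS y]
    refine (intervalIntegral.abs_integral_le_integral_abs hy.1).trans (le_trans ?_ h)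
    exact intervalIntegral.integral_mono_interval le_rfl hy.1 hy.2
      (Filter.Eventually.of_forall fun x => abs_nonneg _) (hc.abs.intervalIntegrable _ _)
  have hcont : Continuous fun y : ℝ => ∑ r ∈ S, b r / (r + 1) * y ^ (r + 1) := by
    refine continuous_finsetSum _ fun r hr => ?_
    exact continuous_const.mul (Real.continuous_rpow_const (by linarith [hS r hr]))
  have h2 : ∫ y in (0:ℝ)..1, (∑ r ∈ S, b r / (r + 1) * y ^ (r + 1)) ^ 2 ≤ ∫ y in (0:ℝ)..1, ε ^ 2 := by
    refine intervalIntegral.integral_mono_on zero_le_one ((hcont.pow 2).intervalIntegrable _ _)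
      (continuous_const.intervalIntegrable _ _) fun y hy => ?_
    rw [← sq_abs]
    exact pow_le_pow_left₀ (abs_nonneg _) (hε y hy) 2
  have h3 : ∫ y in (0:ℝ)..1, (∑ r ∈ S, b r / (r + 1) * y ^ (r + 1)) ^ 2 =
      ∫ y in (0:ℝ)..1, ∑ r ∈ S, ∑ t ∈ S, b r / (r + 1) * (b t / (t + 1)) * y ^ (r + t + 2) := by
    refine intervalIntegral.integral_congr fun y hy => ?_
    rw [Set.uIcc_of_le zero_le_one] at hy
    rw [sq, Finset.sum_mul_sum]
    refine Finset.sum_congr rfl fun r hr => Finset.sum_congr rfl fun t ht => ?_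
    have := hS r hr
    have := hS t ht
    have hadd : y ^ (r + t + 2) = y ^ (r + 1) * y ^ (t + 1) := by
      rw [← Real.rpow_add_of_nonneg hy.1 (by linarith) (by linarith)]
      congr 1; ring
    rw [hadd]
    exact mul_mul_mul_comm _ _ _ _
  rw [h3] at h2
  simp only [intervalIntegral.integral_const, sub_zero, one_smul] at h2
  refine le_trans (le_of_eq ?_) h2
  have hi : ∀ r ∈ S, ∀ t ∈ S, IntervalIntegrable
      (fun y : ℝ => b r / (r + 1) * (b t / (t + 1)) * y ^ (r + t + 2)) volume 0 1 := by
    intro r hr t ht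
    exact (intervalIntegral.intervalIntegrable_rpow (Or.inl (by linarith [hS r hr, hS t ht]))).const_mul _
  rw [intervalIntegral.integral_finsetSum]
  · refine Finset.sum_congr rfl fun r hr => ?_
    rw [intervalIntegral.integral_finsetSum (hi r hr)]
    refine Finset.sum_congr rfl fun t ht => ?_
    have := hS r hr
    have := hS t ht
    rw [intervalIntegral.integral_const_mul, integral_rpow (Or.inl (by linarith)),
      Real.zero_rpow (by linarith), Real.one_rpow]
    rw [show r + 3 / 2 + (t + 3 / 2) = r + t + 2 + 1 by ring]
    ring
  · intro r hr
    refine (continuous_finsetSum _ fun t ht => ?_).intervalIntegrable _ _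
    exact continuous_const.mul (Real.continuous_rpow_const (by linarith [hS r hr, hS t ht]))

/-- lower bound of products -/
lemma prod_lower_s2 (S : Finset ℝ) (f : ℝ → ℝ) (h0 : ∀ r ∈ S, 0 ≤ f r) (h1 : ∀ r ∈ S, f r ≤ 1) :
    1 - ∑ r ∈ S, f r ≤ ∏ r ∈ S, (1 - f r) := by
  classical
  induction S using Finset.induction_on with
  | empty => simp
  | insert e A he ih =>
    rw [Finset.sum_insert he, Finset.prod_insert he]
    have a := ih (fun r hr => h0 r (Finset.mem_insert_of_mem hr)) (fun r hr => h1 r (Finset.mem_insert_of_mem hr))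
    have b := h0 e (Finset.mem_insert_self _ _)
    have c := h1 e (Finset.mem_insert_self _ _)
    have d : 0 ≤ ∑ r ∈ A, f r := Finset.sum_nonneg (fun r hr => h0 r (Finset.mem_insert_of_mem hr))
    nlinarith

lemma muntz_prod (Λ : ℕ → ℕ) (hmono : StrictMono Λ) (hpos : ∀ k, 0 < Λ k)
    (hsum : Summable fun k => 1 / (Λ k : ℝ)) (R : Finset ℝ) (hR : ∀ r ∈ R, 0 ≤ r) (q : ℝ) (hq : 0 ≤ q) :
    ∃ δ : ℝ, 0 < δ ∧ ∀ S : Finset ℝ, (∀ r ∈ S, r ∈ R ∨ ∃ k, r = Λ k) → q ∉ S →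
      δ ≤ ∏ e ∈ S, |((q + 3 / 2) - (e + 3 / 2)) / ((q + 3 / 2) + (e + 3 / 2))| := by
  classical
  obtain ⟨K, hK⟩ := summable_iff_vanishing_norm.1 (hsum.mul_left (2 * q + 3)) (1 / 2) (by norm_num)
  have hinj : Function.Injective (fun k => (Λ k : ℝ)) := by
    intro a b hab
    exact hmono.injective (Nat.cast_injective (R := ℝ) hab)
  let H : Finset ℝ := R ∪ K.image (fun k => (Λ k : ℝ))
  have hH : ∀ e ∈ H, 0 ≤ e := by
    intro e he
    rcases Finset.mem_union.1 he with h | h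
    · exact hR e h
    · obtain ⟨k, -, rfl⟩ := Finset.mem_image.1 h
      positivity
  let g : ℝ → ℝ := fun e => if e = q then 1 else |((q + 3 / 2) - (e + 3 / 2)) / ((q + 3 / 2) + (e + 3 / 2))|
  have hg0 : ∀ e, 0 ≤ e → 0 < g e := by
    intro e he
    by_cases h : e = q
    · simp [g, h]
    · simp only [g, if_neg h]
      refine abs_pos.2 (div_ne_zero ?_ (by positivity))
      intro h'; exact h (by linarith)
  have hg1 : ∀ e, 0 ≤ e → g e ≤ 1 := by
    intro e he
    by_cases h : e = q
    · simp [g, h]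
    · simp only [g, if_neg h]
      rw [abs_div, abs_of_pos (show 0 < q + 3 / 2 + (e + 3 / 2) by positivity),
        div_le_one (by positivity), abs_le]
      constructor <;> linarith
  refine ⟨(∏ e ∈ H, g e) * (1 / 2), mul_pos (Finset.prod_pos fun e he => hg0 e (hH e he)) (by norm_num), ?_⟩
  intro S hS hqS
  have e1 : ∏ e ∈ S, |((q + 3 / 2) - (e + 3 / 2)) / ((q + 3 / 2) + (e + 3 / 2))| = ∏ e ∈ S, g e := by
    refine Finset.prod_congr rfl fun e he => ?_
    have : e ≠ q := fun h => hqS (h ▸ he)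
    simp [g, this]
  rw [e1, ← Finset.prod_inter_mul_prod_sdiff S H g]
  have hHS : ∏ e ∈ H, g e ≤ ∏ e ∈ S ∩ H, g e := by
    rw [← Finset.prod_inter_mul_prod_sdiff H S g, Finset.inter_comm H S]
    refine mul_le_of_le_one_right (Finset.prod_nonneg fun e he => ?_) (Finset.prod_le_one ?_ ?_)
    · exact (hg0 e (hH e (Finset.mem_inter.1 he).2)).le
    · intro e he; exact (hg0 e (hH e (Finset.mem_sdiff.1 he).1)).le
    · intro e he; exact hg1 e (hH e (Finset.mem_sdiff.1 he).1)
  have htail : 1 / 2 ≤ ∏ e ∈ S \ H, g e := by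
    let T := (S \ H).preimage (fun k => (Λ k : ℝ)) hinj.injOn
    have hrange : ∀ e ∈ S \ H, ∃ k, k ∉ K ∧ e = Λ k := by
      intro e he
      obtain ⟨h1, h2⟩ := Finset.mem_sdiff.1 he
      rw [Finset.mem_union, not_or] at h2
      rcases hS e h1 with h | ⟨k, rfl⟩
      · exact absurd h h2.1
      · exact ⟨k, fun hk => h2.2 (Finset.mem_image_of_mem _ hk), rfl⟩
    have hTK : Disjoint T K := by
      rw [Finset.disjoint_left]
      intro k hk hkK
      have := Finset.mem_preimage.1 hk
      obtain ⟨k', h1, h2⟩ := hrange _ this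
      exact h1 (hinj h2 ▸ hkK)
    have hsumT := hK T hTK
    have e2 : ∑ k ∈ T, (2 * q + 3) * (1 / (Λ k : ℝ)) = ∑ e ∈ S \ H, (2 * q + 3) * (1 / e) := by
      refine Finset.sum_preimage (fun k => (Λ k : ℝ)) (S \ H) hinj.injOn (fun e => (2 * q + 3) * (1 / e)) ?_
      intro e he hn
      obtain ⟨k, -, rfl⟩ := hrange e he
      exact absurd ⟨k, rfl⟩ hn
    rw [e2] at hsumT
    have hlt := (le_abs_self _).trans_lt hsumT
    have hposSH : ∀ e ∈ S \ H, 0 < e := by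
      intro e he
      obtain ⟨k, -, rfl⟩ := hrange e he
      exact_mod_cast hpos k
    have hsmall : ∀ e ∈ S \ H, (2 * q + 3) * (1 / e) ≤ 1 / 2 := by
      intro e he
      refine le_trans ?_ hlt.le
      exact Finset.single_le_sum (f := fun e => (2 * q + 3) * (1 / e))
        (fun e he => by have := hposSH e he; positivity) he
    have hge : ∏ e ∈ S \ H, (1 - (2 * q + 3) * (1 / e)) ≤ ∏ e ∈ S \ H, g e := by
      refine Finset.prod_le_prod (fun e he => by linarith [hsmall e he]) fun e he => ?_
      have hne : e ≠ q := fun h => hqS (h ▸ (Finset.mem_sdiff.1 he).1)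
      have he0 := hposSH e he
      simp only [g, if_neg hne]
      refine le_trans ?_ (neg_le_abs _)
      have : -((q + 3 / 2 - (e + 3 / 2)) / (q + 3 / 2 + (e + 3 / 2))) = 1 - (2 * q + 3) * (1 / (q + e + 3)) := by
        have : q + 3 / 2 + (e + 3 / 2) = q + e + 3 := by ring
        rw [this]
        have : q + e + 3 ≠ 0 := by positivity
        field_simp
        ring
      rw [this]
      have : 1 / (q + e + 3) ≤ 1 / e := one_div_le_one_div_of_le he0 (by linarith)
      nlinarith
    refine le_trans ?_ hge
    refine le_trans ?_ (prod_lower_s2 (S \ H) (fun e => (2 * q + 3) * (1 / e))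
      (fun e he => by have := hposSH e he; positivity) (fun e he => by linarith [hsmall e he]))
    linarith
  exact mul_le_mul hHS htail (by norm_num) (Finset.prod_nonneg fun e he => (hg0 e (hH e (Finset.mem_inter.1 he).2)).le)

lemma m01_prob : IsProbabilityMeasure m01 := ⟨by simp [m01]⟩

lemma m01_ae_pos : ∀ᵐ x ∂m01, 0 < x := by
  have h1 : ∀ᵐ x ∂m01, x ∈ Set.Icc (0:ℝ) 1 := ae_restrict_mem measurableSet_Icc
  have h2 : ∀ᵐ x ∂m01, x ≠ 0 := ae_restrict_of_ae (Measure.ae_ne volume 0)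
  filter_upwards [h1, h2] with x a b
  exact lt_of_le_of_ne a.1 (Ne.symm b)

lemma L1_bound (p : ℝ) (hp : 1 ≤ p) (f h : ℝ → ℝ) (hh : Continuous h) (hfh : ∀ x, 0 < x → f x = h x)
    (ε : ℝ) (hε : 0 < ε) (hb : eLpNorm f (ENNReal.ofReal p) m01 ≤ ENNReal.ofReal ε) :
    ∫ x in (0:ℝ)..1, |h x| ≤ ε := by
  have := m01_prob
  have hae : f =ᵐ[m01] h := by
    filter_upwards [m01_ae_pos] with x hx using hfh x hx
  rw [eLpNorm_congr_ae hae] at hb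
  have h1 : eLpNorm h 1 m01 ≤ ENNReal.ofReal ε :=
    (eLpNorm_le_eLpNorm_of_exponent_le (by
      rw [← ENNReal.ofReal_one]; exact ENNReal.ofReal_le_ofReal hp) hh.aestronglyMeasurable).trans hb
  rw [intervalIntegral.integral_of_le zero_le_one, ← integral_Icc_eq_integral_Ioc]
  change ∫ x, ‖h x‖ ∂m01 ≤ ε
  rw [integral_norm_eq_lintegral_enorm hh.aestronglyMeasurable, ← eLpNorm_one_eq_lintegral_enorm]
  exact ENNReal.toReal_le_of_le_ofReal hε.le h1

lemma muntz_support (p : ℝ) (hp : 1 ≤ p) (Λ : ℕ → ℕ) (hmono : StrictMono Λ) (hpos : ∀ k, 0 < Λ k)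
    (hsum : Summable fun k => 1 / (Λ k : ℝ)) (F : GP) (hF : ∀ r ∈ F.coeff.support, 0 ≤ r)
    (f : ℝ → ℝ) (hf : ∀ x (hx : 0 < x), f x = gpEv x hx F)
    (hmem : memMuntz p (fun j => (Λ j : ℝ)) f) :
    ∀ q ∈ F.coeff.support, ∃ k, q = Λ k := by
  classical
  intro q hq
  by_contra hqΛ
  have hq0 := hF q hq
  have hFq := Finsupp.mem_support_iff.1 hq
  obtain ⟨δ, hδ, hprod⟩ := muntz_prod Λ hmono hpos hsum F.coeff.support hF q hq0
  set C : ℝ := (δ * |F.coeff q / (q + 1)|) ^ 2 / (q + 3 / 2 + (q + 3 / 2)) with hC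
  have hCpos : 0 < C := by
    have : 0 < |F.coeff q / (q + 1)| := abs_pos.2 (div_ne_zero hFq (by positivity))
    positivity
  obtain ⟨g, ⟨n, c, k, hg⟩, hb⟩ := hmem (√C / 2) (by positivity)
  let G : GP := F - ∑ i, AddMonoidAlgebra.single (Λ (k i) : ℝ) (c i)
  have hGc : ∀ a : ℝ, (∀ j, a ≠ (Λ j : ℝ)) → G.coeff a = F.coeff a := by
    intro a ha
    have : ∑ i, (Finsupp.single (Λ (k i) : ℝ) (c i)) a = 0 := by
      refine Finset.sum_eq_zero fun i _ => ?_
      rw [Finsupp.single_apply, if_neg (fun h => ha _ h.symm)]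
    simp [G, AddMonoidAlgebra.coeff_sum, this]
  have hGS : ∀ r ∈ G.coeff.support, r ∈ F.coeff.support ∨ ∃ j, r = Λ j := by
    intro r hr
    by_cases h : ∃ j, r = Λ j
    · exact Or.inr h
    · push Not at h
      left
      rw [Finsupp.mem_support_iff] at hr ⊢
      rwa [← hGc r h]
  have hG0 : ∀ r ∈ G.coeff.support, 0 ≤ r := by
    intro r hr
    rcases hGS r hr with h | ⟨j, rfl⟩
    · exact hF r h
    · positivity
  push Not at hqΛ
  have hGq := hGc q hqΛ
  have hqG : q ∈ G.coeff.support := by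
    rw [Finsupp.mem_support_iff, hGq]; exact hFq
  have hfg : ∀ x, 0 < x → f x - g x = ∑ r ∈ G.coeff.support, G.coeff r * x ^ r := by
    intro x hx
    rw [← gpEv_eq x hx, hf x hx, hg]
    simp only [G, map_sub, map_sum, gpEv_single]
  have hL1 := L1_bound p hp _ _ (poly_cont G.coeff.support G.coeff hG0) hfg _ (by positivity) hb
  have hup := cauchyQ_upper _ _ hG0 _ hL1
  have hlow := cauchyQ_lower G.coeff.support (fun r => r + 3 / 2) (fun r => G.coeff r / (r + 1))
    (fun r hr => by have := hG0 r hr; positivity) q hqG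
  have hpr := hprod (G.coeff.support.erase q) (fun r hr => hGS r (Finset.mem_of_mem_erase hr))
    (Finset.notMem_erase _ _)
  rw [← Finset.abs_prod] at hpr
  have hCle : C ≤ (√C / 2) ^ 2 := by
    refine le_trans ?_ (hlow.trans hup)
    simp only [hC, hGq]
    refine div_le_div_of_nonneg_right ?_ (by positivity)
    rw [← sq_abs (_ * (F.coeff q / (q + 1))), abs_mul]
    refine pow_le_pow_left₀ (by positivity) ?_ 2
    exact mul_le_mul_of_nonneg_right hpr (abs_nonneg _)
  rw [div_pow, Real.sq_sqrt hCpos.le] at hCle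
  linarith

lemma sparse (Λ : ℕ → ℕ) (hmono : StrictMono Λ) (hpos : ∀ k, 0 < Λ k)
    (hsum : Summable fun k => 1 / (Λ k : ℝ)) (M : ℝ) (hM : 0 < M) :
    ∃ k, (Λ k : ℝ) * M < Λ (Λ k) := by
  by_contra hcon
  push Not at hcon
  obtain ⟨s, hs⟩ := summable_iff_vanishing_norm.1 hsum (1 / (2 * M)) (by positivity)
  set k := 2 * (s.sup id) + 2 with hk
  set n := Λ k with hn
  have hkn : k ≤ n := hmono.le_apply
  have hdisj : Disjoint (Finset.Ioc (n / 2) n) s := by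
    rw [Finset.disjoint_left]
    intro j hj hjs
    have h1 : j ≤ s.sup id := Finset.le_sup (f := id) hjs
    have h2 := (Finset.mem_Ioc.1 hj).1
    omega
  have h := (le_abs_self _).trans_lt (hs _ hdisj)
  have hn0 : (0:ℝ) < n := by exact_mod_cast hpos k
  have h2 : (Finset.Ioc (n / 2) n).card • (1 / ((n:ℝ) * M)) ≤ ∑ j ∈ Finset.Ioc (n / 2) n, 1 / (Λ j : ℝ) := by
    refine Finset.card_nsmul_le_sum _ _ _ fun j hj => ?_
    have hj' : Λ j ≤ Λ n := hmono.monotone (Finset.mem_Ioc.1 hj).2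
    have : (Λ j : ℝ) ≤ n * M := le_trans (by exact_mod_cast hj') (hcon k)
    exact one_div_le_one_div_of_le (by exact_mod_cast hpos j) this
  rw [Nat.card_Ioc, nsmul_eq_mul] at h2
  have h3 : (n : ℝ) / 2 ≤ ((n - n / 2 : ℕ) : ℝ) := by
    have : n ≤ 2 * (n - n / 2) := by omega
    have : (n : ℝ) ≤ 2 * ((n - n / 2 : ℕ) : ℝ) := by exact_mod_cast this
    linarith
  have h4 : 1 / (2 * M) = (n : ℝ) / 2 * (1 / ((n:ℝ) * M)) := by
    field_simp
  have h5 : (n : ℝ) / 2 * (1 / ((n:ℝ) * M)) ≤ ((n - n / 2 : ℕ) : ℝ) * (1 / ((n:ℝ) * M)) :=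
    mul_le_mul_of_nonneg_right h3 (by positivity)
  linarith

/-- For `Λ` a strictly increasing sequence of positive integers with
`∑ 1/λ_k < ∞` and `φ` a real-exponent polynomial with at least two terms mapping `[0,1]`
into `[0,1]`, the composition operator does not leave `M^p_Λ` invariant: some `φ^{λ}`
with `λ ∈ Λ` fails to belong to `M^p_Λ`. -/
theorem muntz_not_invariant_real_exponent_poly
    (p : ℝ) (hp : 1 ≤ p)
    (Λ : ℕ → ℕ) (hmono : StrictMono Λ) (hpos : ∀ k, 0 < Λ k)
    (hsum : Summable fun k => 1 / (Λ k : ℝ))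
    (l : ℕ) (hl : 2 ≤ l) (c : Fin l → ℝ) (s : Fin l → ℝ)
    (hc : ∀ i, c i ≠ 0) (hs : ∀ i, 0 < s i) (hsinj : Function.Injective s)
    (φ : ℝ → ℝ) (hφ : ∀ x, φ x = ∑ i, c i * x ^ (s i))
    (hmaps : Set.MapsTo φ (Set.Icc (0 : ℝ) 1) (Set.Icc (0 : ℝ) 1)) :
    ∃ k : ℕ, ¬ memMuntz p (fun j => (Λ j : ℝ)) (fun x => φ x ^ (Λ k)) := by
  classical
  by_contra hcon
  push Not at hcon
  let P : GP := ∑ i, AddMonoidAlgebra.single (s i) (c i)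
  have hPc : ∀ a, P.coeff a = ∑ i, if s i = a then c i else 0 := by
    intro a
    simp [P, AddMonoidAlgebra.coeff_sum, Finsupp.single_apply]
  have hPs : ∀ i, P.coeff (s i) = c i := by
    intro i
    rw [hPc, Finset.sum_eq_single i]
    · simp
    · intro j _ hj; rw [if_neg (fun h => hj (hsinj h))]
    · simp
  have hcard : 2 ≤ P.coeff.support.card := by
    have : (Finset.univ.image s) ⊆ P.coeff.support := by
      intro a ha
      obtain ⟨i, -, rfl⟩ := Finset.mem_image.1 ha
      rw [Finsupp.mem_support_iff, hPs]; exact hc i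
    have h := Finset.card_le_card this
    rw [Finset.card_image_of_injective _ hsinj, Finset.card_univ, Fintype.card_fin] at h
    omega
  set M := ∑ i, s i with hM
  have hM0 : 0 < M := Finset.sum_pos (fun i _ => hs i) ⟨⟨0, by omega⟩, Finset.mem_univ _⟩
  have hbd : ∀ a ∈ P.coeff.support, 0 ≤ a ∧ a ≤ M := by
    intro a ha
    rw [Finsupp.mem_support_iff, hPc] at ha
    obtain ⟨i, -, hi⟩ := Finset.exists_ne_zero_of_sum_ne_zero ha
    have hia : s i = a := by
      by_contra h
      exact hi (if_neg h)
    rw [← hia]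
    exact ⟨(hs i).le, Finset.single_le_sum (fun j _ => (hs j).le) (Finset.mem_univ i)⟩
  obtain ⟨k, hk⟩ := sparse Λ hmono hpos hsum M hM0
  have hb := gp_bound P M hbd (Λ k)
  have hsupp := muntz_support p hp Λ hmono hpos hsum (P ^ Λ k) (fun r hr => (hb r hr).1)
    (fun x => φ x ^ Λ k) (by
      intro x hx
      simp only [map_pow, P, map_sum, gpEv_single, hφ]) (hcon k)
  have hsub : (P ^ Λ k).coeff.support ⊆ (Finset.range (Λ k)).image (fun j => (Λ j : ℝ)) := by
    intro a ha
    obtain ⟨j, rfl⟩ := hsupp a ha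
    refine Finset.mem_image.2 ⟨j, Finset.mem_range.2 ?_, rfl⟩
    have h1 : (Λ j : ℝ) < Λ (Λ k) := (hb _ ha).2.trans_lt hk
    exact hmono.lt_iff_lt.1 (by exact_mod_cast h1)
  have h1 := (Finset.card_le_card hsub).trans Finset.card_image_le
  rw [Finset.card_range] at h1
  have h2 := gp_card P hcard (Λ k)
  omega
end

section
/- Let Λ = (λ_k)_{k≥1} be a strictly increasing sequence of positive integers with ∑_k 1/λ_k < ∞, let 1 ≤ p < ∞, and let φ be a real-exponent polynomial with φ([0,1]) ⊆ [0,1]. The following are equivalent: (i) for every f ∈ M^p_Λ, the function f∘φ (defined almost everywhere on [0,1] via the continuous representative of f on [0,1)) belongs to M^p_Λ; (ii) φ(x) = α x^η for some 0 ≤ α ≤ 1 and η > 0, and λ·η^m ∈ Λ for every λ ∈ Λ and every integer m ≥ 0; (iii) statement (i) holds and moreover there is a constant C > 0 such that ‖f∘φ‖_{L^p} ≤ C‖f‖_{L^p} for all f ∈ M^p_Λ. -/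
open MeasureTheory

/-- `C_φ` leaves `M^p_Λ` invariant: for every `f ∈ M^p_Λ` (taken via its continuous
representative on `[0,1)`), the composition `f ∘ φ` again belongs to `M^p_Λ`. -/
def muntzInvariant (p : ℝ) (Λ : ℕ → ℝ) (φ : ℝ → ℝ) : Prop :=
  ∀ f : ℝ → ℝ, ContinuousOn f (Set.Ico (0 : ℝ) 1) → memMuntz p Λ f →
    memMuntz p Λ (fun x => f (φ x))

lemma mz_quad_step {ι : Type*} (s : Finset ι) (μ : ι → ℝ) (hμ : ∀ i ∈ s, 0 < μ i) (b : ι → ℝ)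
    (w : ℝ) (hw : 0 < w) :
    ∑ i ∈ s, ∑ j ∈ s, (b i * ((μ i - w) / (μ i + w))) * (b j * ((μ j - w) / (μ j + w))) / (μ i + μ j)
      ≤ ∑ i ∈ s, ∑ j ∈ s, b i * b j / (μ i + μ j) := by
  have key : ∑ i ∈ s, ∑ j ∈ s, b i * b j / (μ i + μ j)
      - ∑ i ∈ s, ∑ j ∈ s, (b i * ((μ i - w) / (μ i + w))) * (b j * ((μ j - w) / (μ j + w))) / (μ i + μ j)
      = 2 * w * (∑ i ∈ s, b i / (μ i + w)) ^ 2 := by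
    rw [sq, Finset.sum_mul_sum, Finset.mul_sum, ← Finset.sum_sub_distrib]
    refine Finset.sum_congr rfl fun i hi => ?_
    rw [Finset.mul_sum, ← Finset.sum_sub_distrib]
    refine Finset.sum_congr rfl fun j hj => ?_
    have := hμ i hi
    have := hμ j hj
    field_simp
    ring
  have : 0 ≤ 2 * w * (∑ i ∈ s, b i / (μ i + w)) ^ 2 := by positivity
  linarith

lemma mz_quad_iter {ι : Type*} (s : Finset ι) (μ : ι → ℝ) (hμ : ∀ i ∈ s, 0 < μ i)
    (t : Finset ι) (ht : t ⊆ s) : ∀ (b : ι → ℝ),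
    ∑ i ∈ s, ∑ j ∈ s, (b i * ∏ k ∈ t, ((μ i - μ k) / (μ i + μ k))) *
        (b j * ∏ k ∈ t, ((μ j - μ k) / (μ j + μ k))) / (μ i + μ j)
      ≤ ∑ i ∈ s, ∑ j ∈ s, b i * b j / (μ i + μ j) := by
  classical
  induction t using Finset.induction_on with
  | empty => intro b; simp
  | insert k t hk ih =>
    intro b
    have h1 := ih (fun x hx => ht (Finset.mem_insert_of_mem hx)) b
    refine le_trans ?_ h1
    have h2 := mz_quad_step s μ hμ (fun i => b i * ∏ k ∈ t, ((μ i - μ k) / (μ i + μ k))) (μ k)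
      (hμ k (ht (Finset.mem_insert_self _ _)))
    refine le_trans (le_of_eq ?_) h2
    refine Finset.sum_congr rfl fun i hi => Finset.sum_congr rfl fun j hj => ?_
    rw [Finset.prod_insert hk, Finset.prod_insert hk]
    ring

lemma mz_quad_coeff {ι : Type*} [DecidableEq ι] (s : Finset ι) (μ : ι → ℝ) (hμ : ∀ i ∈ s, 0 < μ i)
    (b : ι → ℝ) (r : ι) (hr : r ∈ s) :
    (b r * ∏ k ∈ s.erase r, ((μ r - μ k) / (μ r + μ k))) ^ 2 / (2 * μ r)
      ≤ ∑ i ∈ s, ∑ j ∈ s, b i * b j / (μ i + μ j) := by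
  refine le_trans (le_of_eq ?_) (mz_quad_iter s μ hμ (s.erase r) (Finset.erase_subset _ _) b)
  have h0 : ∀ i ∈ s, i ≠ r → ∏ k ∈ s.erase r, ((μ i - μ k) / (μ i + μ k)) = 0 := by
    intro i hi hir
    exact Finset.prod_eq_zero (Finset.mem_erase.2 ⟨hir, hi⟩) (by simp)
  rw [Finset.sum_eq_single_of_mem r hr, Finset.sum_eq_single_of_mem r hr]
  · ring
  · intro j hj hjr; rw [h0 j hj hjr]; simp
  · intro j hj hjr; rw [h0 j hj hjr]; simp

lemma mz_quad_integral {ι : Type*} (s : Finset ι) (e : ι → ℝ) (he : ∀ i ∈ s, 0 ≤ e i) (b : ι → ℝ) :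
    ∫ x in (0:ℝ)..1, (∑ i ∈ s, b i * x ^ (e i + 1)) ^ 2
      = ∑ i ∈ s, ∑ j ∈ s, b i * b j / ((e i + 3/2) + (e j + 3/2)) := by
  have h1 : ∀ x ∈ Set.uIcc (0:ℝ) 1, (∑ i ∈ s, b i * x ^ (e i + 1)) ^ 2
      = ∑ i ∈ s, ∑ j ∈ s, b i * b j * x ^ ((e i + 1) + (e j + 1)) := by
    intro x hx
    rw [Set.uIcc_of_le zero_le_one] at hx
    rw [sq, Finset.sum_mul_sum]
    refine Finset.sum_congr rfl fun i hi => Finset.sum_congr rfl fun j hj => ?_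
    rw [Real.rpow_add_of_nonneg hx.1 (y := e i + 1) (z := e j + 1) (by linarith [he i hi]) (by linarith [he j hj])]
    ring
  have hI : ∀ i ∈ s, ∀ j ∈ s, IntervalIntegrable (fun x : ℝ => b i * b j * x ^ ((e i + 1) + (e j + 1))) volume 0 1 := by
    intro i hi j hj
    exact (intervalIntegral.intervalIntegrable_rpow' (by linarith [he i hi, he j hj])).const_mul _
  rw [intervalIntegral.integral_congr h1, intervalIntegral.integral_finsetSum]
  · refine Finset.sum_congr rfl fun i hi => ?_
    rw [intervalIntegral.integral_finsetSum (fun j hj => hI i hi j hj)]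
    refine Finset.sum_congr rfl fun j hj => ?_
    have := he i hi
    have := he j hj
    rw [intervalIntegral.integral_const_mul, integral_rpow (Or.inl (by linarith)), Real.one_rpow,
      Real.zero_rpow (by linarith)]
    rw [mul_div_assoc, sub_zero]
    have e1 : e i + 1 + (e j + 1) + 1 = e i + 3 / 2 + (e j + 3 / 2) := by ring
    rw [e1]; ring
  · intro i hi
    have := IntervalIntegrable.sum s (f := fun j => fun x : ℝ => b i * b j * x ^ ((e i + 1) + (e j + 1))) (fun j hj => hI i hi j hj)
    simpa [Finset.sum_fn] using this

lemma mz_coeff_bound {ι : Type*} [DecidableEq ι] (s : Finset ι) (e : ι → ℝ) (he : ∀ i ∈ s, 0 ≤ e i)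
    (a : ι → ℝ) (r : ι) (hr : r ∈ s) (D : ℝ) (hD : 0 ≤ D)
    (h : ∀ x ∈ Set.Icc (0:ℝ) 1, |∑ i ∈ s, a i / (e i + 1) * x ^ (e i + 1)| ≤ D) :
    |a r| * ∏ i ∈ s.erase r, (|e r - e i| / (e r + e i + 3)) ≤ (2 * e r + 3) ^ 2 * D := by
  have hq := mz_quad_coeff s (fun i => e i + 3/2) (fun i hi => by have := he i hi; positivity)
    (fun i => a i / (e i + 1)) r hr
  rw [← mz_quad_integral s e he] at hq
  have hint : ∫ x in (0:ℝ)..1, (∑ i ∈ s, a i / (e i + 1) * x ^ (e i + 1)) ^ 2 ≤ D ^ 2 := by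
    have h2 : ∫ x in (0:ℝ)..1, (∑ i ∈ s, a i / (e i + 1) * x ^ (e i + 1)) ^ 2 ≤ ∫ x in (0:ℝ)..1, D ^ 2 := by
      refine intervalIntegral.integral_mono_on zero_le_one ?_ (by simp) ?_
      · apply Continuous.intervalIntegrable
        refine Continuous.pow (continuous_finsetSum _ fun i hi => ?_) 2
        exact continuous_const.mul (Real.continuous_rpow_const (by linarith [he i hi]))
      · intro x hx
        rw [← sq_abs]
        exact pow_le_pow_left₀ (abs_nonneg _) (h x hx) 2
    simpa using h2
  have h0 := he r hr
  set W := ∏ k ∈ s.erase r, ((e r + 3/2 - (e k + 3/2)) / (e r + 3/2 + (e k + 3/2))) with hW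
  have habs : ∏ i ∈ s.erase r, (|e r - e i| / (e r + e i + 3)) = |W| := by
    rw [hW, Finset.abs_prod]
    refine Finset.prod_congr rfl fun i hi => ?_
    have := he i (Finset.mem_of_mem_erase hi)
    rw [abs_div]
    congr 1
    · congr 1; ring
    · rw [abs_of_pos (by positivity)]; ring
  rw [habs, ← abs_mul]
  have h3 : (a r / (e r + 1) * W) ^ 2 ≤ ((2 * e r + 3) * D) ^ 2 := by
    have := hq.trans hint
    rw [div_le_iff₀ (by positivity)] at this
    refine this.trans ?_
    rw [mul_pow, mul_comm]
    gcongr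
    nlinarith
  have h4 := abs_le_of_sq_le_sq h3 (by positivity)
  have h5 : |a r / (e r + 1) * W| ≤ (2 * e r + 3) * D := h4
  have h6 : a r * W = (e r + 1) * (a r / (e r + 1) * W) := by field_simp
  rw [h6, abs_mul, abs_of_pos (by linarith)]
  calc (e r + 1) * |a r / (e r + 1) * W| ≤ (2 * e r + 3) * ((2 * e r + 3) * D) := by
        gcongr <;> linarith
    _ = _ := by ring

lemma mz_primitive {ι : Type*} (s : Finset ι) (e : ι → ℝ) (he : ∀ i ∈ s, 0 ≤ e i)
    (a : ι → ℝ) (x : ℝ) (hx : x ∈ Set.Icc (0:ℝ) 1) :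
    |∑ i ∈ s, a i / (e i + 1) * x ^ (e i + 1)| ≤ ∫ y in (0:ℝ)..1, |∑ i ∈ s, a i * y ^ (e i)| := by
  have hcont : Continuous fun y : ℝ => ∑ i ∈ s, a i * y ^ (e i) :=
    continuous_finsetSum _ fun i hi => continuous_const.mul (Real.continuous_rpow_const (he i hi))
  have h1 : ∑ i ∈ s, a i / (e i + 1) * x ^ (e i + 1) = ∫ y in (0:ℝ)..x, ∑ i ∈ s, a i * y ^ (e i) := by
    rw [intervalIntegral.integral_finsetSum]
    · refine Finset.sum_congr rfl fun i hi => ?_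
      have := he i hi
      rw [intervalIntegral.integral_const_mul, integral_rpow (Or.inl (by linarith)),
        Real.zero_rpow (by linarith)]
      ring
    · intro i hi
      exact (intervalIntegral.intervalIntegrable_rpow' (by linarith [he i hi])).const_mul _
  rw [h1]
  refine (intervalIntegral.abs_integral_le_integral_abs hx.1).trans ?_
  refine intervalIntegral.integral_mono_interval le_rfl hx.1 hx.2 ?_ ?_
  · exact Filter.Eventually.of_forall fun y => abs_nonneg _
  · exact hcont.abs.intervalIntegrable _ _

lemma mz_prod_subset {ι : Type*} (A B : Finset ι) (h : A ⊆ B) (f : ι → ℝ)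
    (h0 : ∀ i ∈ B, 0 ≤ f i) (h1 : ∀ i ∈ B, f i ≤ 1) : ∏ i ∈ B, f i ≤ ∏ i ∈ A, f i := by
  classical
  rw [← Finset.prod_sdiff h]
  have h2 : ∏ i ∈ B \ A, f i ≤ 1 := Finset.prod_le_one
    (fun i hi => h0 i (Finset.sdiff_subset hi)) (fun i hi => h1 i (Finset.sdiff_subset hi))
  have h3 : 0 ≤ ∏ i ∈ A, f i := Finset.prod_nonneg fun i hi => h0 i (h hi)
  nlinarith

lemma mz_fac_le_one (q e : ℝ) (hq : 0 ≤ q) (he : 0 ≤ e) : |q - e| / (q + e + 3) ≤ 1 := by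
  rw [div_le_one (by positivity), abs_le]
  constructor <;> linarith

lemma mz_prod_far (Λ : ℕ → ℕ) (hpos : ∀ k, 0 < Λ k) (hsum : Summable fun k => 1 / (Λ k : ℝ))
    (q : ℝ) (hq : 0 ≤ q) (T : Finset ℕ) (hT : ∀ j ∈ T, 2 * q < Λ j) :
    Real.exp (-(2 * (2 * q + 3) * ∑' k, 1 / (Λ k : ℝ))) ≤
      ∏ j ∈ T, (|q - Λ j| / (q + Λ j + 3)) := by
  have h1 : Real.exp (-(2 * (2 * q + 3) * ∑' k, 1 / (Λ k : ℝ))) ≤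
      ∏ j ∈ T, Real.exp (-(2 * (2 * q + 3) * (1 / (Λ j : ℝ)))) := by
    rw [← Real.exp_sum, Finset.sum_neg_distrib, ← Finset.mul_sum]
    gcongr
    exact hsum.sum_le_tsum T (fun i _ => by positivity)
  refine h1.trans (Finset.prod_le_prod (fun i _ => (Real.exp_pos _).le) fun j hj => ?_)
  have h2 := hT j hj
  have hL : (0:ℝ) < Λ j := by exact_mod_cast hpos j
  set L := (Λ j : ℝ) with hLdef
  rw [abs_sub_comm, abs_of_pos (by linarith), Real.exp_neg, inv_le_comm₀ (Real.exp_pos _) (by apply div_pos <;> linarith),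
    inv_div]
  refine le_trans ?_ (Real.add_one_le_exp _)
  rw [div_le_iff₀ (by linarith)]
  have : L ≤ 2 * (L - q) := by linarith
  have h3 : 1 ≤ 2 * (1 / L) * (L - q) := by
    field_simp; linarith
  nlinarith

lemma mz_prod_choose (q : ℕ) (I : Finset ℕ) (hI : I ⊆ Finset.range q) :
    (1/2 : ℝ) ^ (3 * q + 3) ≤ ∏ i ∈ I, (((i:ℝ) + 1) / (2 * q + i + 4)) := by
  refine le_trans ?_ (mz_prod_subset I (Finset.range q) hI _ (fun i _ => by positivity) ?_)
  · have hC : (3 * q + 3).choose q ≤ 2 ^ (3 * q + 3) := Nat.choose_le_two_pow _ _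
    have h1 : ∏ i ∈ Finset.range q, ((i:ℝ) + 1) = (q.factorial : ℝ) := by
      rw [← Finset.prod_range_add_one_eq_factorial]; push_cast; rfl
    have h2 : ∏ i ∈ Finset.range q, (2 * (q:ℝ) + i + 4) = (q.factorial : ℝ) * ((3 * q + 3).choose q : ℕ) := by
      have := Nat.ascFactorial_eq_factorial_mul_choose (2 * q + 3) q
      rw [show 2 * q + 3 + q = 3 * q + 3 by ring] at this
      rw [← Nat.cast_mul, ← this, Nat.ascFactorial_eq_prod_range]
      push_cast
      refine Finset.prod_congr rfl fun i _ => by ring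
    rw [Finset.prod_div_distrib, h1, h2]
    have hf : (0:ℝ) < q.factorial := by exact_mod_cast q.factorial_pos
    have hc : (0:ℝ) < ((3 * q + 3).choose q : ℕ) := by exact_mod_cast Nat.choose_pos (by omega)
    rw [div_mul_eq_div_div, div_self hf.ne', one_div_pow]
    apply one_div_le_one_div_of_le hc
    exact_mod_cast hC
  · intro i _
    rw [div_le_one (by positivity)]
    have : (0:ℝ) ≤ q := by positivity
    linarith

lemma mz_prod_near (q : ℕ) (T : Finset ℕ) (hT : ∀ j ∈ T, j ≠ q ∧ j ≤ 2 * q) :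
    (1/2 : ℝ) ^ (6 * q + 6) ≤ ∏ j ∈ T, (|(q:ℝ) - j| / (q + j + 3)) := by
  rw [← Finset.prod_filter_mul_prod_filter_not T (fun j => q < j), show 6 * q + 6 = (3 * q + 3) + (3 * q + 3) by ring, pow_add]
  have key : ∀ (U : Finset ℕ) (m : ℕ → ℕ), Set.InjOn m U → (∀ j ∈ U, m j < q ∧
      ((m j : ℝ) + 1) / (2 * q + m j + 4) ≤ |(q:ℝ) - j| / (q + j + 3)) →
      (1/2 : ℝ) ^ (3 * q + 3) ≤ ∏ j ∈ U, (|(q:ℝ) - j| / (q + j + 3)) := by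
    intro U m hm h
    refine (mz_prod_choose q (U.image m) ?_).trans ?_
    · intro i hi
      obtain ⟨j, hj, rfl⟩ := Finset.mem_image.1 hi
      exact Finset.mem_range.2 (h j hj).1
    · rw [Finset.prod_image hm]
      exact Finset.prod_le_prod (fun i _ => by positivity) fun j hj => (h j hj).2
  gcongr
  · refine key _ (fun j => j - q - 1) ?_ ?_
    · intro i hi j hj hij
      simp only [Finset.coe_filter, Set.mem_ofPred_eq] at hi hj hij
      omega
    · intro j hj
      rw [Finset.mem_filter] at hj
      obtain ⟨i, rfl⟩ : ∃ i, j = q + 1 + i := ⟨j - (q+1), by omega⟩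
      have := hT _ hj.1
      refine ⟨by omega, ?_⟩
      rw [show q + 1 + i - q - 1 = i by omega]
      push_cast
      rw [show (q:ℝ) - (q + 1 + i) = -(i + 1) by ring, abs_neg, abs_of_nonneg (by positivity)]
      apply le_of_eq; congr 1; ring
  · refine key _ (fun j => q - 1 - j) ?_ ?_
    · intro i hi j hj hij
      simp only [Finset.coe_filter, Set.mem_ofPred_eq] at hi hj hij
      have := hT _ hi.1
      have := hT _ hj.1
      omega
    · intro j hj
      rw [Finset.mem_filter] at hj
      have h1 := hT _ hj.1
      obtain ⟨i, rfl⟩ : ∃ i, q = j + 1 + i := ⟨q - (j+1), by omega⟩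
      refine ⟨by omega, ?_⟩
      rw [show j + 1 + i - 1 - j = i by omega]
      push_cast
      rw [show (j:ℝ) + 1 + i - j = (i + 1) by ring, abs_of_nonneg (by positivity)]
      apply div_le_div_of_nonneg_left (by positivity) (by positivity)
      linarith [(Nat.cast_nonneg i : (0:ℝ) ≤ i)]

lemma mz_prod_int (Λ : ℕ → ℕ) (hmono : StrictMono Λ) (hpos : ∀ k, 0 < Λ k)
    (hsum : Summable fun k => 1 / (Λ k : ℝ)) (k : ℕ) (T : Finset ℕ) (hk : k ∉ T) :
    Real.exp (-((12 + 10 * ∑' k, 1 / (Λ k : ℝ)) * Λ k)) ≤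
      ∏ j ∈ T, (|(Λ k : ℝ) - Λ j| / (Λ k + Λ j + 3)) := by
  rw [← Finset.prod_filter_mul_prod_filter_not T (fun j => Λ j ≤ 2 * Λ k)]
  have h1 := mz_prod_near (Λ k) ((T.filter (fun j => Λ j ≤ 2 * Λ k)).image Λ) (by
    intro j hj
    obtain ⟨i, hi, rfl⟩ := Finset.mem_image.1 hj
    rw [Finset.mem_filter] at hi
    refine ⟨fun h => hk ?_, hi.2⟩
    rw [← hmono.injective h]; exact hi.1)
  rw [Finset.prod_image (fun a _ b _ h => hmono.injective h)] at h1
  have h2 := mz_prod_far Λ hpos hsum (Λ k) (by positivity) (T.filter (fun j => ¬ Λ j ≤ 2 * Λ k)) (by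
    intro j hj
    rw [Finset.mem_filter] at hj
    have := not_le.1 hj.2
    exact_mod_cast this)
  have hS : 0 ≤ ∑' k, 1 / (Λ k : ℝ) := tsum_nonneg fun _ => by positivity
  set S := ∑' k, 1 / (Λ k : ℝ)
  have hq : (1:ℝ) ≤ Λ k := by exact_mod_cast hpos k
  have h3 : Real.exp (-(12 * (Λ k : ℝ))) ≤ (1/2 : ℝ) ^ (6 * Λ k + 6) := by
    have he : Real.exp (-1) ≤ 1/2 := by
      rw [Real.exp_neg, one_div]
      apply inv_anti₀ (by norm_num)
      have := Real.add_one_le_exp (1:ℝ)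
      linarith
    calc Real.exp (-(12 * (Λ k : ℝ))) ≤ Real.exp (-1) ^ (6 * Λ k + 6) := by
          rw [← Real.exp_nat_mul]
          gcongr
          push_cast
          linarith
      _ ≤ _ := by gcongr
  have h4 : Real.exp (-((12 + 10 * S) * Λ k)) ≤ Real.exp (-(12 * (Λ k : ℝ))) * Real.exp (-(2 * (2 * (Λ k:ℝ) + 3) * S)) := by
    rw [← Real.exp_add]
    gcongr
    nlinarith
  refine h4.trans ?_
  gcongr
  exact h3.trans h1

lemma mz_prod_real (Λ : ℕ → ℕ) (hmono : StrictMono Λ) (hpos : ∀ k, 0 < Λ k)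
    (hsum : Summable fun k => 1 / (Λ k : ℝ)) (q : ℝ) (hq : 0 ≤ q) (hqn : ∀ j, (Λ j : ℝ) ≠ q) :
    ∃ δ : ℝ, 0 < δ ∧ ∀ T : Finset ℕ, δ ≤ ∏ j ∈ T, (|q - Λ j| / (q + Λ j + 3)) := by
  obtain ⟨N, hN⟩ := exists_nat_gt (2 * q)
  refine ⟨(∏ j ∈ Finset.range N, (|q - Λ j| / (q + Λ j + 3))) *
    Real.exp (-(2 * (2 * q + 3) * ∑' k, 1 / (Λ k : ℝ))), ?_, ?_⟩
  · refine mul_pos (Finset.prod_pos fun j _ => ?_) (Real.exp_pos _)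
    have := abs_pos.2 (sub_ne_zero.2 (hqn j).symm)
    positivity
  · intro T
    rw [← Finset.prod_filter_mul_prod_filter_not T (fun j => j < N)]
    refine mul_le_mul ?_ ?_ (Real.exp_pos _).le (Finset.prod_nonneg fun j _ => by positivity)
    · refine mz_prod_subset _ _ ?_ (fun j => |q - Λ j| / (q + Λ j + 3)) (fun j _ => by positivity) (fun j _ => mz_fac_le_one _ _ hq (by positivity))
      intro j hj
      exact Finset.mem_range.2 (Finset.mem_filter.1 hj).2
    · refine mz_prod_far Λ hpos hsum q hq _ ?_
      intro j hj
      have h1 := not_lt.1 (Finset.mem_filter.1 hj).2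
      have h2 : N ≤ Λ j := h1.trans (hmono.id_le j)
      exact hN.trans_le (by exact_mod_cast h2)

instance mz_prob : IsProbabilityMeasure m01 := ⟨by simp [m01]⟩

lemma mz_span_finset {Λ : ℕ → ℝ} {g : ℝ → ℝ} (hg : inSpan Λ g) :
    ∃ (T : Finset ℕ) (b : ℕ → ℝ), ∀ x, g x = ∑ j ∈ T, b j * x ^ (Λ j) := by
  classical
  obtain ⟨n, c, k, h⟩ := hg
  refine ⟨Finset.univ.image k, fun j => ∑ i with k i = j, c i, fun x => ?_⟩
  rw [h x, ← Finset.sum_fiberwise_of_maps_to (s := Finset.univ) (t := Finset.univ.image k) (g := k)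
    (fun i _ => Finset.mem_image_of_mem k (Finset.mem_univ i))]
  refine Finset.sum_congr rfl fun j _ => ?_
  rw [Finset.sum_mul]
  refine Finset.sum_congr rfl fun i hi => ?_
  rw [(Finset.mem_filter.1 hi).2]

lemma mz_span_cont {Λ : ℕ → ℕ} {g : ℝ → ℝ} (hg : inSpan (fun j => (Λ j : ℝ)) g) : Continuous g := by
  obtain ⟨n, c, k, h⟩ := hg
  rw [funext h]
  exact continuous_finsetSum _ fun i hi => continuous_const.mul (Real.continuous_rpow_const (by positivity))

lemma mz_span_sub {Λ : ℕ → ℝ} {g h : ℝ → ℝ} (hg : inSpan Λ g) (hh : inSpan Λ h) :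
    inSpan Λ (fun x => g x - h x) := by
  obtain ⟨n, c, k, h1⟩ := hg
  obtain ⟨m, d, l, h2⟩ := hh
  refine ⟨n + m, Fin.append c (fun i => - d i), Fin.append k l, fun x => ?_⟩
  change g x - h x = _
  rw [Fin.sum_univ_add, h1, h2]
  simp [sub_eq_add_neg]

lemma mz_memLp {g : ℝ → ℝ} (hg : Continuous g) (p : ENNReal) : MemLp g p m01 := by
  obtain ⟨C, hC⟩ := (isCompact_Icc (a := (0:ℝ)) (b := 1)).exists_bound_of_continuousOn hg.continuousOn
  refine MemLp.of_bound hg.aestronglyMeasurable C ?_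
  rw [m01, ae_restrict_iff' measurableSet_Icc]
  exact Filter.Eventually.of_forall hC

lemma mz_L1_le {g : ℝ → ℝ} (hg : Continuous g) (p : ℝ) (hp : 1 ≤ p) :
    ENNReal.ofReal (∫ y in (0:ℝ)..1, |g y|) ≤ eLpNorm g (ENNReal.ofReal p) m01 := by
  have h1 : eLpNorm g 1 m01 ≤ eLpNorm g (ENNReal.ofReal p) m01 :=
    eLpNorm_le_eLpNorm_of_exponent_le (by simpa using hp) hg.aestronglyMeasurable
  refine le_trans (le_of_eq ?_) h1
  rw [eLpNorm_one_eq_lintegral_enorm, intervalIntegral.integral_of_le zero_le_one,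
    ← integral_Icc_eq_integral_Ioc]
  have := ofReal_integral_norm_eq_lintegral_enorm (memLp_one_iff_integrable.1 (mz_memLp hg 1))
  rw [← this]; rfl

lemma mz_L1_le' {g : ℝ → ℝ} (hg : Continuous g) (p : ℝ) (hp : 1 ≤ p) :
    (∫ y in (0:ℝ)..1, |g y|) ≤ (eLpNorm g (ENNReal.ofReal p) m01).toReal :=
  (ENNReal.ofReal_le_iff_le_toReal (mz_memLp hg _).eLpNorm_ne_top).1 (mz_L1_le hg p hp)

lemma mz_int_nonneg (g : ℝ → ℝ) : 0 ≤ ∫ y in (0:ℝ)..1, |g y| :=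
  intervalIntegral.integral_nonneg zero_le_one fun _ _ => abs_nonneg _

/-- exponents of a generalized polynomial in the Müntz space lie in `Λ` -/
lemma mz_exponents (p : ℝ) (hp : 1 ≤ p) (Λ : ℕ → ℕ) (hmono : StrictMono Λ) (hpos : ∀ k, 0 < Λ k)
    (hsum : Summable fun k => 1 / (Λ k : ℝ)) (F : Finset ℝ) (hF : ∀ r ∈ F, 0 ≤ r) (G : ℝ → ℝ)
    (h : memMuntz p (fun j => (Λ j : ℝ)) (fun x => ∑ r ∈ F, G r * x ^ r))
    (q : ℝ) (hq : q ∈ F) (hG : G q ≠ 0) : ∃ j, (Λ j : ℝ) = q := by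
  classical
  by_contra! hcon
  have hq0 := hF q hq
  obtain ⟨δ, hδ, hT⟩ := mz_prod_real Λ hmono hpos hsum q hq0 hcon
  set A := ∏ e ∈ F.erase q, (|q - e| / (q + e + 3)) with hA
  have hApos : 0 < A := by
    refine Finset.prod_pos fun e he => ?_
    have h1 := abs_pos.2 (sub_ne_zero.2 (Finset.ne_of_mem_erase he).symm)
    have := hF e (Finset.mem_of_mem_erase he)
    positivity
  set ε := |G q| * (A * δ) / (2 * (2 * q + 3) ^ 2) with hε
  have hGp := abs_pos.2 hG
  have hεpos : 0 < ε := by positivity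
  obtain ⟨g, hg, hle⟩ := h ε hεpos
  obtain ⟨T, b, hb⟩ := mz_span_finset hg
  let s : Finset (ℝ ⊕ ℕ) := F.disjSum T
  let e : ℝ ⊕ ℕ → ℝ := Sum.elim id (fun j => (Λ j : ℝ))
  let a : ℝ ⊕ ℕ → ℝ := Sum.elim G (fun j => - b j)
  have he : ∀ i ∈ s, 0 ≤ e i := by
    intro i hi
    rcases i with r | j
    · exact hF r (by simpa [s] using hi)
    · simp [e]
  have hfun : (fun x => (∑ r ∈ F, G r * x ^ r) - g x) = fun x => ∑ i ∈ s, a i * x ^ (e i) := by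
    funext x
    simp [s, a, e, hb x, Finset.sum_disjSum, sub_eq_add_neg]
  have hcont : Continuous fun x => ∑ i ∈ s, a i * x ^ (e i) :=
    continuous_finsetSum _ fun i hi => continuous_const.mul (Real.continuous_rpow_const (he i hi))
  rw [hfun] at hle
  have h1 := (mz_L1_le hcont p hp).trans hle
  rw [ENNReal.ofReal_le_ofReal_iff hεpos.le] at h1
  have h2 := mz_coeff_bound s e he a (Sum.inl q) (by simpa [s] using hq) _ (mz_int_nonneg _)
    (fun x hx => mz_primitive s e he a x hx)
  have h3 : s.erase (Sum.inl q) = (F.erase q).disjSum T := by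
    ext i
    rcases i with r | j <;> simp [s]
  rw [h3, Finset.prod_disjSum] at h2
  simp only [a, e, Sum.elim_inl, Sum.elim_inr, id] at h2 h1
  rw [← hA] at h2
  have h4 : |G q| * (A * δ) ≤ (2 * q + 3) ^ 2 * ε := by
    calc |G q| * (A * δ) ≤ _ := by
          gcongr
          exact hT T
      _ ≤ _ := h2
      _ ≤ _ := by gcongr
  have h5 : (2 * q + 3) ^ 2 * ε = |G q| * (A * δ) / 2 := by
    rw [hε]; field_simp
  have h6 : 0 < |G q| * (A * δ) := by positivity
  linarith

lemma mz_span_bound (p : ℝ) (hp : 1 ≤ p) (Λ : ℕ → ℕ) (hmono : StrictMono Λ) (hpos : ∀ k, 0 < Λ k)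
    (hsum : Summable fun k => 1 / (Λ k : ℝ)) :
    ∃ ρ C : ℝ, 0 < ρ ∧ ρ < 1 ∧ 0 ≤ C ∧ ∀ g, inSpan (fun j => (Λ j : ℝ)) g → ∀ x ∈ Set.Icc 0 ρ,
      |g x| ≤ C * x * (eLpNorm g (ENNReal.ofReal p) m01).toReal := by
  have hS : 0 ≤ ∑' k, 1 / (Λ k : ℝ) := tsum_nonneg fun _ => by positivity
  set S := ∑' k, 1 / (Λ k : ℝ) with hSdef
  set B := 12 + 10 * S with hB
  refine ⟨Real.exp (-(B + 3)), 25 * S * Real.exp (B + 3), Real.exp_pos _, ?_, by positivity, ?_⟩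
  · rw [Real.exp_lt_one_iff]; linarith
  intro g hg x hx
  have hL1 := mz_L1_le' (mz_span_cont hg) p hp
  have hD0 := mz_int_nonneg g
  obtain ⟨T, b, hb⟩ := mz_span_finset hg
  set D := ∫ y in (0:ℝ)..1, |g y| with hD
  have hDeq : D = ∫ y in (0:ℝ)..1, |∑ j ∈ T, b j * y ^ (Λ j : ℝ)| := by
    rw [hD]; simp only [hb]
  have hx0 := hx.1
  have hterm : ∀ k ∈ T, |b k * x ^ (Λ k : ℝ)| ≤ 25 * Real.exp (B + 3) * x * D * (1 / (Λ k : ℝ)) := by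
    intro k hk
    have h2 := mz_coeff_bound T (fun j => (Λ j : ℝ)) (fun _ _ => by positivity) b k hk D hD0
      (fun y hy => by rw [hDeq]; exact mz_primitive T (fun j => (Λ j : ℝ)) (fun _ _ => by positivity) b y hy)
    have h3 := mz_prod_int Λ hmono hpos hsum k (T.erase k) (Finset.notMem_erase k T)
    rw [← hSdef, ← hB] at h3
    have hq : (1:ℝ) ≤ Λ k := by exact_mod_cast hpos k
    have hexp : (Λ k : ℝ) ≤ Real.exp (Λ k) := by linarith [Real.add_one_le_exp (Λ k : ℝ)]
    have h4 : |b k| * Real.exp (-(B * Λ k)) ≤ 25 * Real.exp (Λ k) ^ 2 * D := by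
      calc |b k| * Real.exp (-(B * Λ k)) ≤ _ := by gcongr
        _ ≤ _ := h2
        _ ≤ 25 * Real.exp (Λ k) ^ 2 * D := by
          gcongr
          nlinarith
    have h5 : |b k| ≤ 25 * Real.exp ((B + 2) * Λ k) * D := by
      have e1 : |b k| = |b k| * Real.exp (-(B * Λ k)) * Real.exp (B * Λ k) := by
        rw [mul_assoc, ← Real.exp_add]; simp
      have e2 : Real.exp ((B + 2) * Λ k) = Real.exp (Λ k) ^ 2 * Real.exp (B * Λ k) := by
        rw [← Real.exp_nat_mul, ← Real.exp_add]; congr 1; push_cast; ring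
      rw [e1, e2]
      calc _ ≤ 25 * Real.exp (Λ k) ^ 2 * D * Real.exp (B * Λ k) := by gcongr
        _ = _ := by ring
    obtain ⟨m, hm⟩ : ∃ m, Λ k = m + 1 := ⟨Λ k - 1, by have := hpos k; omega⟩
    have h6 : x ^ (Λ k : ℝ) ≤ x * (Real.exp (B + 3) * Real.exp (-((B + 3) * Λ k))) := by
      rw [Real.rpow_natCast, hm, pow_succ, mul_comm]
      gcongr
      calc x ^ m ≤ Real.exp (-(B + 3)) ^ m := by gcongr; exact hx.2
        _ = _ := by
          rw [← Real.exp_nat_mul, ← Real.exp_add]; congr 1; push_cast; ring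
    have h7 : Real.exp ((B + 2) * Λ k) * Real.exp (-((B + 3) * Λ k)) ≤ 1 / (Λ k : ℝ) := by
      rw [← Real.exp_add, show (B + 2) * (Λ k:ℝ) + -((B + 3) * Λ k) = -(Λ k : ℝ) by ring, Real.exp_neg, one_div]
      exact inv_anti₀ (by linarith) hexp
    rw [abs_mul, abs_of_nonneg (Real.rpow_nonneg hx0 _)]
    calc |b k| * x ^ (Λ k : ℝ) ≤ (25 * Real.exp ((B + 2) * Λ k) * D) * (x * (Real.exp (B + 3) * Real.exp (-((B + 3) * Λ k)))) := by
          gcongr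
      _ = 25 * Real.exp (B + 3) * x * D * (Real.exp ((B + 2) * Λ k) * Real.exp (-((B + 3) * Λ k))) := by ring
      _ ≤ _ := by gcongr
  rw [hb x]
  calc |∑ j ∈ T, b j * x ^ (Λ j : ℝ)| ≤ ∑ j ∈ T, |b j * x ^ (Λ j : ℝ)| := Finset.abs_sum_le_sum_abs _ _
    _ ≤ ∑ j ∈ T, 25 * Real.exp (B + 3) * x * D * (1 / (Λ j : ℝ)) := Finset.sum_le_sum hterm
    _ = 25 * Real.exp (B + 3) * x * D * ∑ j ∈ T, (1 / (Λ j : ℝ)) := by rw [Finset.mul_sum]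
    _ ≤ 25 * Real.exp (B + 3) * x * D * S := by
      gcongr
      exact hsum.sum_le_tsum T (fun i _ => by positivity)
    _ = 25 * S * Real.exp (B + 3) * x * D := by ring
    _ ≤ _ := by gcongr

lemma mz_aesm {f : ℝ → ℝ} (hf : ContinuousOn f (Set.Ico (0:ℝ) 1)) : AEStronglyMeasurable f m01 := by
  have h : m01 = volume.restrict (Set.Ico (0:ℝ) 1) := by
    rw [m01]; exact (Measure.restrict_congr_set Ico_ae_eq_Icc).symm
  rw [h]
  exact hf.aestronglyMeasurable measurableSet_Ico

lemma mz_mem_ne_top {p : ℝ} (hp : 1 ≤ p) {Λ : ℕ → ℕ} {f : ℝ → ℝ} (hf : ContinuousOn f (Set.Ico (0:ℝ) 1))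
    (hm : memMuntz p (fun j => (Λ j : ℝ)) f) : eLpNorm f (ENNReal.ofReal p) m01 ≠ ⊤ := by
  obtain ⟨g, hg, hle⟩ := hm 1 one_pos
  have hgc := mz_span_cont hg
  have h1 : MemLp (fun x => f x - g x) (ENNReal.ofReal p) m01 :=
    ⟨(mz_aesm hf).sub hgc.aestronglyMeasurable, hle.trans_lt ENNReal.ofReal_lt_top⟩
  have h2 := h1.add (mz_memLp hgc (ENNReal.ofReal p))
  have h3 : (fun x => f x - g x) + g = f := by funext x; simp
  rw [h3] at h2
  exact h2.eLpNorm_ne_top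

lemma mz_mem_bound (p : ℝ) (hp : 1 ≤ p) (Λ : ℕ → ℕ) (hmono : StrictMono Λ) (hpos : ∀ k, 0 < Λ k)
    (hsum : Summable fun k => 1 / (Λ k : ℝ)) :
    ∃ ρ C : ℝ, 0 < ρ ∧ ρ < 1 ∧ 0 ≤ C ∧ ∀ f, ContinuousOn f (Set.Ico (0:ℝ) 1) →
      memMuntz p (fun j => (Λ j : ℝ)) f → ∀ x ∈ Set.Ico 0 ρ,
      |f x| ≤ C * x * (eLpNorm f (ENNReal.ofReal p) m01).toReal := by
  obtain ⟨ρ, C, hρ0, hρ1, hC, hb⟩ := mz_span_bound p hp Λ hmono hpos hsum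
  refine ⟨ρ, C, hρ0, hρ1, hC, ?_⟩
  intro f hf hm
  have hp1 : 1 ≤ ENNReal.ofReal p := by simpa using hp
  choose g hg hle using fun n : ℕ => hm (1 / ((n:ℝ) + 1)) (by positivity)
  have hfm := mz_aesm hf
  have hgm := fun n => (mz_span_cont (hg n)).aestronglyMeasurable (μ := m01)
  have hlim0 : Filter.Tendsto (fun n : ℕ => ENNReal.ofReal (1 / ((n:ℝ) + 1))) Filter.atTop (nhds 0) := by
    have := ENNReal.tendsto_ofReal (tendsto_one_div_add_atTop_nhds_zero_nat (𝕜 := ℝ))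
    simpa using this
  have hsw : ∀ n, eLpNorm (g n - f) (ENNReal.ofReal p) m01 ≤ ENNReal.ofReal (1 / ((n:ℝ) + 1)) := by
    intro n
    rw [eLpNorm_sub_comm]
    exact hle n
  have hlim : Filter.Tendsto (fun n => eLpNorm (g n - f) (ENNReal.ofReal p) m01) Filter.atTop (nhds 0) :=
    tendsto_of_tendsto_of_tendsto_of_le_of_le tendsto_const_nhds hlim0 (fun _ => zero_le) hsw
  obtain ⟨ns, hns, hae⟩ := (tendstoInMeasure_of_tendsto_eLpNorm (by positivity) hgm hfm hlim).exists_seq_tendsto_ae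
  have hN := mz_mem_ne_top hp hf hm
  set N := (eLpNorm f (ENNReal.ofReal p) m01).toReal with hNdef
  have hgn : ∀ n : ℕ, (eLpNorm (g n) (ENNReal.ofReal p) m01).toReal ≤ N + 1 / ((n:ℝ) + 1) := by
    intro n
    have h1 : eLpNorm (g n) (ENNReal.ofReal p) m01 ≤ eLpNorm f (ENNReal.ofReal p) m01 + ENNReal.ofReal (1 / ((n:ℝ) + 1)) := by
      have h2 : g n = f + (g n - f) := by funext x; simp
      calc eLpNorm (g n) (ENNReal.ofReal p) m01 = eLpNorm (f + (g n - f)) (ENNReal.ofReal p) m01 := by rw [← h2]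
        _ ≤ _ := eLpNorm_add_le hfm ((hgm n).sub hfm) hp1
        _ ≤ _ := by gcongr; exact hsw n
    have h3 := ENNReal.toReal_mono (by simp [hN]) h1
    rwa [ENNReal.toReal_add hN ENNReal.ofReal_ne_top, ENNReal.toReal_ofReal (by positivity)] at h3
  have hsub : Set.Ico 0 ρ ⊆ Set.Icc (0:ℝ) 1 := fun x hx => ⟨hx.1, hx.2.le.trans hρ1.le⟩
  have hae2 : ∀ᵐ x ∂(volume.restrict (Set.Ico 0 ρ)), max (|f x| - C * x * N) 0 = 0 := by
    have h1 := ae_restrict_of_ae_restrict_of_subset (μ := volume) hsub hae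
    filter_upwards [h1, ae_restrict_mem measurableSet_Ico] with x hx hxm
    apply max_eq_right
    have h2 : Filter.Tendsto (fun n : ℕ => C * x * (N + 1 / ((ns n : ℝ) + 1))) Filter.atTop (nhds (C * x * (N + 0))) :=
      ((tendsto_one_div_add_atTop_nhds_zero_nat (𝕜 := ℝ)).comp hns.tendsto_atTop).const_add N |>.const_mul (C * x)
    have h3 := le_of_tendsto_of_tendsto' hx.abs h2 (fun n => by
      refine (hb _ (hg (ns n)) x ⟨hxm.1, hxm.2.le⟩).trans ?_
      have := hxm.1
      gcongr
      exact hgn (ns n))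
    linarith
  have hfc : ContinuousOn f (Set.Ico 0 ρ) := hf.mono fun x hx => ⟨hx.1, hx.2.trans hρ1⟩
  have hFc : ContinuousOn (fun x => max (|f x| - C * x * N) 0) (Set.Ico 0 ρ) := by
    have h6 : ContinuousOn (fun x => |f x| - C * x * N) (Set.Ico 0 ρ) :=
      hfc.abs.sub (Continuous.continuousOn (by fun_prop))
    exact ContinuousOn.sup h6 continuousOn_const
  have heq := Measure.eqOn_of_ae_eq (f := fun x => max (|f x| - C * x * N) 0) (g := fun _ => (0:ℝ)) hae2
    hFc continuousOn_const
    (by rw [interior_Ico, closure_Ioo hρ0.ne]; exact Set.Ico_subset_Icc_self)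
  intro x hx
  have h5 := heq hx
  simp only at h5
  have := le_max_left (|f x| - C * x * N) 0
  linarith

lemma mz_comp_bound (p : ℝ) (hp : 1 ≤ p) (Λ : ℕ → ℕ) (hmono : StrictMono Λ) (hpos : ∀ k, 0 < Λ k)
    (hsum : Summable fun k => 1 / (Λ k : ℝ)) (φ : ℝ → ℝ) (α : ℝ) (n : ℕ) (hn : 1 ≤ n) (hα0 : 0 ≤ α)
    (hα1 : α ≤ 1) (hφ : ∀ x ∈ Set.Icc (0:ℝ) 1, φ x = α * x ^ n) :
    ∃ K : ℝ, 0 < K ∧ ∀ f, ContinuousOn f (Set.Ico (0:ℝ) 1) →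
      memMuntz p (fun j => (Λ j : ℝ)) f →
        eLpNorm (fun x => f (φ x)) (ENNReal.ofReal p) m01 ≤
            ENNReal.ofReal K * eLpNorm f (ENNReal.ofReal p) m01 := by
  obtain ⟨ρ, C, hρ0, hρ1, hC, hb⟩ := mz_mem_bound p hp Λ hmono hpos hsum
  have hp0 : 0 < p := by linarith
  refine ⟨(C ^ p + 1 / ρ) ^ (1 / p), by positivity, ?_⟩
  intro f hf hm
  have hN := mz_mem_ne_top hp hf hm
  have hbf := hb f hf hm
  set N := eLpNorm f (ENNReal.ofReal p) m01 with hNdef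
  have hpne : ENNReal.ofReal p ≠ 0 := by simpa using hp0
  have hNp : N ^ p = ∫⁻ x in Set.Icc (0:ℝ) 1, ‖f x‖ₑ ^ p := by
    rw [hNdef, eLpNorm_eq_lintegral_rpow_enorm_toReal hpne ENNReal.ofReal_ne_top,
      ENNReal.toReal_ofReal hp0.le, ← ENNReal.rpow_mul, one_div, inv_mul_cancel₀ hp0.ne', ENNReal.rpow_one, m01]
  rw [eLpNorm_eq_lintegral_rpow_enorm_toReal hpne ENNReal.ofReal_ne_top, ENNReal.toReal_ofReal hp0.le]
  set S := Set.Icc (0:ℝ) 1 ∩ {x | ρ ≤ α * x ^ n} with hS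
  have hSm : MeasurableSet S := by
    apply measurableSet_Icc.inter
    exact measurableSet_le measurable_const (by fun_prop)
  have hSs : S ⊆ Set.Icc (0:ℝ) 1 := Set.inter_subset_left
  -- large part
  have hlarge : ∫⁻ x in S, ‖f (φ x)‖ₑ ^ p ≤ ENNReal.ofReal (1 / ρ) * N ^ p := by
    have hcv := lintegral_image_eq_lintegral_abs_deriv_mul (s := S) (f := fun x => α * x ^ n)
      (f' := fun x => α * (n * x ^ (n - 1))) hSm
      (fun x _ => ((hasDerivAt_pow n x).const_mul α).hasDerivWithinAt) (by
        intro x hx y hy hxy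
        have hα : α ≠ 0 := by
          rintro rfl
          have := hx.2
          simp only [zero_mul, Set.mem_ofPred_eq] at this
          linarith
        have h1 : x ^ n = y ^ n := mul_left_cancel₀ hα hxy
        exact (pow_left_inj₀ hx.1.1 hy.1.1 (by omega)).1 h1) (fun y => ‖f y‖ₑ ^ p)
    have himg : (fun x => α * x ^ n) '' S ⊆ Set.Icc (0:ℝ) 1 := by
      rintro _ ⟨x, hx, rfl⟩
      have h1 := hx.1.1
      have h2 : x ^ n ≤ 1 := pow_le_one₀ hx.1.1 hx.1.2
      exact ⟨by positivity, by nlinarith [pow_nonneg h1 n]⟩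
    have h2 : ∫⁻ x in S, ENNReal.ofReal |α * (n * x ^ (n - 1))| * ‖f (α * x ^ n)‖ₑ ^ p ≤ N ^ p := by
      rw [← hcv, hNp]
      exact lintegral_mono_set himg
    calc ∫⁻ x in S, ‖f (φ x)‖ₑ ^ p
        ≤ ∫⁻ x in S, ENNReal.ofReal (1 / ρ) * (ENNReal.ofReal |α * (n * x ^ (n - 1))| * ‖f (α * x ^ n)‖ₑ ^ p) := by
          refine setLIntegral_mono' hSm fun x hx => ?_
          rw [hφ x hx.1, ← mul_assoc, ← ENNReal.ofReal_mul (by positivity)]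
          have h3 : 1 ≤ 1 / ρ * |α * (n * x ^ (n - 1))| := by
            have h0 := hx.1.1
            have hx2 : ρ ≤ α * x ^ n := hx.2
            have h4 : x ^ n ≤ n * x ^ (n - 1) := by
              have h5 : x ^ n ≤ x ^ (n - 1) := pow_le_pow_of_le_one h0 hx.1.2 (by omega)
              have h6 : (1:ℝ) ≤ n := by exact_mod_cast hn
              nlinarith [pow_nonneg h0 (n - 1)]
            rw [abs_of_nonneg (by positivity), one_div, ← div_eq_inv_mul, le_div_iff₀ hρ0, one_mul]
            exact hx2.trans (by gcongr)
          calc ‖f (α * x ^ n)‖ₑ ^ p = ENNReal.ofReal 1 * ‖f (α * x ^ n)‖ₑ ^ p := by simp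
            _ ≤ _ := by gcongr
      _ = ENNReal.ofReal (1 / ρ) * _ := lintegral_const_mul' _ _ ENNReal.ofReal_ne_top
      _ ≤ _ := by gcongr
  have hsmall : ∫⁻ x in Set.Icc (0:ℝ) 1 \ S, ‖f (φ x)‖ₑ ^ p ≤ ENNReal.ofReal (C ^ p) * N ^ p := by
    calc ∫⁻ x in Set.Icc (0:ℝ) 1 \ S, ‖f (φ x)‖ₑ ^ p
        ≤ ∫⁻ x in Set.Icc (0:ℝ) 1 \ S, ENNReal.ofReal (C ^ p) * N ^ p := by
          refine setLIntegral_mono' (measurableSet_Icc.diff hSm) fun x hx => ?_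
          rw [hφ x hx.1]
          have h0 := hx.1.1
          have hlt : α * x ^ n < ρ := by
            by_contra hcon
            exact hx.2 ⟨hx.1, not_lt.1 hcon⟩
          have h1 := hbf (α * x ^ n) ⟨by positivity, hlt⟩
          have h2 : |f (α * x ^ n)| ≤ C * N.toReal := by
            refine h1.trans ?_
            have : C * (α * x ^ n) ≤ C := by nlinarith
            gcongr
          have h3 : ‖f (α * x ^ n)‖ₑ ≤ ENNReal.ofReal C * N := by
            rw [Real.enorm_eq_ofReal_abs]
            refine (ENNReal.ofReal_le_ofReal h2).trans ?_
            rw [ENNReal.ofReal_mul hC, ENNReal.ofReal_toReal hN]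
          calc ‖f (α * x ^ n)‖ₑ ^ p ≤ (ENNReal.ofReal C * N) ^ p := by gcongr
            _ = _ := by rw [ENNReal.mul_rpow_of_nonneg _ _ hp0.le, ENNReal.ofReal_rpow_of_nonneg hC hp0.le]
      _ = ENNReal.ofReal (C ^ p) * N ^ p * volume (Set.Icc (0:ℝ) 1 \ S) := by
          rw [setLIntegral_const]
      _ ≤ ENNReal.ofReal (C ^ p) * N ^ p * 1 := by
          gcongr
          refine (measure_mono Set.sdiff_subset).trans ?_
          simp
      _ = _ := mul_one _
  have htot : ∫⁻ x, ‖f (φ x)‖ₑ ^ p ∂m01 ≤ ENNReal.ofReal (C ^ p + 1 / ρ) * N ^ p := by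
    have e1 : Set.Icc (0:ℝ) 1 = (Set.Icc (0:ℝ) 1 \ S) ∪ S := (Set.sdiff_union_of_subset hSs).symm
    rw [m01, e1]
    refine (lintegral_union_le _ _ _).trans ?_
    rw [ENNReal.ofReal_add (by positivity) (by positivity), add_mul]
    gcongr
  calc (∫⁻ x, ‖f (φ x)‖ₑ ^ p ∂m01) ^ (1 / p) ≤ (ENNReal.ofReal (C ^ p + 1 / ρ) * N ^ p) ^ (1 / p) := by
        gcongr
    _ = _ := by
      rw [ENNReal.mul_rpow_of_nonneg _ _ (by positivity), ENNReal.ofReal_rpow_of_nonneg (by positivity) (by positivity),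
        ← ENNReal.rpow_mul, mul_one_div_cancel hp0.ne', ENNReal.rpow_one]

lemma mz_integer (L : ℕ) (hL : 0 < L) (s : ℝ) (hs : 0 < s)
    (h : ∀ m : ℕ, ∃ N : ℕ, (N : ℝ) = L * s ^ m) : ∃ σ : ℕ, s = σ := by
  have hL' : (L:ℝ) ≠ 0 := by positivity
  obtain ⟨N1, h1⟩ := h 1
  set q : ℚ := (N1 : ℚ) / L with hq
  have hsq : s = (q : ℝ) := by
    rw [hq]; push_cast; rw [h1]; field_simp
  have hd : ∀ m : ℕ, q.den ^ m ∣ L := by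
    intro m
    obtain ⟨N, hN⟩ := h m
    have h2 : q ^ m = ((N : ℤ) : ℚ) / ((L : ℤ) : ℚ) := by
      have h3 : ((q ^ m : ℚ) : ℝ) = ((((N : ℤ) : ℚ) / ((L : ℤ) : ℚ) : ℚ) : ℝ) := by
        push_cast
        rw [← hsq, hN]; field_simp
      exact_mod_cast h3
    rw [← Rat.den_pow, h2, ← Rat.divInt_eq_div]
    exact_mod_cast Rat.den_dvd (N : ℤ) (L : ℤ)
  have hden : q.den = 1 := by
    by_contra hne
    have h2 : 2 ≤ q.den := by have := q.den_pos; omega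
    have h3 := Nat.le_of_dvd hL (hd L)
    have h4 : L < 2 ^ L := Nat.lt_two_pow_self
    have h5 : 2 ^ L ≤ q.den ^ L := Nat.pow_le_pow_left h2 L
    omega
  have hqpos : 0 < q := by
    have : (0:ℝ) < q := hsq ▸ hs
    exact_mod_cast this
  refine ⟨q.num.toNat, ?_⟩
  have h6 : q = ((q.num.toNat : ℕ) : ℚ) := by
    have h7 : ((q.num.toNat : ℕ) : ℤ) = q.num := Int.toNat_of_nonneg (Rat.num_nonneg.2 hqpos.le)
    have h8 : ((q.num : ℤ) : ℚ) = q := Rat.den_eq_one_iff q |>.1 hden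
    have h9 : ((q.num.toNat : ℕ) : ℚ) = ((q.num : ℤ) : ℚ) := by
      exact_mod_cast congrArg (Int.cast : ℤ → ℚ) h7
    exact (h9.trans h8).symm
  rw [hsq]; exact_mod_cast h6

lemma mz_density (Λ : ℕ → ℕ) (hmono : StrictMono Λ) (hpos : ∀ k, 0 < Λ k)
    (hsum : Summable fun k => 1 / (Λ k : ℝ)) (M : ℝ) (hM : 0 < M)
    (h : ∀ N, ∃ k, N ≤ k ∧ (Λ k : ℝ) ≤ M * k) : False := by
  obtain ⟨s, hs⟩ := summable_iff_vanishing_norm.1 hsum (1 / (2 * M)) (by positivity)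
  obtain ⟨N, hN⟩ : ∃ N, s ⊆ Finset.range N := s.exists_nat_subset_range
  obtain ⟨k, hk, hle⟩ := h (2 * N + 1)
  have h1 := hs (Finset.Ico N (k + 1)) (by
    rw [Finset.disjoint_left]
    intro a ha has
    have := Finset.mem_range.1 (hN has)
    have := (Finset.mem_Ico.1 ha).1
    omega)
  have hkpos : (0:ℝ) < k := by exact_mod_cast (by omega : 0 < k)
  have hc : ((Finset.Ico N (k+1)).card : ℝ) ≥ k / 2 := by
    rw [Nat.card_Ico, Nat.cast_sub (by omega)]
    have : (2 * N + 1 : ℝ) ≤ k := by exact_mod_cast hk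
    push_cast; linarith
  have h2 : (k / 2 : ℝ) * (1 / (M * k)) ≤ ∑ b ∈ Finset.Ico N (k + 1), 1 / (Λ b : ℝ) := by
    calc (k / 2 : ℝ) * (1 / (M * k)) ≤ ((Finset.Ico N (k+1)).card : ℝ) * (1 / (M * k)) := by gcongr
      _ = (Finset.Ico N (k+1)).card • (1 / (M * k)) := by rw [nsmul_eq_mul]
      _ ≤ _ := by
        apply Finset.card_nsmul_le_sum
        intro x hx
        have hxk : Λ x ≤ Λ k := hmono.monotone (by have := (Finset.mem_Ico.1 hx).2; omega)
        have hxp : (0:ℝ) < Λ x := by exact_mod_cast hpos x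
        apply one_div_le_one_div_of_le hxp
        exact le_trans (by exact_mod_cast hxk) hle
  have h3 : (k / 2 : ℝ) * (1 / (M * k)) = 1 / (2 * M) := by field_simp
  rw [h3] at h2
  have h4 := (le_abs_self _).trans_lt h1
  linarith

lemma mz_count (Λ : ℕ → ℕ) (hmono : StrictMono Λ) (hpos : ∀ k, 0 < Λ k)
    (hsum : Summable fun k => 1 / (Λ k : ℝ)) (σ : ℕ) (hσ : 1 ≤ σ) (d : ℝ) (hd : 0 < d)
    (H : ∀ j : ℕ, ∃ N0 : ℕ, ∀ k, N0 ≤ Λ k → ∃ i, (Λ i : ℝ) = Λ k * σ + j * d) : False := by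
  choose N0 hN0 using H
  set N := (Finset.range (σ + 1)).sup N0 with hN
  have hN' : ∀ j ≤ σ, ∀ k, N ≤ Λ k → ∃ i, (Λ i : ℝ) = Λ k * σ + j * d := by
    intro j hj k hk
    exact hN0 j k (le_trans (Finset.le_sup (Finset.mem_range.2 (by omega))) hk)
  set L := Λ N with hL
  have hLN : N ≤ L := hmono.id_le N
  have key : ∀ n : ℕ, ∃ K : ℕ, n ≤ K ∧ (1 ≤ n → σ ^ n ≤ K) ∧ ∀ k ≤ K, ∃ i, (Λ i : ℝ) = σ ^ n * L + k * d := by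
    intro n
    induction n with
    | zero =>
      refine ⟨0, le_rfl, by simp, ?_⟩
      intro k hk
      obtain rfl : k = 0 := by omega
      exact ⟨N, by simp [hL]⟩
    | succ n ih =>
      obtain ⟨K, hnK, hσK, hK⟩ := ih
      refine ⟨σ * K + σ, ?_, ?_, ?_⟩
      · nlinarith
      · intro _
        rcases Nat.eq_zero_or_pos n with rfl | hn
        · simp
        · have := hσK hn
          rw [pow_succ]; nlinarith
      · intro k hk
        obtain ⟨a, j, ha, hj, rfl⟩ : ∃ a j, a ≤ K ∧ j ≤ σ ∧ k = σ * a + j := by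
          rcases le_or_gt k (σ * K) with h | h
          · refine ⟨k / σ, k % σ, ?_, (Nat.mod_lt _ hσ).le, (Nat.div_add_mod k σ).symm⟩
            exact Nat.div_le_of_le_mul h
          · exact ⟨K, k - σ * K, le_rfl, by omega, by omega⟩
        obtain ⟨i, hi⟩ := hK a ha
        have hge : N ≤ Λ i := by
          refine hLN.trans ?_
          have h1 : (1:ℝ) ≤ (σ:ℝ) ^ n := one_le_pow₀ (by exact_mod_cast hσ)
          have h2 : (L : ℝ) ≤ Λ i := by
            rw [hi]
            have : (0:ℝ) ≤ a * d := by positivity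
            nlinarith [(Nat.cast_nonneg L : (0:ℝ) ≤ L)]
          exact_mod_cast h2
        obtain ⟨i', hi'⟩ := hN' j hj i hge
        refine ⟨i', ?_⟩
        rw [hi', hi]; push_cast; ring
  refine mz_density Λ hmono hpos hsum (L + d) (by positivity) fun n => ?_
  obtain ⟨K, hnK, hσK, hK⟩ := key (n + 1)
  refine ⟨K, by omega, ?_⟩
  have hσK' : ((σ:ℝ) ^ (n+1)) ≤ K := by exact_mod_cast hσK (by omega)
  choose! i hi using hK
  -- the K+1 indices are distinct
  have hinj : Set.InjOn i (Finset.range (K + 1)) := by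
    intro a ha b hb hab
    have ha' := hi a (by have := Finset.mem_range.1 ha; omega)
    have hb' := hi b (by have := Finset.mem_range.1 hb; omega)
    rw [hab, hb'] at ha'
    have h1 : (b:ℝ) * d = a * d := by linarith
    have := mul_right_cancel₀ hd.ne' h1
    exact_mod_cast this.symm
  have hex : ∃ a ∈ Finset.range (K + 1), K ≤ i a := by
    by_contra! hcon
    have h1 : (Finset.range (K+1)).image i ⊆ Finset.range K := by
      intro y hy
      obtain ⟨a, ha, rfl⟩ := Finset.mem_image.1 hy
      exact Finset.mem_range.2 (hcon a ha)
    have h2 := Finset.card_le_card h1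
    rw [Finset.card_image_of_injOn hinj] at h2
    simp at h2
  obtain ⟨a, ha, hKa⟩ := hex
  have haK : a ≤ K := by have := Finset.mem_range.1 ha; omega
  have h3 : (Λ K : ℝ) ≤ Λ (i a) := by exact_mod_cast hmono.monotone hKa
  rw [hi a haK] at h3
  have h4 : (a:ℝ) ≤ K := by exact_mod_cast haK
  calc (Λ K : ℝ) ≤ σ ^ (n+1) * L + a * d := h3
    _ ≤ K * L + K * d := by gcongr
    _ = _ := by ring

lemma mz_alg_mul (P Q : AddMonoidAlgebra ℝ ℝ) (a b : ℝ) (hP : ∀ r < a, P.coeff r = 0)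
    (hQ : ∀ r < b, Q.coeff r = 0) :
    (∀ r < a + b, (P * Q).coeff r = 0) ∧ (P * Q).coeff (a + b) = P.coeff a * Q.coeff b := by
  constructor
  · intro r hr
    rw [AddMonoidAlgebra.coeff_mul_apply_left]
    refine Finset.sum_eq_zero fun h _ => ?_
    rcases lt_or_ge h a with h1 | h1
    · simp [hP h h1]
    · simp [hQ (-h + r) (by linarith)]
  · rw [AddMonoidAlgebra.coeff_mul_apply_left]
    rw [Finsupp.sum, Finset.sum_eq_single a]
    · simp
    · intro h _ hne
      rcases lt_or_gt_of_ne hne with h1 | h1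
      · simp [hP h h1]
      · simp [hQ (-h + (a + b)) (by linarith)]
    · intro h
      simp [Finsupp.notMem_support_iff.1 h]

lemma mz_alg_one (r : ℝ) : (1 : AddMonoidAlgebra ℝ ℝ).coeff r = if r = 0 then 1 else 0 := by
  rw [AddMonoidAlgebra.one_def, AddMonoidAlgebra.coeff_single]
  simp [Finsupp.single_apply, eq_comm]

lemma mz_alg_pow (P : AddMonoidAlgebra ℝ ℝ) (a : ℝ) (hP : ∀ r < a, P.coeff r = 0) (n : ℕ) :
    (∀ r < n * a, (P ^ n).coeff r = 0) ∧ (P ^ n).coeff (n * a) = P.coeff a ^ n := by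
  induction n with
  | zero =>
    constructor
    · intro r hr
      rw [pow_zero, mz_alg_one, if_neg]
      intro h; simp [h] at hr
    · rw [pow_zero, mz_alg_one, if_pos (by simp), pow_zero]
  | succ n ih =>
    have h := mz_alg_mul (P ^ n) P (n * a) a ih.1 hP
    have e : ((n + 1 : ℕ) : ℝ) * a = n * a + a := by push_cast; ring
    rw [e, pow_succ, pow_succ]
    exact ⟨h.1, by rw [h.2, ih.2]⟩

lemma mz_choose_ne (v : ℕ → ℝ) (j : ℕ) (hv : v j ≠ 0) :
    ∀ᶠ n : ℕ in Filter.atTop, ∑ i ∈ Finset.range (j + 1), (n.choose i : ℝ) * v i ≠ 0 := by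
  classical
  set Q : Polynomial ℝ := ∑ i ∈ Finset.range (j + 1),
    Polynomial.C (v i / (Nat.factorial i : ℝ)) * descPochhammer ℝ i with hQ
  have hc : Q.coeff j ≠ 0 := by
    rw [hQ, Polynomial.finsetSum_coeff, Finset.sum_range_succ, Finset.sum_eq_zero, zero_add,
      Polynomial.coeff_C_mul]
    · have h1 : (descPochhammer ℝ j).coeff j = 1 := by
        have := (monic_descPochhammer ℝ j).coeff_natDegree
        rwa [descPochhammer_natDegree] at this
      rw [h1, mul_one]
      exact div_ne_zero hv (by exact_mod_cast Nat.factorial_ne_zero j)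
    · intro i hi
      rw [Polynomial.coeff_C_mul, Polynomial.coeff_eq_zero_of_natDegree_lt, mul_zero]
      rw [descPochhammer_natDegree]; exact Finset.mem_range.1 hi
  have hQ0 : Q ≠ 0 := by rintro h; simp [h] at hc
  have hev : ∀ n : ℕ, Q.eval (n : ℝ) = ∑ i ∈ Finset.range (j + 1), (n.choose i : ℝ) * v i := by
    intro n
    rw [hQ, Polynomial.eval_finsetSum]
    refine Finset.sum_congr rfl fun i _ => ?_
    rw [Polynomial.eval_mul, Polynomial.eval_C, descPochhammer_eval_eq_descFactorial,
      Nat.descFactorial_eq_factorial_mul_choose]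
    have : (Nat.factorial i : ℝ) ≠ 0 := by exact_mod_cast Nat.factorial_ne_zero i
    push_cast; field_simp
  have hfin : {x : ℝ | Q.IsRoot x}.Finite := Polynomial.finite_setOfPred_isRoot hQ0
  have h1 : ∀ᶠ n : ℕ in Filter.cofinite, (n : ℝ) ∉ {x : ℝ | Q.IsRoot x} :=
    (Nat.cast_injective.tendsto_cofinite).eventually hfin.eventually_cofinite_notMem
  rw [Nat.cofinite_eq_atTop] at h1
  filter_upwards [h1] with n hn h0
  exact hn (by change Q.eval _ = 0; rw [hev, h0])

lemma mz_alg_two (P : AddMonoidAlgebra ℝ ℝ) (a d : ℝ) (hd : 0 < d) (ha : P.coeff a ≠ 0)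
    (had : P.coeff (a + d) ≠ 0) (hP : ∀ r < a + d, r ≠ a → P.coeff r = 0) (j : ℕ) :
    ∀ᶠ n : ℕ in Filter.atTop, (P ^ n).coeff (n * a + j * d) ≠ 0 := by
  set c := P.coeff a with hc
  set u : AddMonoidAlgebra ℝ ℝ := AddMonoidAlgebra.single (-a) c⁻¹ * P - 1 with hu
  have hPu : P = AddMonoidAlgebra.single a c * (u + 1) := by
    rw [hu, sub_add_cancel, ← mul_assoc, AddMonoidAlgebra.single_mul_single, add_neg_cancel,
      mul_inv_cancel₀ ha, ← AddMonoidAlgebra.one_def, one_mul]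
  have huc : ∀ r, u.coeff r = c⁻¹ * P.coeff (a + r) - if r = 0 then 1 else 0 := by
    intro r
    rw [hu, AddMonoidAlgebra.coeff_sub, Finsupp.sub_apply, mz_alg_one,
      AddMonoidAlgebra.coeff_single_mul_apply, neg_neg]
  have hu0 : ∀ r < d, u.coeff r = 0 := by
    intro r hr
    rw [huc]
    by_cases h : r = 0
    · rw [h, add_zero, if_pos rfl, ← hc, inv_mul_cancel₀ ha, sub_self]
    · rw [if_neg h, hP _ (by linarith) (by simpa using h)]; simp
  have hud : u.coeff d ≠ 0 := by
    rw [huc, if_neg hd.ne', sub_zero]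
    exact mul_ne_zero (inv_ne_zero ha) had
  have hv := mz_choose_ne (fun i => (u ^ i).coeff (j * d)) j
    (by rw [(mz_alg_pow u d hu0 j).2]; exact pow_ne_zero _ hud)
  filter_upwards [hv, Filter.eventually_ge_atTop j] with n hn hjn
  rw [hPu, mul_pow, AddMonoidAlgebra.single_pow, AddMonoidAlgebra.coeff_single_mul_apply]
  refine mul_ne_zero (pow_ne_zero _ ha) ?_
  have e : -(n • a) + (n * a + j * d) = j * d := by rw [nsmul_eq_mul]; ring
  rw [e, add_pow]
  have e2 : (∑ m ∈ Finset.range (n + 1), u ^ m * 1 ^ (n - m) * (n.choose m : AddMonoidAlgebra ℝ ℝ)).coeff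
      (j * d) = ∑ m ∈ Finset.range (n + 1), (n.choose m : ℝ) * (u ^ m).coeff (j * d) := by
    rw [AddMonoidAlgebra.coeff_sum, Finsupp.finsetSum_apply]
    refine Finset.sum_congr rfl fun m _ => ?_
    rw [one_pow, mul_one, mul_comm, ← nsmul_eq_mul, AddMonoidAlgebra.coeff_smul,
      Finsupp.smul_apply, nsmul_eq_mul]
  rw [e2, ← Finset.sum_subset (Finset.range_subset_range.2 (Nat.succ_le_succ hjn))]
  · exact hn
  · intro m _ hm
    have hm' : j < m := by simpa using hm
    rw [(mz_alg_pow u d hu0 m).1, mul_zero]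
    have : (j : ℝ) < m := by exact_mod_cast hm'
    nlinarith

noncomputable def mzEv (x : ℝ) (hx : 0 < x) : Multiplicative ℝ →* ℝ where
  toFun a := x ^ a.toAdd
  map_one' := by simp
  map_mul' a b := by simp [Real.rpow_add hx]

lemma mz_ev_pow (l : ℕ) (c s : Fin l → ℝ) (x : ℝ) (hx : 0 < x) (n : ℕ) :
    (∑ i, c i * x ^ (s i)) ^ n =
      ∑ r ∈ ((∑ i, AddMonoidAlgebra.single (s i) (c i)) ^ n : AddMonoidAlgebra ℝ ℝ).coeff.support,
        ((∑ i, AddMonoidAlgebra.single (s i) (c i)) ^ n : AddMonoidAlgebra ℝ ℝ).coeff r * x ^ r := by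
  set P : AddMonoidAlgebra ℝ ℝ := ∑ i, AddMonoidAlgebra.single (s i) (c i) with hP
  have h1 : AddMonoidAlgebra.lift ℝ ℝ ℝ (mzEv x hx) P = ∑ i, c i * x ^ (s i) := by
    rw [hP, map_sum]
    refine Finset.sum_congr rfl fun i _ => ?_
    rw [AddMonoidAlgebra.lift_single]; rfl
  rw [← h1, ← map_pow, AddMonoidAlgebra.lift_apply]
  rfl

lemma mz_P_coeff (l : ℕ) (c s : Fin l → ℝ) (r : ℝ) :
    (∑ i, AddMonoidAlgebra.single (s i) (c i) : AddMonoidAlgebra ℝ ℝ).coeff r =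
      ∑ i, if s i = r then c i else 0 := by
  classical
  rw [AddMonoidAlgebra.coeff_sum, Finsupp.finsetSum_apply]
  refine Finset.sum_congr rfl fun i _ => ?_
  rw [AddMonoidAlgebra.coeff_single, Finsupp.single_apply]

lemma mz_ae_pos : ∀ᵐ x ∂m01, 0 < x ∧ x ≤ 1 := by
  have h : m01 = volume.restrict (Set.Ioc (0:ℝ) 1) := by
    rw [m01]; exact (Measure.restrict_congr_set Ioc_ae_eq_Icc).symm
  rw [h, ae_restrict_iff' measurableSet_Ioc]
  exact Filter.Eventually.of_forall fun x hx => hx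

lemma mz_mem_congr {p : ℝ} {Λ : ℕ → ℝ} {f g : ℝ → ℝ} (h : f =ᵐ[m01] g) (hf : memMuntz p Λ f) :
    memMuntz p Λ g := by
  intro ε hε
  obtain ⟨w, hw, hle⟩ := hf ε hε
  refine ⟨w, hw, le_trans (le_of_eq ?_) hle⟩
  apply eLpNorm_congr_ae
  filter_upwards [h] with x hx
  rw [hx]

lemma mz_mem_span {p : ℝ} {Λ : ℕ → ℝ} {f : ℝ → ℝ} (hf : inSpan Λ f) : memMuntz p Λ f := by
  intro ε hε
  refine ⟨f, hf, ?_⟩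
  simp

lemma mz_key (p : ℝ) (hp : 1 ≤ p) (Λ : ℕ → ℕ) (hmono : StrictMono Λ) (hpos : ∀ k, 0 < Λ k)
    (hsum : Summable fun k => 1 / (Λ k : ℝ)) (l : ℕ) (c s : Fin l → ℝ) (hs : ∀ i, 0 < s i)
    (φ : ℝ → ℝ) (hφ : ∀ x, φ x = ∑ i, c i * x ^ (s i))
    (hinv : muntzInvariant p (fun j => (Λ j : ℝ)) φ) (k : ℕ) (r : ℝ)
    (hr : ((∑ i, AddMonoidAlgebra.single (s i) (c i)) ^ (Λ k) : AddMonoidAlgebra ℝ ℝ).coeff r ≠ 0) :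
    ∃ j, (Λ j : ℝ) = r := by
  set P : AddMonoidAlgebra ℝ ℝ := ∑ i, AddMonoidAlgebra.single (s i) (c i) with hP
  have hsp : inSpan (fun j => (Λ j : ℝ)) (fun x => x ^ (Λ k : ℝ)) :=
    ⟨1, fun _ => 1, fun _ => k, fun x => by simp⟩
  have h1 := hinv _ (mz_span_cont hsp).continuousOn (mz_mem_span hsp)
  have hP0 : ∀ r < (0:ℝ), P.coeff r = 0 := by
    intro r hr
    rw [hP, mz_P_coeff]
    refine Finset.sum_eq_zero fun i _ => if_neg ?_
    have := hs i
    linarith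
  refine mz_exponents p hp Λ hmono hpos hsum (P ^ (Λ k)).coeff.support ?_ (fun r => (P ^ (Λ k)).coeff r)
    (mz_mem_congr ?_ h1) r (Finsupp.mem_support_iff.2 hr) hr
  · intro q hq
    by_contra! hq0
    exact Finsupp.mem_support_iff.1 hq ((mz_alg_pow P 0 hP0 (Λ k)).1 q (by simpa using hq0))
  · filter_upwards [mz_ae_pos] with x hx
    rw [Real.rpow_natCast, hφ]
    exact mz_ev_pow l c s x hx.1 (Λ k)

lemma mz_iter (Λ : ℕ → ℕ) (η : ℝ) (h : ∀ k, ∃ j, (Λ j : ℝ) = Λ k * η) (k m : ℕ) :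
    ∃ j, (Λ j : ℝ) = Λ k * η ^ m := by
  induction m with
  | zero => exact ⟨k, by simp⟩
  | succ m ih =>
    obtain ⟨i, hi⟩ := ih
    obtain ⟨j, hj⟩ := h i
    exact ⟨j, by rw [hj, hi]; ring⟩

lemma mz_forward (p : ℝ) (hp : 1 ≤ p)
    (Λ : ℕ → ℕ) (hmono : StrictMono Λ) (hpos : ∀ k, 0 < Λ k)
    (hsum : Summable fun k => 1 / (Λ k : ℝ))
    (l : ℕ) (c : Fin l → ℝ) (s : Fin l → ℝ)
    (hc : ∀ i, c i ≠ 0) (hs : ∀ i, 0 < s i) (hsinj : Function.Injective s)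
    (φ : ℝ → ℝ) (hφ : ∀ x, φ x = ∑ i, c i * x ^ (s i))
    (hmaps : Set.MapsTo φ (Set.Icc (0 : ℝ) 1) (Set.Icc (0 : ℝ) 1))
    (hinv : muntzInvariant p (fun j => (Λ j : ℝ)) φ) :
    ∃ α η : ℝ, 0 ≤ α ∧ α ≤ 1 ∧ 0 < η ∧
        (∀ x ∈ Set.Icc (0 : ℝ) 1, φ x = α * x ^ η) ∧
        (∀ k m : ℕ, ∃ j : ℕ, (Λ j : ℝ) = (Λ k : ℝ) * η ^ m) := by
  classical
  have hkey := mz_key p hp Λ hmono hpos hsum l c s hs φ hφ hinv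
  set P : AddMonoidAlgebra ℝ ℝ := ∑ i, AddMonoidAlgebra.single (s i) (c i) with hP
  have hPc : ∀ i, P.coeff (s i) = c i := by
    intro i
    rw [hP, mz_P_coeff, Finset.sum_eq_single i]
    · simp
    · intro b _ hb; rw [if_neg]; exact fun h => hb (hsinj h)
    · simp
  have hPn : ∀ r, (∀ i, s i ≠ r) → P.coeff r = 0 := by
    intro r h
    rw [hP, mz_P_coeff]
    exact Finset.sum_eq_zero fun i _ => if_neg (h i)
  rcases Nat.eq_zero_or_pos l with rfl | hl
  · refine ⟨0, 1, le_rfl, zero_le_one, one_pos, fun x _ => by rw [hφ]; simp, fun k m => ⟨k, by simp⟩⟩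
  haveI : Nonempty (Fin l) := ⟨⟨0, hl⟩⟩
  obtain ⟨i0, hi0⟩ := Finite.exists_min s
  have hlow : ∀ r < s i0, P.coeff r = 0 := fun r hr => hPn r fun i h => by
    have := hi0 i; linarith
  have hmul : ∀ k, ∃ j, (Λ j : ℝ) = Λ k * s i0 := by
    intro k
    apply hkey k
    rw [(mz_alg_pow P (s i0) hlow (Λ k)).2, hPc]
    exact pow_ne_zero _ (hc i0)
  have hit := mz_iter Λ (s i0) hmul
  by_cases hone : ∀ i, i = i0
  · have hφ' : ∀ x, φ x = c i0 * x ^ (s i0) := by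
      intro x
      rw [hφ, Finset.sum_eq_single i0]
      · intro b _ hb; exact absurd (hone b) hb
      · simp
    have h1 := hmaps (Set.right_mem_Icc.2 zero_le_one)
    rw [hφ', Real.one_rpow, mul_one] at h1
    exact ⟨c i0, s i0, h1.1, h1.2, hs i0, fun x _ => hφ' x, hit⟩
  · exfalso
    push Not at hone
    obtain ⟨i', hi'⟩ := hone
    obtain ⟨i1, hi1, hmin⟩ := Finset.exists_min_image (Finset.univ.erase i0) s
      ⟨i', Finset.mem_erase.2 ⟨hi', Finset.mem_univ _⟩⟩
    have hne : i1 ≠ i0 := (Finset.mem_erase.1 hi1).1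
    have hlt : s i0 < s i1 := lt_of_le_of_ne (hi0 i1) fun h => hne (hsinj h.symm)
    obtain ⟨σ, hσ⟩ := mz_integer (Λ 0) (hpos 0) (s i0) (hs i0) fun m => by
      obtain ⟨j, hj⟩ := hit 0 m
      exact ⟨Λ j, hj⟩
    have hσ1 : 1 ≤ σ := by
      have := hs i0
      rw [hσ] at this
      exact_mod_cast this
    refine mz_count Λ hmono hpos hsum σ hσ1 (s i1 - s i0) (by linarith) fun j => ?_
    have e : s i0 + (s i1 - s i0) = s i1 := by ring
    have h2 := mz_alg_two P (s i0) (s i1 - s i0) (by linarith) (by rw [hPc]; exact hc i0)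
      (by rw [e, hPc]; exact hc i1)
      (fun r hr hr0 => hPn r fun i h => by
        by_cases hii : i = i0
        · exact hr0 (by rw [← h, hii])
        · have := hmin i (Finset.mem_erase.2 ⟨hii, Finset.mem_univ _⟩)
          rw [e] at hr; linarith) j
    obtain ⟨N0, hN0⟩ := Filter.eventually_atTop.1 h2
    refine ⟨N0, fun k hk => ?_⟩
    have h3 := hkey k _ (hN0 (Λ k) hk)
    rwa [hσ] at h3 ⊢

lemma mz_backward (p : ℝ) (hp : 1 ≤ p)
    (Λ : ℕ → ℕ) (hmono : StrictMono Λ) (hpos : ∀ k, 0 < Λ k)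
    (hsum : Summable fun k => 1 / (Λ k : ℝ)) (φ : ℝ → ℝ)
    (h : ∃ α η : ℝ, 0 ≤ α ∧ α ≤ 1 ∧ 0 < η ∧
        (∀ x ∈ Set.Icc (0 : ℝ) 1, φ x = α * x ^ η) ∧
        (∀ k m : ℕ, ∃ j : ℕ, (Λ j : ℝ) = (Λ k : ℝ) * η ^ m)) :
    muntzInvariant p (fun j => (Λ j : ℝ)) φ ∧
        ∃ C : ℝ, 0 < C ∧ ∀ f : ℝ → ℝ, ContinuousOn f (Set.Ico (0 : ℝ) 1) →
          memMuntz p (fun j => (Λ j : ℝ)) f →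
          eLpNorm (fun x => f (φ x)) (ENNReal.ofReal p) m01 ≤
            ENNReal.ofReal C * eLpNorm f (ENNReal.ofReal p) m01 := by
  obtain ⟨α, η, hα0, hα1, hη, hφ, hit⟩ := h
  obtain ⟨n, hn⟩ := mz_integer (Λ 0) (hpos 0) η hη fun m => by
    obtain ⟨j, hj⟩ := hit 0 m
    exact ⟨Λ j, hj⟩
  subst hn
  have hn1 : 1 ≤ n := by exact_mod_cast hη
  obtain ⟨K, hK, hb⟩ := mz_comp_bound p hp Λ hmono hpos hsum φ α n hn1 hα0 hα1
    (fun x hx => by rw [hφ x hx, Real.rpow_natCast])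
  refine ⟨?_, K, hK, hb⟩
  intro f hfc hfm ε hε
  obtain ⟨g, hg, hle⟩ := hfm (ε / K) (by positivity)
  have hgc := mz_span_cont hg
  have hsubm : memMuntz p (fun j => (Λ j : ℝ)) (fun x => f x - g x) := by
    intro δ hδ
    obtain ⟨w, hw, hwle⟩ := hfm δ hδ
    refine ⟨fun x => w x - g x, mz_span_sub hw hg, ?_⟩
    refine le_trans (le_of_eq ?_) hwle
    congr 1; funext x; ring
  have h1 := hb (fun x => f x - g x) (hfc.sub hgc.continuousOn) hsubm
  obtain ⟨N, b, k, hgf⟩ := hg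
  choose j hj using fun k => hit k 1
  refine ⟨fun x => ∑ i, (b i * α ^ (Λ (k i) : ℝ)) * x ^ (Λ (j (k i)) : ℝ),
    ⟨N, fun i => b i * α ^ (Λ (k i) : ℝ), fun i => j (k i), fun x => rfl⟩, ?_⟩
  calc eLpNorm (fun x => f (φ x) - ∑ i, (b i * α ^ (Λ (k i) : ℝ)) * x ^ (Λ (j (k i)) : ℝ))
        (ENNReal.ofReal p) m01 = eLpNorm (fun x => f (φ x) - g (φ x)) (ENNReal.ofReal p) m01 := by
        apply eLpNorm_congr_ae
        filter_upwards [mz_ae_pos] with x hx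
        rw [hgf (φ x), hφ x ⟨hx.1.le, hx.2⟩]
        congr 1
        refine Finset.sum_congr rfl fun i _ => ?_
        rw [hj, pow_one, Real.mul_rpow hα0 (Real.rpow_nonneg hx.1.le _), ← Real.rpow_mul hx.1.le,
          mul_comm (n : ℝ)]
        ring
    _ ≤ ENNReal.ofReal K * ENNReal.ofReal (ε / K) := h1.trans (by gcongr)
    _ = ENNReal.ofReal ε := by
        rw [← ENNReal.ofReal_mul hK.le, mul_div_cancel₀ _ hK.ne']

/-- For `Λ` a strictly increasing sequence of positive integers with
`∑ 1/λ_k < ∞` and a real-exponent polynomial `φ` mapping `[0,1]` into `[0,1]`, the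
following are equivalent: (i) `C_φ` leaves `M^p_Λ` invariant; (ii) `φ(x) = α x^η` with
`0 ≤ α ≤ 1`, `η > 0`, and `λ·η^m ∈ Λ` for all `λ ∈ Λ`, `m ≥ 0`; (iii) (i) holds and
moreover `C_φ : M^p_Λ → M^p_Λ` is bounded. -/
theorem muntz_invariant_iff
    (p : ℝ) (hp : 1 ≤ p)
    (Λ : ℕ → ℕ) (hmono : StrictMono Λ) (hpos : ∀ k, 0 < Λ k)
    (hsum : Summable fun k => 1 / (Λ k : ℝ))
    (l : ℕ) (c : Fin l → ℝ) (s : Fin l → ℝ)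
    (hc : ∀ i, c i ≠ 0) (hs : ∀ i, 0 < s i) (hsinj : Function.Injective s)
    (φ : ℝ → ℝ) (hφ : ∀ x, φ x = ∑ i, c i * x ^ (s i))
    (hmaps : Set.MapsTo φ (Set.Icc (0 : ℝ) 1) (Set.Icc (0 : ℝ) 1)) :
    (muntzInvariant p (fun j => (Λ j : ℝ)) φ ↔
      (∃ α η : ℝ, 0 ≤ α ∧ α ≤ 1 ∧ 0 < η ∧
        (∀ x ∈ Set.Icc (0 : ℝ) 1, φ x = α * x ^ η) ∧
        (∀ k m : ℕ, ∃ j : ℕ, (Λ j : ℝ) = (Λ k : ℝ) * η ^ m))) ∧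
    (muntzInvariant p (fun j => (Λ j : ℝ)) φ ↔
      (muntzInvariant p (fun j => (Λ j : ℝ)) φ ∧
        ∃ C : ℝ, 0 < C ∧ ∀ f : ℝ → ℝ, ContinuousOn f (Set.Ico (0 : ℝ) 1) →
          memMuntz p (fun j => (Λ j : ℝ)) f →
          eLpNorm (fun x => f (φ x)) (ENNReal.ofReal p) m01 ≤
            ENNReal.ofReal C * eLpNorm f (ENNReal.ofReal p) m01)) := by
  have hf := mz_forward p hp Λ hmono hpos hsum l c s hc hs hsinj φ hφ hmaps
  have hb := mz_backward p hp Λ hmono hpos hsum φ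
  exact ⟨⟨hf, fun h => (hb h).1⟩, ⟨fun h => hb (hf h), fun h => h.1⟩⟩
end

section
/- Let (s_k)_{k≥1} be a sequence of pairwise distinct positive real numbers which is a finite union of subsequences each of which is strictly increasing with positive infimum of consecutive gaps (i.e., each satisfies inf_k (s_{k+1} − s_k) > 0), and let (a_k)_{k≥1} be real numbers with limsup_k |a_k|^{1/s_k} < ∞. Then there exists ρ > 0 such that the series f(x) = ∑_{k≥1} a_k x^{s_k} converges uniformly on the interval [0, ρ]. -/
open Filter

/-- If `(s_k)` is a sequence of pairwise distinct positive reals which is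
a finite union of subsequences each satisfying the gap condition (any two distinct terms
of the same class differ by at least some `γ > 0`), and `limsup |a_k|^{1/s_k} < ∞`
(i.e. the quantities are eventually bounded above), then the series `∑ a_k x^{s_k}`
converges uniformly on some interval `[0, ρ]` with `ρ > 0`. -/
theorem real_exponent_series_uniform_convergence
    (s : ℕ → ℝ) (hspos : ∀ k, 0 < s k) (hsinj : Function.Injective s)
    (N : ℕ) (cl : ℕ → Fin N)
    (hgap : ∀ j : Fin N, ∃ γ : ℝ, 0 < γ ∧
      ∀ k l : ℕ, cl k = j → cl l = j → s k < s l → s k + γ ≤ s l)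
    (a : ℕ → ℝ)
    (hL : ∃ L : ℝ, ∀ᶠ k in atTop, |a k| ^ (1 / s k) ≤ L) :
    ∃ ρ : ℝ, 0 < ρ ∧ ∃ f : ℝ → ℝ,
      TendstoUniformlyOn (fun n x => ∑ k ∈ Finset.range n, a k * x ^ (s k)) f
        atTop (Set.Icc 0 ρ) := by
  classical
  haveI : Nonempty (Fin N) := ⟨cl 0⟩
  choose g hg0 hg using hgap
  obtain ⟨j0, hj0⟩ := Finite.exists_min g
  set γ := g j0 with hγ
  have hγ0 : 0 < γ := hg0 j0
  have hgap' : ∀ k l : ℕ, cl k = cl l → s k < s l → s k + γ ≤ s l := by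
    intro k l h h'
    have h1 := hg (cl l) k l h rfl h'
    have h2 := hj0 (cl l)
    linarith
  -- summability
  have hsum : Summable (fun k => ((1:ℝ)/2) ^ (s k)) := by
    set r : ℝ := ((1:ℝ)/2) ^ γ with hr
    have hr0 : 0 ≤ r := by positivity
    have hr1 : r < 1 := Real.rpow_lt_one (by norm_num) (by norm_num) hγ0
    have hgeo : Summable (fun m : ℕ => r ^ m) := summable_geometric_of_lt_one hr0 hr1
    have hfin : Summable (fun _ : Fin N => (1:ℝ)) := Summable.of_finite
    have hprod : Summable (fun p : Fin N × ℕ => (1:ℝ) * r ^ p.2) :=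
      hfin.mul_of_nonneg hgeo (fun _ => zero_le_one) (fun m => pow_nonneg hr0 m)
    have hinj : Function.Injective (fun k : ℕ => (cl k, ⌊s k / γ⌋₊)) := by
      have key : ∀ k l : ℕ, cl k = cl l → ⌊s k / γ⌋₊ = ⌊s l / γ⌋₊ → ¬ s k < s l := by
        intro k l h1 h2 h3
        have h4 := hgap' k l h1 h3
        have h5 : s l / γ < ⌊s l / γ⌋₊ + 1 := Nat.lt_floor_add_one _
        have h6 : (⌊s k / γ⌋₊ : ℝ) ≤ s k / γ := Nat.floor_le (div_nonneg (hspos k).le hγ0.le)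
        rw [h2] at h6
        have h7 : s k / γ + 1 ≤ s l / γ := by
          rw [div_add_one hγ0.ne']
          exact div_le_div_of_nonneg_right h4 hγ0.le
        linarith
      intro k l h
      simp only [Prod.mk.injEq] at h
      apply hsinj
      exact le_antisymm (not_lt.mp (key l k h.1.symm h.2.symm)) (not_lt.mp (key k l h.1 h.2))
    refine Summable.of_nonneg_of_le (fun k => by positivity) (fun k => ?_)
      (hprod.comp_injective hinj)
    simp only [Function.comp, one_mul]
    rw [hr, ← Real.rpow_natCast, ← Real.rpow_mul (by norm_num)]
    apply Real.rpow_le_rpow_of_exponent_ge (by norm_num) (by norm_num)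
    have h6 : (⌊s k / γ⌋₊ : ℝ) ≤ s k / γ := Nat.floor_le (div_nonneg (hspos k).le hγ0.le)
    rw [le_div_iff₀ hγ0] at h6
    linarith
  obtain ⟨L, hL⟩ := hL
  set M := max L 1 with hM
  have hM0 : 0 < M := lt_of_lt_of_le one_pos (le_max_right _ _)
  refine ⟨1 / (2 * M), by positivity,
    _, tendstoUniformlyOn_tsum_nat_eventually hsum ?_⟩
  filter_upwards [hL] with k hk x hx
  have hs := hspos k
  have ha : |a k| ≤ M ^ (s k) := by
    have h1 : (|a k| ^ (1 / s k)) ^ (s k) ≤ M ^ (s k) :=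
      Real.rpow_le_rpow (by positivity) (hk.trans (le_max_left _ _)) hs.le
    rwa [← Real.rpow_mul (abs_nonneg _), one_div_mul_cancel hs.ne', Real.rpow_one] at h1
  have hx' : x ^ (s k) ≤ (1 / (2 * M)) ^ (s k) := Real.rpow_le_rpow hx.1 hx.2 hs.le
  have hx0 : 0 ≤ x ^ (s k) := Real.rpow_nonneg hx.1 _
  rw [Real.norm_eq_abs, abs_mul, abs_of_nonneg hx0]
  calc |a k| * x ^ (s k) ≤ M ^ (s k) * (1 / (2 * M)) ^ (s k) :=
        mul_le_mul ha hx' hx0 (by positivity)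
    _ = (1 / 2) ^ (s k) := by
        rw [← Real.mul_rpow hM0.le (by positivity)]
        congr 1
        field_simp
end

section
/- Let (s_k)_{k≥1} be a sequence of pairwise distinct positive real numbers which is a finite union of subsequences each of which is strictly increasing with positive infimum of consecutive gaps, and let (a_k)_{k≥1} be real numbers with limsup_k |a_k|^{1/s_k} < ∞, so that f(x) = ∑_{k≥1} a_k x^{s_k} converges uniformly on some interval [0, ρ] with ρ > 0. If f(x) = 0 for all x in some interval [0, ρ₀] with 0 < ρ₀ ≤ ρ, then a_k = 0 for every k. -/
open Filter

lemma aux_summable (s : ℕ → ℝ) (hspos : ∀ k, 0 < s k) (hsinj : Function.Injective s)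
    (N : ℕ) (cl : ℕ → Fin N)
    (hgap : ∀ j : Fin N, ∃ γ : ℝ, 0 < γ ∧
      ∀ k l : ℕ, cl k = j → cl l = j → s k < s l → s k + γ ≤ s l) :
    Summable (fun k => (1 / 2 : ℝ) ^ (s k)) := by
  have h1 : ∀ j : Fin N, Summable (Set.indicator {k | cl k = j}
      (fun k => (1 / 2 : ℝ) ^ (s k))) := by
    intro j
    rw [← summable_subtype_iff_indicator]
    obtain ⟨γ, hγ, hg⟩ := hgap j
    have hq0 : (0 : ℝ) ≤ (1 / 2 : ℝ) ^ γ := by positivity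
    have hq1 : (1 / 2 : ℝ) ^ γ < 1 := Real.rpow_lt_one (by norm_num) (by norm_num) hγ
    have hinj : Function.Injective (fun k : {k | cl k = j} => ⌊s k / γ⌋₊) := by
      have key : ∀ k l : ℕ, cl k = j → cl l = j → s k < s l → ⌊s k / γ⌋₊ < ⌊s l / γ⌋₊ := by
        intro k l hk hl h
        have h2 := hg k l hk hl h
        have h3 : s k / γ + 1 ≤ s l / γ := by
          rw [div_add_one hγ.ne']; gcongr
        have h4 : ⌊s k / γ + 1⌋₊ = ⌊s k / γ⌋₊ + 1 :=
          Nat.floor_add_one (div_nonneg (hspos k).le hγ.le)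
        have h5 := Nat.floor_le_floor h3
        omega
      rintro ⟨k, hk⟩ ⟨l, hl⟩ h
      simp only at h
      rcases lt_trichotomy (s k) (s l) with h' | h' | h'
      · have := key k l hk hl h'; omega
      · exact Subtype.ext (hsinj h')
      · have := key l k hl hk h'; omega
    refine Summable.of_nonneg_of_le (fun k => ?_) (fun k => ?_)
      ((summable_geometric_of_lt_one hq0 hq1).comp_injective hinj)
    · simp only [Function.comp]; positivity
    · simp only [Function.comp]
      rw [← Real.rpow_natCast, ← Real.rpow_mul (by norm_num)]
      apply Real.rpow_le_rpow_of_exponent_ge (by norm_num) (by norm_num)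
      have := Nat.floor_le (div_nonneg (hspos k).le hγ.le)
      rw [le_div_iff₀ hγ] at this
      linarith
  have h2 := summable_sum (s := Finset.univ) (fun j _ => h1 j)
  refine h2.congr (fun k => ?_)
  simp [Set.indicator_apply]

theorem real_exponent_series_unique
    (s : ℕ → ℝ) (hspos : ∀ k, 0 < s k) (hsinj : Function.Injective s)
    (N : ℕ) (cl : ℕ → Fin N)
    (hgap : ∀ j : Fin N, ∃ γ : ℝ, 0 < γ ∧
      ∀ k l : ℕ, cl k = j → cl l = j → s k < s l → s k + γ ≤ s l)
    (a : ℕ → ℝ)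
    (hL : ∃ L : ℝ, ∀ᶠ k in atTop, |a k| ^ (1 / s k) ≤ L)
    (ρ : ℝ) (hρ : 0 < ρ) (f : ℝ → ℝ)
    (hf : TendstoUniformlyOn (fun n x => ∑ k ∈ Finset.range n, a k * x ^ (s k)) f
      atTop (Set.Icc 0 ρ))
    (ρ₀ : ℝ) (hρ₀ : 0 < ρ₀) (hρ₀ρ : ρ₀ ≤ ρ)
    (hzero : ∀ x ∈ Set.Icc (0 : ℝ) ρ₀, f x = 0) :
    ∀ k, a k = 0 := by
  have hsum := aux_summable s hspos hsinj N cl hgap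
  obtain ⟨L, hL⟩ := hL
  obtain ⟨r, hr0, hrρ, hrs⟩ : ∃ r : ℝ, 0 < r ∧ r ≤ ρ₀ ∧
      Summable (fun k => |a k| * r ^ (s k)) := by
    have hM : 0 < max L 1 := lt_of_lt_of_le one_pos (le_max_right _ _)
    set M := max L 1 with hMdef
    refine ⟨min ρ₀ (1 / (2 * M)), by positivity, min_le_left _ _, ?_⟩
    set r := min ρ₀ (1 / (2 * M)) with hr
    have hr0 : 0 < r := by positivity
    have hMr : M * r ≤ 1 / 2 := by
      have : r ≤ 1 / (2 * M) := min_le_right _ _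
      calc M * r ≤ M * (1 / (2 * M)) := by gcongr
        _ = 1 / 2 := by field_simp
    refine summable_of_isBigO_nat hsum (Asymptotics.IsBigO.of_bound 1 ?_)
    filter_upwards [hL] with k hk
    rw [one_mul, Real.norm_of_nonneg (by positivity), Real.norm_of_nonneg (by positivity)]
    have h1 : |a k| ≤ M ^ s k := by
      have := Real.rpow_le_rpow (by positivity) (hk.trans (le_max_left L 1)) (hspos k).le
      rwa [← Real.rpow_mul (abs_nonneg _), one_div_mul_cancel (hspos k).ne',
        Real.rpow_one] at this
    calc |a k| * r ^ s k ≤ M ^ s k * r ^ s k := by gcongr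
      _ = (M * r) ^ s k := (Real.mul_rpow hM.le hr0.le).symm
      _ ≤ _ := Real.rpow_le_rpow (by positivity) hMr (hspos k).le
  by_contra! hne
  obtain ⟨k1, hk1⟩ := hne
  -- minimal exponent
  obtain ⟨k0, hk0, hmin⟩ : ∃ k0, a k0 ≠ 0 ∧ ∀ k, a k ≠ 0 → s k0 ≤ s k := by
    have hfin : {k | s k ≤ s k1}.Finite := by
      have h := hsum.tendsto_cofinite_zero.eventually
        (gt_mem_nhds (show (0 : ℝ) < (1 / 2 : ℝ) ^ s k1 by positivity))
      refine (Filter.eventually_cofinite.1 h).subset (fun k hk => ?_)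
      simp only [Set.mem_setOf_eq, not_lt] at hk ⊢
      exact Real.rpow_le_rpow_of_exponent_ge (by norm_num) (by norm_num) hk
    obtain ⟨k0, h0, hm⟩ := Set.exists_min_image ({k | s k ≤ s k1} ∩ {k | a k ≠ 0}) s
      (hfin.inter_of_left _) ⟨k1, le_refl (s k1), hk1⟩
    refine ⟨k0, h0.2, fun k hk => ?_⟩
    rcases le_total (s k) (s k1) with h | h
    · exact hm k ⟨h, hk⟩
    · exact le_trans h0.1 h
  have hb : Summable (fun k => |a k| * r ^ (s k - s k0)) := by
    refine (hrs.mul_right (r ^ (s k0))⁻¹).congr (fun k => ?_)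
    rw [Real.rpow_sub hr0]; ring
  have hev : ∀ᶠ x : ℝ in nhdsWithin 0 (Set.Ioi 0), 0 < x ∧ x ≤ r := by
    filter_upwards [Ioc_mem_nhdsGT hr0] with x hx using hx
  have hlim : Tendsto (fun x : ℝ => ∑' k, a k * x ^ (s k - s k0)) (nhdsWithin 0 (Set.Ioi 0))
      (nhds (∑' k, if k = k0 then a k0 else 0)) := by
    refine tendsto_tsum_of_dominated_convergence hb (fun k => ?_) ?_
    · by_cases hk : k = k0
      · subst hk; simp
      · simp only [hk, if_false]
        by_cases hak : a k = 0
        · simp [hak]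
        · have hlt : 0 < s k - s k0 := by
            have := lt_of_le_of_ne (hmin k hak) (fun h => hk (hsinj h).symm)
            linarith
          have h := (Real.continuousAt_rpow_const 0 (s k - s k0) (Or.inr hlt.le)).tendsto
          rw [Real.zero_rpow hlt.ne'] at h
          simpa using (h.mono_left nhdsWithin_le_nhds).const_mul (a k)
    · filter_upwards [hev] with x hx k
      have hx0 := hx.1
      rw [norm_mul, Real.norm_eq_abs, Real.norm_of_nonneg (by positivity)]
      by_cases hak : a k = 0
      · simp [hak]
      · have := hmin k hak
        gcongr
        · linarith
  rw [tsum_ite_eq] at hlim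
  have hz : Tendsto (fun x : ℝ => ∑' k, a k * x ^ (s k - s k0)) (nhdsWithin 0 (Set.Ioi 0))
      (nhds 0) := by
    refine tendsto_const_nhds.congr' ?_
    filter_upwards [hev] with x hx
    obtain ⟨hx0, hxr⟩ := hx
    have hs : Summable (fun k => a k * x ^ s k) := by
      refine Summable.of_norm_bounded hrs (fun k => ?_)
      rw [norm_mul, Real.norm_eq_abs, Real.norm_of_nonneg (by positivity)]
      gcongr
      exact (hspos k).le
    have h1 := hs.hasSum.tendsto_sum_nat
    have h2 := hf.tendsto_at (x := x) ⟨hx0.le, hxr.trans (hrρ.trans hρ₀ρ)⟩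
    rw [hzero x ⟨hx0.le, hxr.trans hrρ⟩] at h2
    have h3 := tendsto_nhds_unique h1 h2
    have h4 : (fun k => a k * x ^ (s k - s k0)) = fun k => a k * x ^ s k * (x ^ s k0)⁻¹ := by
      funext k
      rw [Real.rpow_sub hx0]; ring
    rw [h4, tsum_mul_right, h3, zero_mul]
  exact hk0 (tendsto_nhds_unique hlim hz)
end

section
/- Suppose Λ = (λ_k)_{k≥1} ⊂ ℝ⁺ is strictly increasing with ∑_k 1/λ_k < ∞ and satisfies the gap condition inf_k (λ_{k+1} − λ_k) > 0, and let 1 ≤ p < ∞. If φ(x) = α x^{ζ₁} + β x^{ζ₂} with α, β nonzero reals, 0 < ζ₁ < ζ₂, and φ([0,1]) ⊆ [0,1], then C_φ does not leave M^p_Λ invariant: there exists λ ∈ Λ such that the function x ↦ φ(x)^λ does not belong to M^p_Λ. -/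
open MeasureTheory

noncomputable def QF {ι : Type*} (S : Finset ι) (a c : ι → ℝ) : ℝ :=
  ∑ i ∈ S, ∑ j ∈ S, c i * c j / (a i + a j + 1)

lemma QF_step {ι : Type*} (S : Finset ι) (a c : ι → ℝ) (ha : ∀ i, 0 < a i) (l : ℝ) (hl : 0 < l) :
    QF S a (fun i => c i * ((a i - l) / (a i + l + 1))) ≤ QF S a c := by
  have h : QF S a (fun i => c i * ((a i - l) / (a i + l + 1)))
      = QF S a c - (2 * l + 1) * (∑ i ∈ S, c i / (a i + l + 1)) ^ 2 := by
    rw [sq, Finset.sum_mul_sum, Finset.mul_sum]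
    unfold QF
    rw [← Finset.sum_sub_distrib]
    refine Finset.sum_congr rfl fun i _ => ?_
    rw [Finset.mul_sum, ← Finset.sum_sub_distrib]
    refine Finset.sum_congr rfl fun j _ => ?_
    have h1 := ha i
    have h2 := ha j
    have e1 : a i + l + 1 ≠ 0 := by positivity
    have e2 : a j + l + 1 ≠ 0 := by positivity
    have e3 : a i + a j + 1 ≠ 0 := by positivity
    field_simp
    ring
  rw [h]
  have : 0 ≤ (2 * l + 1) * (∑ i ∈ S, c i / (a i + l + 1)) ^ 2 := by positivity
  linarith

lemma QF_prod {ι : Type*} (S L : Finset ι) (a c : ι → ℝ) (ha : ∀ i, 0 < a i) :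
    QF S a (fun i => c i * ∏ l ∈ L, ((a i - a l) / (a i + a l + 1))) ≤ QF S a c := by
  classical
  induction L using Finset.induction_on with
  | empty => simp
  | insert l L hl ih =>
    refine le_trans (le_of_eq ?_) ((QF_step S a _ ha (a l) (ha l)).trans ih)
    congr 1
    funext i
    rw [Finset.prod_insert hl]
    ring

lemma QF_lower {ι : Type*} [DecidableEq ι] (S : Finset ι) (a c : ι → ℝ) (ha : ∀ i, 0 < a i)
    (i₀ : ι) (h0 : i₀ ∈ S) :
    (c i₀ * ∏ l ∈ S.erase i₀, ((a i₀ - a l) / (a i₀ + a l + 1))) ^ 2 / (2 * a i₀ + 1)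
      ≤ QF S a c := by
  refine le_trans (le_of_eq ?_) (QF_prod S (S.erase i₀) a c ha)
  have hz : ∀ i ∈ S, i ≠ i₀ → ∏ l ∈ S.erase i₀, ((a i - a l) / (a i + a l + 1)) = 0 := by
    intro i hi hne
    exact Finset.prod_eq_zero (Finset.mem_erase.2 ⟨hne, hi⟩) (by simp)
  unfold QF
  rw [Finset.sum_eq_single_of_mem i₀ h0, Finset.sum_eq_single_of_mem i₀ h0]
  · rw [sq]; ring_nf
  · intro j hj hne; simp only [hz j hj hne]; simp
  · intro j hj hne; simp only [hz j hj hne]; simp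

lemma prod_lower_s6 (Λ : ℕ → ℝ) (hpos : ∀ k, 0 < Λ k)
    (hsum : Summable fun k => 1 / Λ k) (ν : ℝ) (hν : 0 < ν) (hn : ∀ k, Λ k ≠ ν) :
    ∃ D : ℝ, 0 < D ∧ ∀ F : Finset ℕ, D ≤ ∏ k ∈ F, (|ν - Λ k| / (ν + Λ k + 3)) := by
  set b : ℕ → ℝ := fun k => |ν - Λ k| / (ν + Λ k + 3) with hb
  have hbpos : ∀ k, 0 < b k := fun k => by
    have := hpos k
    have h2 : 0 < |ν - Λ k| := abs_pos.2 (sub_ne_zero.2 (hn k).symm)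
    simp only [hb]; positivity
  have hb1 : ∀ k, b k ≤ 1 := fun k => by
    have := hpos k
    simp only [hb]
    rw [div_le_one (by positivity), abs_le]; constructor <;> linarith
  have hs : Summable fun k => b k - 1 := by
    refine Summable.of_norm_bounded (hsum.mul_left (2 * ν + 3)) fun k => ?_
    have := hpos k
    rw [Real.norm_eq_abs, abs_of_nonpos (by linarith [hb1 k])]
    have h3 : -(b k - 1) = (ν + Λ k + 3 - |ν - Λ k|) / (ν + Λ k + 3) := by
      simp only [hb]; field_simp; ring
    rw [h3, mul_one_div]
    have h4 : Λ k - ν ≤ |ν - Λ k| := by rw [abs_sub_comm]; exact le_abs_self _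
    exact div_le_div₀ (by linarith) (by linarith) this (by linarith)
  have hl : Summable fun k => Real.log (b k) := by
    have := Real.summable_log_one_add_of_summable hs
    simpa using this
  refine ⟨Real.exp (∑' k, Real.log (b k)), Real.exp_pos _, fun F => ?_⟩
  have : ∏ k ∈ F, b k = Real.exp (∑ k ∈ F, Real.log (b k)) := by
    rw [Real.exp_sum]
    exact Finset.prod_congr rfl fun k _ => (Real.exp_log (hbpos k)).symm
  rw [this, Real.exp_le_exp]
  have := hl.neg.sum_le_tsum F (fun k _ => neg_nonneg.2 (Real.log_nonpos (hbpos k).le (hb1 k)))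
  rw [tsum_neg, Finset.sum_neg_distrib] at this
  linarith

/-- lower bound for combos. -/
lemma L1_lower {ι : Type*} [DecidableEq ι] (S : Finset ι) (a c : ι → ℝ) (ha : ∀ i, 0 < a i)
    (ε : ℝ) (hε : ∫ x in (0:ℝ)..1, |∑ i ∈ S, c i * x ^ (a i)| ≤ ε) :
    QF S (fun i => a i + 1) (fun i => c i / (a i + 1)) ≤ ε ^ 2 := by
  have hcont : Continuous fun x : ℝ => ∑ i ∈ S, c i * x ^ (a i) :=
    continuous_finsetSum _ fun i _ => continuous_const.mul
      (Real.continuous_rpow_const (ha i).le)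
  have hcont2 : Continuous fun x : ℝ => ∑ i ∈ S, c i / (a i + 1) * x ^ (a i + 1) :=
    continuous_finsetSum _ fun i _ => continuous_const.mul
      (Real.continuous_rpow_const (by linarith [ha i]))
  have hε0 : 0 ≤ ε := le_trans
    (intervalIntegral.integral_nonneg zero_le_one fun x _ => abs_nonneg _) hε
  have hG : ∀ x ∈ Set.Icc (0:ℝ) 1, |∑ i ∈ S, c i / (a i + 1) * x ^ (a i + 1)| ≤ ε := by
    intro x hx
    have : ∑ i ∈ S, c i / (a i + 1) * x ^ (a i + 1)
        = ∫ t in (0:ℝ)..x, ∑ i ∈ S, c i * t ^ (a i) := by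
      rw [intervalIntegral.integral_finsetSum]
      · refine Finset.sum_congr rfl fun i _ => ?_
        have := ha i
        rw [intervalIntegral.integral_const_mul, integral_rpow (Or.inl (by linarith)),
          Real.zero_rpow (by positivity)]
        ring
      · intro i _
        exact (continuous_const.mul
          (Real.continuous_rpow_const (ha i).le)).intervalIntegrable _ _
    rw [this]
    refine (intervalIntegral.abs_integral_le_integral_abs hx.1).trans (le_trans ?_ hε)
    exact intervalIntegral.integral_mono_interval le_rfl hx.1 hx.2
      (Filter.Eventually.of_forall fun _ => abs_nonneg _) (hcont.abs.intervalIntegrable _ _)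
  have hQ : QF S (fun i => a i + 1) (fun i => c i / (a i + 1))
      = ∫ x in (0:ℝ)..1, (∑ i ∈ S, c i / (a i + 1) * x ^ (a i + 1)) ^ 2 := by
    have e : ∀ x ∈ Set.uIcc (0:ℝ) 1, (∑ i ∈ S, c i / (a i + 1) * x ^ (a i + 1)) ^ 2
        = ∑ i ∈ S, ∑ j ∈ S, c i / (a i + 1) * (c j / (a j + 1))
          * x ^ ((a i + 1) + (a j + 1)) := by
      intro x hx
      rw [Set.uIcc_of_le zero_le_one] at hx
      rw [sq, Finset.sum_mul_sum]
      refine Finset.sum_congr rfl fun i _ => Finset.sum_congr rfl fun j _ => ?_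
      have := ha i
      have := ha j
      rw [Real.rpow_add_of_nonneg (y := a i + 1) (z := a j + 1) hx.1 (by positivity) (by positivity)]
      ring
    rw [intervalIntegral.integral_congr e]
    have hc : ∀ i j, Continuous fun x : ℝ => c i / (a i + 1) * (c j / (a j + 1))
          * x ^ ((a i + 1) + (a j + 1)) := fun i j =>
      continuous_const.mul (Real.continuous_rpow_const (by linarith [ha i, ha j]))
    rw [intervalIntegral.integral_finsetSum
      (fun i _ => (continuous_finsetSum _ fun j _ => hc i j).intervalIntegrable _ _)]
    refine Finset.sum_congr rfl fun i _ => ?_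
    rw [intervalIntegral.integral_finsetSum (fun j _ => (hc i j).intervalIntegrable _ _)]
    refine Finset.sum_congr rfl fun j _ => ?_
    have := ha i
    have := ha j
    rw [intervalIntegral.integral_const_mul, integral_rpow (Or.inl (by linarith)),
          Real.zero_rpow (by positivity)]
    simp
    ring
  rw [hQ]
  have : ∫ x in (0:ℝ)..1, (∑ i ∈ S, c i / (a i + 1) * x ^ (a i + 1)) ^ 2
      ≤ ∫ x in (0:ℝ)..1, ε ^ 2 := by
    refine intervalIntegral.integral_mono_on zero_le_one ((hcont2.pow 2).intervalIntegrable _ _)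
      (by simp) fun x hx => ?_
    rw [← sq_abs]
    exact pow_le_pow_left₀ (abs_nonneg _) (hG x hx) 2
  simpa using this

noncomputable def MS (Λ : ℕ → ℝ) : Submodule ℝ (ℝ → ℝ) :=
  Submodule.span ℝ (Set.range fun k : ℕ => fun x : ℝ => x ^ (Λ k))

lemma dist_lower (Λ : ℕ → ℝ) (hpos : ∀ k, 0 < Λ k)
    (hsum : Summable fun k => 1 / Λ k) (ν : ℝ) (hν : 0 < ν) (hn : ∀ k, Λ k ≠ ν) :
    ∃ D : ℝ, 0 < D ∧ ∀ g ∈ MS Λ, D ≤ ∫ x in (0:ℝ)..1, |x ^ ν - g x| := by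
  obtain ⟨D, hD, hF⟩ := prod_lower_s6 Λ hpos hsum ν hν hn
  refine ⟨Real.sqrt ((1 / (ν + 1) * D) ^ 2 / (2 * (ν + 1) + 1)), by positivity, fun g hg => ?_⟩
  obtain ⟨c, rfl⟩ := (Finsupp.mem_span_range_iff_exists_finsupp).1 hg
  refine Real.sqrt_le_iff.2 ⟨intervalIntegral.integral_nonneg zero_le_one fun x _ => abs_nonneg _, ?_⟩
  let a : Option ℕ → ℝ := fun o => o.elim ν Λ
  let c' : Option ℕ → ℝ := fun o => o.elim 1 (fun k => - c k)
  have ha : ∀ i, 0 < a i := by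
    intro i; cases i with
    | none => exact hν
    | some k => exact hpos k
  have key := L1_lower (Finset.insertNone c.support) a c' ha
    (∫ x in (0:ℝ)..1, |x ^ ν - (c.sum fun i a => a • fun x : ℝ => x ^ Λ i) x|) (le_of_eq (by
      congr 1
      funext x
      congr 1
      rw [Finset.sum_insertNone]
      simp [a, c', Finsupp.sum, Finset.sum_apply, sub_eq_add_neg]))
  refine le_trans ?_ key
  refine le_trans ?_ (QF_lower _ _ _ (fun i => by linarith [ha i]) none (by simp))
  have he : (Finset.insertNone c.support).erase none = c.support.map Function.Embedding.some := by
    ext o; cases o <;> simp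
  rw [he, Finset.prod_map]
  have : |∏ k ∈ c.support, ((a none + 1 - (a (some k) + 1)) / (a none + 1 + (a (some k) + 1) + 1))|
      = ∏ k ∈ c.support, (|ν - Λ k| / (ν + Λ k + 3)) := by
    rw [Finset.abs_prod]
    refine Finset.prod_congr rfl fun k _ => ?_
    have := hpos k
    rw [abs_div]
    simp only [a, Option.elim]
    rw [abs_of_pos (a := ν + 1 + (Λ k + 1) + 1) (by positivity)]
    congr 1
    · congr 1; ring
    · ring
  simp only [Function.Embedding.some_apply]
  rw [mul_pow, mul_pow, ← sq_abs (∏ k ∈ c.support, _), this]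
  simp only [a, c', Option.elim]
  gcongr
  exact hF _

lemma MS_cont (Λ : ℕ → ℝ) (hpos : ∀ k, 0 < Λ k) (g : ℝ → ℝ) (hg : g ∈ MS Λ) : Continuous g := by
  unfold MS at hg
  induction hg using Submodule.span_induction with
  | mem x h => obtain ⟨k, rfl⟩ := h; exact Real.continuous_rpow_const (hpos k).le
  | zero => exact continuous_const
  | add x y _ _ hx hy => exact hx.add hy
  | smul a x _ hx => exact hx.const_smul a

lemma MS_scale (Λ : ℕ → ℝ) (s : ℝ) (hs : 0 < s) (g : ℝ → ℝ) (hg : g ∈ MS Λ) :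
    ∃ g' ∈ MS Λ, ∀ x, 0 ≤ x → g' x = g (s * x) := by
  unfold MS at hg
  induction hg using Submodule.span_induction with
  | mem x h =>
    obtain ⟨k, rfl⟩ := h
    refine ⟨(s ^ Λ k) • fun x : ℝ => x ^ Λ k,
      Submodule.smul_mem _ _ (Submodule.subset_span ⟨k, rfl⟩), fun x hx => ?_⟩
    simp [Real.mul_rpow hs.le hx]
  | zero => exact ⟨0, Submodule.zero_mem _, fun _ _ => rfl⟩
  | add x y _ _ hx hy =>
    obtain ⟨g1, h1, e1⟩ := hx
    obtain ⟨g2, h2, e2⟩ := hy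
    exact ⟨g1 + g2, Submodule.add_mem _ h1 h2, fun z hz => by simp [e1 z hz, e2 z hz]⟩
  | smul a x _ hx =>
    obtain ⟨g1, h1, e1⟩ := hx
    exact ⟨a • g1, Submodule.smul_mem _ _ h1, fun z hz => by simp [e1 z hz]⟩

/-- `L¹` closure membership. -/
def M1 (Λ : ℕ → ℝ) (f : ℝ → ℝ) : Prop :=
  ∀ ε : ℝ, 0 < ε → ∃ g ∈ MS Λ, ∫ x in (0:ℝ)..1, |f x - g x| ≤ ε

lemma M1_of_mem (p : ℝ) (hp : 1 ≤ p) (Λ : ℕ → ℝ) (hpos : ∀ k, 0 < Λ k) (f : ℝ → ℝ)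
    (hf : Continuous f) (h : memMuntz p Λ f) : M1 Λ f := by
  intro ε hε
  obtain ⟨g, ⟨n, c, k, hg⟩, hle⟩ := h ε hε
  have hgM : g ∈ MS Λ := by
    have : g = ∑ i, c i • fun x : ℝ => x ^ Λ (k i) := by
      funext x; rw [hg x]; simp
    rw [this]
    exact Submodule.sum_mem _ fun i _ => Submodule.smul_mem _ _ (Submodule.subset_span ⟨k i, rfl⟩)
  refine ⟨g, hgM, ?_⟩
  have hgc := MS_cont Λ hpos g hgM
  have hprob : IsProbabilityMeasure m01 := ⟨by simp [m01]⟩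
  have hm : AEStronglyMeasurable (fun x => f x - g x) m01 := (hf.sub hgc).aestronglyMeasurable
  have h1 : eLpNorm (fun x => f x - g x) 1 m01 ≤ ENNReal.ofReal ε :=
    (eLpNorm_le_eLpNorm_of_exponent_le (by simpa using hp) hm).trans hle
  rw [eLpNorm_one_eq_lintegral_enorm] at h1
  rw [intervalIntegral.integral_of_le zero_le_one, ← integral_Icc_eq_integral_Ioc]
  change ∫ x, ‖f x - g x‖ ∂m01 ≤ ε
  rw [integral_norm_eq_lintegral_enorm hm]
  exact ENNReal.toReal_le_of_le_ofReal hε.le h1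

lemma expand (Λ : ℕ → ℝ) (hpos : ∀ k, 0 < Λ k) (hsum : Summable fun k => 1 / Λ k)
    (f : ℝ → ℝ) (hf : Continuous f) (hM : M1 Λ f) (μ δ c K s₀ : ℝ) (hμ : 0 < μ) (hδ : 0 < δ)
    (hc : c ≠ 0) (hs₀ : 0 < s₀)
    (hK : ∀ x, 0 ≤ x → x ≤ s₀ → |f x - c * x ^ μ| ≤ K * x ^ (μ + δ)) : ∃ k, Λ k = μ := by
  by_contra! hn
  obtain ⟨D, hD, hlow⟩ := dist_lower Λ hpos hsum μ hμ hn
  have hK0 : 0 ≤ K := by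
    have := (abs_nonneg _).trans (hK s₀ hs₀.le le_rfl)
    exact nonneg_of_mul_nonneg_left this (by positivity)
  have hcp : 0 < |c| := abs_pos.2 hc
  -- choose s
  obtain ⟨s, hs, hss, hs1, hsK⟩ : ∃ s : ℝ, 0 < s ∧ s ≤ s₀ ∧ s ≤ 1 ∧ K * s ^ δ < |c| * D / 2 := by
    have ht : Filter.Tendsto (fun s : ℝ => K * s ^ δ) (nhds 0) (nhds (K * 0 ^ δ)) :=
      (continuous_const.mul (Real.continuous_rpow_const hδ.le)).tendsto 0
    rw [Real.zero_rpow hδ.ne', mul_zero] at ht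
    have h1 := (ht.eventually_lt_const (show (0:ℝ) < |c| * D / 2 by positivity)).filter_mono
      (nhdsWithin_le_nhds (s := Set.Ioi 0))
    have h2 := Ioc_mem_nhdsGT (show (0:ℝ) < min s₀ 1 by positivity)
    obtain ⟨s, hs1, hs2⟩ := (h1.and h2).exists
    exact ⟨s, hs2.1, hs2.2.trans (min_le_left _ _), hs2.2.trans (min_le_right _ _), hs1⟩
  have hsμ : 0 < s ^ μ := Real.rpow_pos_of_pos hs μ
  obtain ⟨g, hg, hge⟩ := hM (s * s ^ μ * (|c| * D / 4)) (by positivity)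
  have hgc := MS_cont Λ hpos g hg
  obtain ⟨g', hg', he⟩ := MS_scale Λ s hs g hg
  have hg'c := MS_cont Λ hpos g' hg'
  have hL := hlow (((s ^ μ)⁻¹ * c⁻¹) • g') (Submodule.smul_mem _ _ hg')
  have hb : ∫ x in (0:ℝ)..1, |f (s * x) - g (s * x)| ≤ s ^ μ * (|c| * D / 4) := by
    rw [intervalIntegral.integral_comp_mul_left (fun x => |f x - g x|) hs.ne', smul_eq_mul,
      mul_zero, mul_one, inv_mul_le_iff₀ hs, ← mul_assoc]
    refine le_trans ?_ hge
    exact intervalIntegral.integral_mono_interval le_rfl hs.le hs1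
      (Filter.Eventually.of_forall fun _ => abs_nonneg _)
      ((hf.sub hgc).abs.intervalIntegrable _ _)
  have hpt : ∀ x ∈ Set.Icc (0:ℝ) 1, |x ^ μ - (((s ^ μ)⁻¹ * c⁻¹) • g') x|
      ≤ |c|⁻¹ * (K * s ^ δ) + |c|⁻¹ * (s ^ μ)⁻¹ * |f (s * x) - g (s * x)| := by
    intro x hx
    have h1 := hK (s * x) (mul_nonneg hs.le hx.1)
      ((mul_le_of_le_one_right hs.le hx.2).trans hss)
    have h2 : K * (s * x) ^ (μ + δ) ≤ K * (s ^ μ * s ^ δ) := by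
      rw [← Real.rpow_add hs]
      have := mul_nonneg hs.le hx.1
      have := mul_le_of_le_one_right hs.le hx.2
      gcongr
    rw [Real.mul_rpow hs.le hx.1] at h1
    have e : x ^ μ - (((s ^ μ)⁻¹ * c⁻¹) • g') x = (s ^ μ)⁻¹ * c⁻¹ *
        (-(f (s * x) - c * (s ^ μ * x ^ μ)) + (f (s * x) - g (s * x))) := by
      simp only [Pi.smul_apply, smul_eq_mul, he x hx.1]
      field_simp
      ring
    rw [e, abs_mul, abs_mul, abs_inv, abs_inv, abs_of_pos hsμ]
    have h3 := (abs_add_le (-(f (s * x) - c * (s ^ μ * x ^ μ))) (f (s * x) - g (s * x)))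
    rw [abs_neg] at h3
    have h4 := h3.trans (add_le_add_left (h1.trans h2) _)
    calc _ ≤ (s ^ μ)⁻¹ * |c|⁻¹ * (K * (s ^ μ * s ^ δ) + |f (s * x) - g (s * x)|) := by
          gcongr
      _ = _ := by field_simp
  have hcs : Continuous fun x : ℝ => |f (s * x) - g (s * x)| :=
    ((hf.comp (continuous_const.mul continuous_id)).sub
      (hgc.comp (continuous_const.mul continuous_id))).abs
  have hcl : Continuous fun x : ℝ => |x ^ μ - (((s ^ μ)⁻¹ * c⁻¹) • g') x| :=
    ((Real.continuous_rpow_const hμ.le).sub (hg'c.const_smul ((s ^ μ)⁻¹ * c⁻¹))).abs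
  have hcm : Continuous fun x : ℝ => |c|⁻¹ * (s ^ μ)⁻¹ * |f (s * x) - g (s * x)| :=
    continuous_const.mul hcs
  have hcr : Continuous fun x : ℝ =>
      |c|⁻¹ * (K * s ^ δ) + |c|⁻¹ * (s ^ μ)⁻¹ * |f (s * x) - g (s * x)| :=
    continuous_const.add hcm
  have hI := intervalIntegral.integral_mono_on zero_le_one
    (hcl.intervalIntegrable (μ := volume) _ _) (hcr.intervalIntegrable (μ := volume) _ _) hpt
  rw [intervalIntegral.integral_add (by simp) (hcm.intervalIntegrable _ _)] at hI
  simp only [intervalIntegral.integral_const, sub_zero, one_smul] at hI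
  have h5 : |c|⁻¹ * (K * s ^ δ) < D / 2 := by
    rw [inv_mul_lt_iff₀ hcp]; linarith
  have h6 : |c|⁻¹ * (s ^ μ)⁻¹ * ∫ x in (0:ℝ)..1, |f (s * x) - g (s * x)| ≤ D / 4 := by
    calc _ ≤ |c|⁻¹ * (s ^ μ)⁻¹ * (s ^ μ * (|c| * D / 4)) := by gcongr
      _ = D / 4 := by field_simp
  have h7 := hL.trans hI
  rw [intervalIntegral.integral_const_mul] at h7
  linarith

lemma series (Λ : ℕ → ℝ) (hpos : ∀ k, 0 < Λ k) (hsum : Summable fun k => 1 / Λ k)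
    (f : ℝ → ℝ) (hf : Continuous f) (hM : M1 Λ f) (μ δ : ℝ) (hμ : 0 < μ) (hδ : 0 < δ) (b : ℕ → ℝ)
    (hb : ∀ n : ℕ, ∃ K s₀ : ℝ, 0 < s₀ ∧ ∀ x, 0 ≤ x → x ≤ s₀ →
      |f x - ∑ i ∈ Finset.range n, b i * x ^ (μ + i * δ)| ≤ K * x ^ (μ + n * δ)) (j : ℕ)
    (hj : ∀ i ≤ j, b i ≠ 0) : ∃ k, Λ k = μ + j * δ := by
  induction j using Nat.strong_induction_on with
  | _ j ih =>
    obtain ⟨K, s₀, hs₀, hK⟩ := hb (j + 1)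
    let h : ℝ → ℝ := ∑ i ∈ Finset.range j, b i • fun x : ℝ => x ^ (μ + i * δ)
    have hh : h ∈ MS Λ := by
      refine Submodule.sum_mem _ fun i hi => Submodule.smul_mem _ _ ?_
      have hi' := Finset.mem_range.1 hi
      obtain ⟨k, hk⟩ := ih i hi' (fun l hl => hj l (hl.trans hi'.le))
      rw [← hk]
      exact Submodule.subset_span ⟨k, rfl⟩
    have hhx : ∀ x, h x = ∑ i ∈ Finset.range j, b i * x ^ (μ + i * δ) := by
      intro x; simp [h]
    refine expand Λ hpos hsum (fun x => f x - h x) (hf.sub (MS_cont Λ hpos h hh)) ?_ (μ + j * δ) δ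
      (b j) K s₀ (by positivity) hδ (hj j le_rfl) hs₀ ?_
    · intro ε hε
      obtain ⟨g, hg, hge⟩ := hM ε hε
      refine ⟨g - h, Submodule.sub_mem _ hg hh, ?_⟩
      simpa using hge
    · intro x hx hxs
      have := hK x hx hxs
      rw [Finset.sum_range_succ] at this
      rw [hhx, sub_sub]
      convert this using 3
      push_cast; ring

lemma choose_ne (r : ℝ) (j : ℕ) (hj : (j : ℝ) ≤ r) : Ring.choose r j ≠ 0 := by
  have h := Ring.descPochhammer_eq_factorial_smul_choose r j
  rw [Polynomial.descPochhammer_smeval_eq_ascPochhammer,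
    Polynomial.ascPochhammer_smeval_eq_eval] at h
  have hp := ascPochhammer_pos j (r - j + 1) (by linarith)
  intro h0
  rw [h, h0, smul_zero] at hp
  exact lt_irrefl _ hp

lemma binom (r : ℝ) (n : ℕ) : ∃ C ρ : ℝ, 0 < ρ ∧ ∀ t : ℝ, |t| ≤ ρ →
    |(1 + t) ^ r - ∑ i ∈ Finset.range n, Ring.choose r i * t ^ i| ≤ C * |t| ^ n := by
  have h := (Real.one_add_rpow_hasFPowerSeriesAt_zero (a := r)).isBigO_sub_partialSum_pow n
  obtain ⟨C, hC⟩ := h.bound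
  obtain ⟨ρ, hρ, hball⟩ := Metric.eventually_nhds_iff.1 hC
  refine ⟨C, ρ / 2, by positivity, fun t ht => ?_⟩
  have := hball (y := t) (by rw [Real.dist_eq, sub_zero]; linarith)
  simpa only [zero_add, FormalMultilinearSeries.partialSum, binomialSeries_apply, List.ofFn_const,
    List.prod_replicate, smul_eq_mul, Real.norm_eq_abs, abs_pow, abs_abs] using this

lemma alpha_pos (α β ζ₁ ζ₂ : ℝ) (hα : α ≠ 0) (hζ : ζ₁ < ζ₂)
    (h : ∀ x ∈ Set.Icc (0:ℝ) 1, 0 ≤ α * x ^ ζ₁ + β * x ^ ζ₂) : 0 < α := by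
  have ht : Filter.Tendsto (fun x : ℝ => α + β * x ^ (ζ₂ - ζ₁)) (nhdsWithin 0 (Set.Ioi 0))
      (nhds (α + β * 0 ^ (ζ₂ - ζ₁))) :=
    ((continuous_const.add (continuous_const.mul
      (Real.continuous_rpow_const (by linarith)))).tendsto 0).mono_left nhdsWithin_le_nhds
  rw [Real.zero_rpow (by linarith), mul_zero, add_zero] at ht
  refine lt_of_le_of_ne (ge_of_tendsto ht ?_) hα.symm
  filter_upwards [Ioc_mem_nhdsGT (zero_lt_one' ℝ)] with x hx
  have h1 := h x ⟨hx.1.le, hx.2⟩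
  have e : α * x ^ ζ₁ + β * x ^ ζ₂ = x ^ ζ₁ * (α + β * x ^ (ζ₂ - ζ₁)) := by
    have : x ^ ζ₂ = x ^ ζ₁ * x ^ (ζ₂ - ζ₁) := by
      rw [← Real.rpow_add hx.1]; congr 1; ring
    rw [this]; ring
  rw [e] at h1
  exact nonneg_of_mul_nonneg_right h1 (Real.rpow_pos_of_pos hx.1 _)

lemma phi_series (α β ζ₁ ζ₂ r : ℝ) (hα : 0 < α) (hζ₁ : 0 < ζ₁) (hζ : ζ₁ < ζ₂) (hr : 0 < r)
    (n : ℕ) : ∃ K s₀ : ℝ, 0 < s₀ ∧ ∀ x, 0 ≤ x → x ≤ s₀ →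
      |(α * x ^ ζ₁ + β * x ^ ζ₂) ^ r - ∑ i ∈ Finset.range n,
        (α ^ r * Ring.choose r i * (β / α) ^ i) * x ^ (r * ζ₁ + i * (ζ₂ - ζ₁))|
        ≤ K * x ^ (r * ζ₁ + n * (ζ₂ - ζ₁)) := by
  obtain ⟨C, ρ, hρ, hC⟩ := binom r n
  have hδ : 0 < ζ₂ - ζ₁ := by linarith
  obtain ⟨s₀, hs₀, hs⟩ : ∃ s₀ : ℝ, 0 < s₀ ∧ ∀ x, 0 ≤ x → x ≤ s₀ →
      |β / α * x ^ (ζ₂ - ζ₁)| < min ρ 1 := by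
    have ht : Filter.Tendsto (fun x : ℝ => |β / α * x ^ (ζ₂ - ζ₁)|) (nhds 0)
        (nhds (|β / α * 0 ^ (ζ₂ - ζ₁)|)) :=
      (continuous_const.mul (Real.continuous_rpow_const hδ.le)).abs.tendsto 0
    rw [Real.zero_rpow hδ.ne', mul_zero, abs_zero] at ht
    obtain ⟨e, he, h⟩ := Metric.eventually_nhds_iff.1
      (ht.eventually_lt_const (show (0:ℝ) < min ρ 1 by positivity))
    refine ⟨e / 2, by positivity, fun x hx hxe => h ?_⟩
    rw [Real.dist_eq, sub_zero, abs_of_nonneg hx]; linarith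
  refine ⟨α ^ r * C * |β / α| ^ n, s₀, hs₀, fun x hx hxs => ?_⟩
  have hts := hs x hx hxs
  set t := β / α * x ^ (ζ₂ - ζ₁) with ht
  have h1 := hC t (hts.le.trans (min_le_left _ _))
  have h2 : 0 ≤ 1 + t := by
    have := (abs_lt.1 (hts.trans_le (min_le_right _ _))).1; linarith
  have hpw : ∀ i : ℕ, x ^ (r * ζ₁ + i * (ζ₂ - ζ₁)) = (x ^ ζ₁) ^ r * (x ^ (ζ₂ - ζ₁)) ^ i := by
    intro i
    rw [Real.rpow_add_of_nonneg hx (by positivity) (by positivity), mul_comm r, Real.rpow_mul hx,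
      mul_comm (i : ℝ), Real.rpow_mul hx, Real.rpow_natCast]
  have e1 : α * x ^ ζ₁ + β * x ^ ζ₂ = (α * x ^ ζ₁) * (1 + t) := by
    have : x ^ ζ₂ = x ^ ζ₁ * x ^ (ζ₂ - ζ₁) := by
      rw [← Real.rpow_add_of_nonneg hx hζ₁.le hδ.le]; congr 1; ring
    rw [this, ht]; field_simp
  have hx1 : 0 ≤ x ^ ζ₁ := Real.rpow_nonneg hx _
  rw [e1, Real.mul_rpow (by positivity) h2, Real.mul_rpow hα.le hx1, hpw]
  have e2 : ∑ i ∈ Finset.range n,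
        (α ^ r * Ring.choose r i * (β / α) ^ i) * x ^ (r * ζ₁ + i * (ζ₂ - ζ₁))
      = α ^ r * (x ^ ζ₁) ^ r * ∑ i ∈ Finset.range n, Ring.choose r i * t ^ i := by
    rw [Finset.mul_sum]
    refine Finset.sum_congr rfl fun i _ => ?_
    rw [hpw, ht, mul_pow]; ring
  have hA : 0 ≤ α ^ r * (x ^ ζ₁) ^ r :=
    mul_nonneg (Real.rpow_nonneg hα.le _) (Real.rpow_nonneg hx1 _)
  rw [e2, ← mul_sub, abs_mul, abs_of_nonneg hA]
  refine (mul_le_mul_of_nonneg_left h1 hA).trans (le_of_eq ?_)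
  rw [ht, abs_mul, abs_of_nonneg (Real.rpow_nonneg hx (ζ₂ - ζ₁)), mul_pow]
  ring

/-- Suppose `Λ ⊂ ℝ⁺` is strictly increasing with `∑ 1/λ_k < ∞` and
satisfies the gap condition `inf_k (λ_{k+1} − λ_k) > 0`. If `φ(x) = α x^{ζ₁} + β x^{ζ₂}`
with `α, β ≠ 0`, `0 < ζ₁ < ζ₂` and `φ([0,1]) ⊆ [0,1]`, then `C_φ` does not leave
`M^p_Λ` invariant: some `φ^λ` with `λ ∈ Λ` is not in `M^p_Λ`. -/
theorem muntz_not_invariant_two_term_gap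
    (p : ℝ) (hp : 1 ≤ p)
    (Λ : ℕ → ℝ) (hmono : StrictMono Λ) (hpos : ∀ k, 0 < Λ k)
    (hsum : Summable fun k => 1 / Λ k)
    (hgap : ∃ γ : ℝ, 0 < γ ∧ ∀ k, Λ k + γ ≤ Λ (k + 1))
    (α β ζ₁ ζ₂ : ℝ) (hα : α ≠ 0) (hβ : β ≠ 0) (hζ₁ : 0 < ζ₁) (hζ : ζ₁ < ζ₂)
    (φ : ℝ → ℝ) (hφ : ∀ x, φ x = α * x ^ ζ₁ + β * x ^ ζ₂)
    (hmaps : Set.MapsTo φ (Set.Icc (0 : ℝ) 1) (Set.Icc (0 : ℝ) 1)) :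
    ∃ k : ℕ, ¬ memMuntz p Λ (fun x => φ x ^ (Λ k)) := by
  by_contra! hcon
  have hφ0 : ∀ x ∈ Set.Icc (0:ℝ) 1, 0 ≤ α * x ^ ζ₁ + β * x ^ ζ₂ := fun x hx => by
    rw [← hφ]; exact (hmaps hx).1
  have hαp := alpha_pos α β ζ₁ ζ₂ hα hζ hφ0
  have hδ : 0 < ζ₂ - ζ₁ := by linarith
  have hζ₂ : 0 < ζ₂ := by linarith
  have hφc : Continuous φ := by
    rw [funext hφ]
    exact (continuous_const.mul (Real.continuous_rpow_const hζ₁.le)).add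
      (continuous_const.mul (Real.continuous_rpow_const hζ₂.le))
  have hmem : ∀ k j : ℕ, (j : ℝ) ≤ Λ k → ∃ m, Λ m = Λ k * ζ₁ + j * (ζ₂ - ζ₁) := by
    intro k j hj
    have hc : Continuous fun x => φ x ^ Λ k :=
      hφc.rpow_const fun _ => Or.inr (hpos k).le
    refine series Λ hpos hsum _ hc (M1_of_mem p hp Λ hpos _ hc (hcon k)) (Λ k * ζ₁) (ζ₂ - ζ₁)
      (mul_pos (hpos k) hζ₁) hδ (fun i => α ^ Λ k * Ring.choose (Λ k) i * (β / α) ^ i) ?_ j ?_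
    · intro n
      simp only [hφ]
      exact phi_series α β ζ₁ ζ₂ (Λ k) hαp hζ₁ hζ (hpos k) n
    · intro i hi
      have : Ring.choose (Λ k) i ≠ 0 := choose_ne _ _ (le_trans (by exact_mod_cast hi) hj)
      have h2 : α ^ Λ k ≠ 0 := (Real.rpow_pos_of_pos hαp _).ne'
      exact mul_ne_zero (mul_ne_zero h2 this) (pow_ne_zero _ (div_ne_zero hβ hα))
  obtain ⟨S, hS⟩ := summable_iff_vanishing_norm.1 hsum (1 / ζ₂) (by positivity)
  obtain ⟨k, hk⟩ : ∃ k, ∀ m ∈ S, Λ m < Λ k * ζ₁ := by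
    have h0 := hsum.tendsto_atTop_zero
    have hB : 0 < ∑ m ∈ S, Λ m + 1 := by
      have := Finset.sum_nonneg (fun m (_ : m ∈ S) => (hpos m).le)
      linarith
    obtain ⟨k, hk⟩ := (h0.eventually_lt_const
      (show 0 < ζ₁ / (∑ m ∈ S, Λ m + 1) by positivity)).exists
    refine ⟨k, fun m hm => ?_⟩
    rw [div_lt_div_iff₀ (hpos k) hB] at hk
    have := Finset.single_le_sum (fun m (_ : m ∈ S) => (hpos m).le) hm
    linarith
  have hfl : ∀ j ∈ Finset.range (⌊Λ k⌋₊ + 1), (j : ℝ) ≤ Λ k := by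
    intro j hj
    have : j ≤ ⌊Λ k⌋₊ := by have := Finset.mem_range.1 hj; omega
    exact (Nat.le_floor_iff (hpos k).le).1 this
  choose! m hm using hmem k
  have hinj : Set.InjOn m (Finset.range (⌊Λ k⌋₊ + 1)) := by
    intro i hi j hj hij
    have h1 := hm i (hfl i hi)
    have h2 := hm j (hfl j hj)
    rw [hij, h2] at h1
    have h3 : (j : ℝ) * (ζ₂ - ζ₁) = i * (ζ₂ - ζ₁) := by linarith
    exact_mod_cast (mul_right_cancel₀ hδ.ne' h3).symm
  have hdis : Disjoint ((Finset.range (⌊Λ k⌋₊ + 1)).image m) S := by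
    rw [Finset.disjoint_left]
    intro a ha haS
    obtain ⟨j, hj, rfl⟩ := Finset.mem_image.1 ha
    have h1 := hk _ haS
    rw [hm j (hfl j hj)] at h1
    have : 0 ≤ (j : ℝ) * (ζ₂ - ζ₁) := by positivity
    linarith
  have h1 := hS _ hdis
  rw [Finset.sum_image hinj] at h1
  have h2 := (le_abs_self _).trans_lt h1
  have hkp := hpos k
  have h3 : (Finset.range (⌊Λ k⌋₊ + 1)).card • (1 / (Λ k * ζ₂))
      ≤ ∑ j ∈ Finset.range (⌊Λ k⌋₊ + 1), 1 / Λ (m j) := by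
    refine Finset.card_nsmul_le_sum _ _ _ fun j hj => ?_
    refine one_div_le_one_div_of_le (hpos _) ?_
    rw [hm j (hfl j hj)]
    have := mul_le_mul_of_nonneg_right (hfl j hj) hδ.le
    linarith
  rw [Finset.card_range, nsmul_eq_mul] at h3
  have h4 : 1 / ζ₂ ≤ ((⌊Λ k⌋₊ + 1 : ℕ) : ℝ) * (1 / (Λ k * ζ₂)) := by
    have := (Nat.lt_floor_add_one (Λ k)).le
    push_cast
    rw [mul_one_div, div_le_div_iff₀ hζ₂ (by positivity)]
    nlinarith
  linarith
end

section
/- Let φ : [0,1] → [0,1] be Borel measurable with α = ess sup_{[0,1]} φ, and for ε > 0 let V_ε = {x ∈ [0,1] : dist(x, 𝔐_φ) < ε}. Then for every ε > 0, the essential supremum of φ over [0,1] ∖ V_ε (with respect to Lebesgue measure restricted to that set) is strictly less than α. -/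
open MeasureTheory

/-- The essential supremum of `φ` over the subset `s` of `[0,1]`, with respect to
Lebesgue measure, computed in `EReal` (so that the essential supremum over a null set
is `⊥ = -∞`). -/
noncomputable def essSupOn (φ : ℝ → ℝ) (s : Set ℝ) : EReal :=
  essSup (fun x => ((φ x : ℝ) : EReal)) (m01.restrict s)

/-- The set `𝔐_φ` of essential points of maximum of `φ`: points `x ∈ [0,1]` such that
the essential supremum of `φ` over every relative neighborhood of `x` in `[0,1]` equals
the essential supremum of `φ` over `[0,1]`. -/
def essMaxPts (φ : ℝ → ℝ) : Set ℝ :=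
  {x | x ∈ Set.Icc (0 : ℝ) 1 ∧
    ∀ E ∈ nhdsWithin x (Set.Icc (0 : ℝ) 1), essSupOn φ E = essSupOn φ Set.univ}

/-- The `ε`-neighborhood `V_ε = {x ∈ [0,1] : dist(x, 𝔐_φ) < ε}` of `𝔐_φ`. -/
def Veps (φ : ℝ → ℝ) (ε : ℝ) : Set ℝ :=
  {x | x ∈ Set.Icc (0 : ℝ) 1 ∧ Metric.infDist x (essMaxPts φ) < ε}

/-- For a Borel measurable `φ : [0,1] → [0,1]` and every `ε > 0`, the
essential supremum of `φ` over `[0,1] ∖ V_ε` is strictly less than the essential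
supremum `α` of `φ` over `[0,1]`. -/
theorem essSup_off_Veps_lt
    (φ : ℝ → ℝ) (hmeas : Measurable φ)
    (hmaps : Set.MapsTo φ (Set.Icc (0 : ℝ) 1) (Set.Icc (0 : ℝ) 1)) :
    ∀ ε : ℝ, 0 < ε →
      essSupOn φ (Set.Icc (0 : ℝ) 1 \ Veps φ ε) < essSupOn φ Set.univ := by
  intro ε hε
  have hmono : ∀ s t : Set ℝ, s ⊆ t → essSupOn φ s ≤ essSupOn φ t := by
    intro s t hst
    exact essSup_mono_measure (Measure.restrict_mono hst le_rfl).absolutelyContinuous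
  have hbot : (⊥ : EReal) < essSupOn φ Set.univ := by
    rw [bot_lt_iff_ne_bot]
    intro h
    have h1 : ∀ᵐ x ∂(m01.restrict Set.univ), ((φ x : ℝ) : EReal) ≤ essSupOn φ Set.univ :=
      ae_le_essSup
    rw [h] at h1
    simp only [le_bot_iff, EReal.coe_ne_bot, Measure.restrict_univ] at h1
    have h2 : m01 = 0 := by simpa using h1
    have h3 : m01 Set.univ = 1 := by simp [m01]
    rw [h2] at h3
    simp at h3
  have hK : IsCompact (Set.Icc (0 : ℝ) 1 \ Veps φ ε) := by
    have : Set.Icc (0 : ℝ) 1 \ Veps φ ε =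
        Set.Icc (0 : ℝ) 1 ∩ {x | ε ≤ Metric.infDist x (essMaxPts φ)} := by
      ext x
      simp only [Veps, Set.mem_diff, Set.mem_inter_iff, Set.mem_setOf_eq, not_and, not_lt]
      tauto
    rw [this]
    exact isCompact_Icc.inter_right
      (isClosed_le continuous_const (Metric.continuous_infDist_pt _))
  refine hK.induction_on (p := fun s => essSupOn φ s < essSupOn φ Set.univ) ?_ ?_ ?_ ?_
  · have : essSupOn φ ∅ = ⊥ := by simp [essSupOn]
    rw [this]; exact hbot
  · intro s t hst ht
    exact (hmono s t hst).trans_lt ht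
  · intro s t hs ht
    refine lt_of_le_of_lt ?_ (max_lt hs ht)
    refine essSup_le_of_ae_le _ ?_
    have h1 : ∀ᵐ x ∂(m01.restrict s), ((φ x : ℝ) : EReal) ≤ essSupOn φ s := ae_le_essSup
    have h2 : ∀ᵐ x ∂(m01.restrict t), ((φ x : ℝ) : EReal) ≤ essSupOn φ t := ae_le_essSup
    refine (ae_restrict_union_iff s t _).2 ⟨?_, ?_⟩
    · filter_upwards [h1] with x hx using hx.trans (le_max_left _ _)
    · filter_upwards [h2] with x hx using hx.trans (le_max_right _ _)
  · rintro x ⟨hx, hxV⟩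
    have hxM : x ∉ essMaxPts φ := by
      intro hM
      exact hxV ⟨hx, by rw [Metric.infDist_zero_of_mem hM]; exact hε⟩
    have : ∃ E ∈ nhdsWithin x (Set.Icc (0 : ℝ) 1), essSupOn φ E ≠ essSupOn φ Set.univ := by
      by_contra hcon
      push Not at hcon
      exact hxM ⟨hx, hcon⟩
    obtain ⟨E, hE, hne⟩ := this
    exact ⟨E, nhdsWithin_mono x Set.diff_subset hE,
      lt_of_le_of_ne (hmono E _ (Set.subset_univ _)) hne⟩
end

section
/- Let φ : [0,1] → [0,1] be Borel measurable with α = ess sup_{[0,1]} φ, and for ε > 0 let V_ε = {x ∈ [0,1] : dist(x, 𝔐_φ) < ε}. Then for every ε > 0 there exists δ₀ > 0 such that for every 0 < δ < δ₀, the set φ^{-1}([α−δ, α]) is contained in V_ε up to a set of Lebesgue measure zero. -/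
open MeasureTheory

/-- For a Borel measurable `φ : [0,1] → [0,1]` with essential supremum
`α`, for every `ε > 0` there exists `δ₀ > 0` such that for `0 < δ < δ₀` the set
`φ⁻¹([α−δ, α])` is contained in `V_ε` up to a Lebesgue null set. -/
theorem preimage_near_max_subset_Veps
    (φ : ℝ → ℝ) (hmeas : Measurable φ)
    (hmaps : Set.MapsTo φ (Set.Icc (0 : ℝ) 1) (Set.Icc (0 : ℝ) 1))
    (α : ℝ) (hα : essSupOn φ Set.univ = (α : EReal)) :
    ∀ ε : ℝ, 0 < ε → ∃ δ₀ : ℝ, 0 < δ₀ ∧ ∀ δ : ℝ, 0 < δ → δ < δ₀ →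
      volume (({x ∈ Set.Icc (0 : ℝ) 1 | φ x ∈ Set.Icc (α - δ) α}) \ Veps φ ε) = 0 := by
  intro ε hε
  set K : Set ℝ := {x | x ∈ Set.Icc (0 : ℝ) 1 ∧ ε ≤ Metric.infDist x (essMaxPts φ)} with hK
  have hKc : IsCompact K := by
    have : K = Set.Icc (0 : ℝ) 1 ∩ {x | ε ≤ Metric.infDist x (essMaxPts φ)} := rfl
    rw [this]
    exact isCompact_Icc.inter_right
      (isClosed_le continuous_const (Metric.continuous_infDist_pt _))
  have key : ∃ δ₀ : ℝ, 0 < δ₀ ∧ ∀ δ : ℝ, δ < δ₀ →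
      volume ({x ∈ Set.Icc (0 : ℝ) 1 | α - δ ≤ φ x} ∩ K) = 0 := by
    refine hKc.induction_on (p := fun S => ∃ δ₀ : ℝ, 0 < δ₀ ∧ ∀ δ : ℝ, δ < δ₀ →
      volume ({x ∈ Set.Icc (0 : ℝ) 1 | α - δ ≤ φ x} ∩ S) = 0) ?_ ?_ ?_ ?_
    · exact ⟨1, one_pos, by simp⟩
    · rintro s t hst ⟨d, hd, h⟩
      exact ⟨d, hd, fun δ hδ => measure_mono_null (Set.inter_subset_inter_right _ hst) (h δ hδ)⟩
    · rintro s t ⟨d, hd, h⟩ ⟨d', hd', h'⟩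
      refine ⟨min d d', lt_min hd hd', fun δ hδ => ?_⟩
      rw [Set.inter_union_distrib_left]
      exact measure_union_null (h δ (hδ.trans_le (min_le_left _ _)))
        (h' δ (hδ.trans_le (min_le_right _ _)))
    · rintro x ⟨hx, hxε⟩
      have hxM : x ∉ essMaxPts φ := by
        intro hM
        rw [Metric.infDist_zero_of_mem hM] at hxε
        linarith
      have : ∃ E ∈ nhdsWithin x (Set.Icc (0 : ℝ) 1), essSupOn φ E ≠ essSupOn φ Set.univ := by
        by_contra hcon
        push Not at hcon
        exact hxM ⟨hx, hcon⟩
      obtain ⟨E, hE, hne⟩ := this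
      have hle : essSupOn φ E ≤ essSupOn φ Set.univ :=
        essSup_mono_measure (Measure.restrict_mono (Set.subset_univ _) le_rfl).absolutelyContinuous
      have hlt := lt_of_le_of_ne hle hne
      rw [hα] at hlt
      obtain ⟨b, hb1, hb2⟩ := EReal.lt_iff_exists_real_btwn.1 hlt
      have hb : b < α := by exact_mod_cast hb2
      refine ⟨E, nhdsWithin_mono x (fun y hy => hy.1) hE, α - b, by linarith, fun δ hδ => ?_⟩
      have hae := ae_lt_of_essSup_lt hb1
      have hae2 : ∀ᵐ y ∂(m01.restrict E), φ y < b := by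
        filter_upwards [hae] with y hy
        exact_mod_cast hy
      rw [m01, Measure.restrict_restrict' measurableSet_Icc, ae_iff, Measure.restrict_apply
        (show MeasurableSet {a | ¬ φ a < b} from
          (measurableSet_lt hmeas measurable_const).compl)] at hae2
      refine measure_mono_null ?_ hae2
      rintro y ⟨⟨hy, hy1⟩, hyE⟩
      refine ⟨?_, hyE, hy⟩
      simp only [Set.mem_setOf_eq, not_lt]
      linarith
  obtain ⟨d, hd, h⟩ := key
  refine ⟨d, hd, fun δ _ hδ => measure_mono_null ?_ (h δ hδ)⟩
  rintro x ⟨⟨hx, hx1⟩, hx2⟩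
  refine ⟨⟨hx, hx1.1⟩, hx, ?_⟩
  by_contra hc
  exact hx2 ⟨hx, not_le.1 hc⟩
end

section
/- Let φ : [0,1] → [0,1] be Borel measurable with ess sup_{[0,1]} φ = 1, with finite set of essential points of maximum 𝔐_φ = {x_1, …, x_k}, and with φ(x_i) = 1 for each i. Let μ = φ*m be the pushforward of Lebesgue measure under φ. If for some s ≥ 1 there exist ε > 0 and a constant c > 0 such that |x − x_i| ≤ c|φ(x) − 1|^s for every x ∈ [0,1] with |x − x_i| < ε, for each i = 1, …, k, then there exists δ₀ > 0 such that μ([1−δ, 1]) ≤ 2kc·δ^s whenever 0 < δ < δ₀. -/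
open MeasureTheory

/-- Suppose `φ : [0,1] → [0,1]` is Borel measurable with
`ess sup φ = 1`, with finitely many essential points of maximum `x_1, …, x_k` at which
`φ = 1`, and `μ = φ*m`. If for some `s ≥ 1` there are `ε > 0` and `c > 0` with
`|x − x_i| ≤ c|φ(x) − 1|^s` whenever `|x − x_i| < ε`, then there is `δ₀ > 0` such that
`μ([1−δ,1]) ≤ 2kc·δ^s` for all `0 < δ < δ₀`. -/
theorem pushforward_measure_near_one_bound
    (φ : ℝ → ℝ) (hmeas : Measurable φ)
    (hmaps : Set.MapsTo φ (Set.Icc (0 : ℝ) 1) (Set.Icc (0 : ℝ) 1))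
    (hsup : essSupOn φ Set.univ = (1 : EReal))
    (k : ℕ) (xs : Fin k → ℝ) (hM : essMaxPts φ = Set.range xs)
    (hone : ∀ i, φ (xs i) = 1)
    (s : ℝ) (hs : 1 ≤ s) (ε : ℝ) (hε : 0 < ε) (c : ℝ) (hc : 0 < c)
    (hcond : ∀ i : Fin k, ∀ x ∈ Set.Icc (0 : ℝ) 1,
      |x - xs i| < ε → |x - xs i| ≤ c * |φ x - 1| ^ s) :
    ∃ δ₀ : ℝ, 0 < δ₀ ∧ ∀ δ : ℝ, 0 < δ → δ < δ₀ →
      (Measure.map φ m01) (Set.Icc (1 - δ) 1) ≤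
        ENNReal.ofReal (2 * (k : ℝ) * c * δ ^ s) := by
  classical
  have hK : IsCompact (Set.Icc (0 : ℝ) 1 \ ⋃ i, Metric.ball (xs i) ε) :=
    isCompact_Icc.diff (isOpen_iUnion fun i => Metric.isOpen_ball)
  have key : ∃ η : ℝ, 0 < η ∧
      m01 ({x | 1 - η ≤ φ x} ∩ (Set.Icc (0 : ℝ) 1 \ ⋃ i, Metric.ball (xs i) ε)) = 0 := by
    refine hK.induction_on (p := fun S => ∃ η : ℝ, 0 < η ∧ m01 ({x | 1 - η ≤ φ x} ∩ S) = 0)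
      ?_ ?_ ?_ ?_
    · exact ⟨1, one_pos, by simp⟩
    · rintro S T hST ⟨η, h0, h⟩
      exact ⟨η, h0, measure_mono_null (Set.inter_subset_inter_right _ hST) h⟩
    · rintro S T ⟨η, h0, h⟩ ⟨η', h0', h'⟩
      refine ⟨min η η', lt_min h0 h0', measure_mono_null ?_ (measure_union_null h h')⟩
      rintro x ⟨hx, hx' | hx'⟩
      · left
        refine ⟨?_, hx'⟩
        have := min_le_left η η'
        simp only [Set.mem_setOf_eq] at hx ⊢
        linarith
      · right
        refine ⟨?_, hx'⟩
        have := min_le_right η η'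
        simp only [Set.mem_setOf_eq] at hx ⊢
        linarith
    · rintro y ⟨hy, hyb⟩
      have hyM : y ∉ essMaxPts φ := by
        rw [hM]
        rintro ⟨i, rfl⟩
        exact hyb (Set.mem_iUnion.2 ⟨i, Metric.mem_ball_self hε⟩)
      have hyE : ∃ E ∈ nhdsWithin y (Set.Icc (0 : ℝ) 1),
          essSupOn φ E ≠ essSupOn φ Set.univ := by
        by_contra hcon
        push Not at hcon
        exact hyM ⟨hy, hcon⟩
      obtain ⟨E, hE, hne⟩ := hyE
      have hle : essSupOn φ E ≤ essSupOn φ Set.univ := by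
        unfold essSupOn
        exact essSup_mono_measure
          (Measure.absolutelyContinuous_of_le (Measure.restrict_mono_set _ (Set.subset_univ E)))
      have hlt : essSupOn φ E < 1 := hsup ▸ lt_of_le_of_ne hle hne
      obtain ⟨q, hq1, hq2⟩ := EReal.lt_iff_exists_real_btwn.1 hlt
      have hq : q < 1 := by exact_mod_cast hq2
      have hae := ae_lt_of_essSup_lt hq1
      refine ⟨E, nhdsWithin_mono _ Set.diff_subset hE, 1 - q, by linarith, ?_⟩
      rw [← Measure.restrict_apply (measurableSet_le measurable_const hmeas)]
      refine measure_mono_null ?_ (ae_iff.1 hae)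
      intro x hx
      simp only [Set.mem_setOf_eq, not_lt, EReal.coe_le_coe_iff] at hx ⊢
      linarith
  obtain ⟨η, hη, hnull⟩ := key
  refine ⟨η, hη, fun δ hδ hδη => ?_⟩
  rw [Measure.map_apply hmeas measurableSet_Icc, m01,
    Measure.restrict_apply (hmeas measurableSet_Icc)]
  have hsub : φ ⁻¹' Set.Icc (1 - δ) 1 ∩ Set.Icc (0 : ℝ) 1 ⊆
      (({x | 1 - η ≤ φ x} ∩ (Set.Icc (0 : ℝ) 1 \ ⋃ i, Metric.ball (xs i) ε)) ∩
        Set.Icc (0 : ℝ) 1) ∪ ⋃ i, Metric.closedBall (xs i) (c * δ ^ s) := by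
    rintro x ⟨⟨h1, h2⟩, hx⟩
    by_cases hb : x ∈ ⋃ i, Metric.ball (xs i) ε
    · right
      obtain ⟨i, hi⟩ := Set.mem_iUnion.1 hb
      rw [Metric.mem_ball, Real.dist_eq] at hi
      refine Set.mem_iUnion.2 ⟨i, ?_⟩
      rw [Metric.mem_closedBall, Real.dist_eq]
      refine (hcond i x hx hi).trans ?_
      have h3 : |φ x - 1| ≤ δ := by
        rw [abs_le]
        constructor <;> linarith
      exact mul_le_mul_of_nonneg_left
        (Real.rpow_le_rpow (abs_nonneg _) h3 (by linarith)) hc.le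
    · left
      refine ⟨⟨?_, hx, hb⟩, hx⟩
      simp only [Set.mem_setOf_eq]
      linarith
  have hnull' : volume (({x | 1 - η ≤ φ x} ∩
      (Set.Icc (0 : ℝ) 1 \ ⋃ i, Metric.ball (xs i) ε)) ∩ Set.Icc (0 : ℝ) 1) = 0 := by
    rw [m01, Measure.restrict_apply' measurableSet_Icc] at hnull
    exact hnull
  refine (measure_mono hsub).trans ((measure_union_le _ _).trans ?_)
  rw [hnull', zero_add]
  refine (measure_iUnion_fintype_le _ _).trans ?_
  simp only [Real.volume_closedBall, Finset.sum_const, Finset.card_univ, Fintype.card_fin,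
    nsmul_eq_mul]
  rw [← ENNReal.ofReal_natCast, ← ENNReal.ofReal_mul (Nat.cast_nonneg k)]
  apply le_of_eq
  congr 1
  ring
end
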